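/- There is no Coxeter decomposition of the second type of the hyperbolic simplex H_12^5 with fundamental simplex H_5^5. -/

import Mathlib

noncomputable section

namespace CD

open MeasureTheory Set
open scoped ENNReal

/-! ## Coxeter diagrams, encoded as Coxeter matrices.
A Coxeter diagram on `k` nodes is encoded by its Coxeter matrix
`M : Matrix (Fin k) (Fin k) ℕ`: `M i i = 1`, and for `i ≠ j` the entry `M i j = m`
means that the corresponding facets meet at the dihedral angle `π / m`
(`2` = no edge of the diagram, and `0` encodes the label `∞`, i.e. angle `0`,
consistently with `π / 0 = 0` in Lean). -/

/-- A Coxeter diagram: a number of nodes together with a Coxeter matrix. -/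
def CM : Type := Σ k : ℕ, Matrix (Fin k) (Fin k) ℕ

/-- The Coxeter matrix on `k` nodes with the given list of labelled edges
(`(i, j, m)` is an edge between nodes `i` and `j` with label `m`). -/
def cmOfEdges (k : ℕ) (E : List (ℕ × ℕ × ℕ)) : Matrix (Fin k) (Fin k) ℕ :=
  Matrix.of fun i j =>
    if i = j then 1 else
      match E.find? (fun e => (e.1 == (i : ℕ) && e.2.1 == (j : ℕ)) ||
                              (e.1 == (j : ℕ) && e.2.1 == (i : ℕ))) with
      | some e => e.2.2
      | none => 2

/-- The Coxeter matrix of type `A_k`. -/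
def cmA (k : ℕ) : Matrix (Fin k) (Fin k) ℕ :=
  Matrix.of fun i j =>
    if i = j then 1
    else if (i : ℕ) + 1 = (j : ℕ) ∨ (j : ℕ) + 1 = (i : ℕ) then 3 else 2

/-- The Coxeter matrix of type `D_k`, with the conventions `D_2 = A_1 + A_1` and
`D_3 = A_3`. -/
def cmD (k : ℕ) : Matrix (Fin k) (Fin k) ℕ :=
  Matrix.of fun i j =>
    if i = j then 1
    else if k = 2 then 2
    else if ((i : ℕ) + 1 = (j : ℕ) ∧ (j : ℕ) ≤ k - 2) ∨
            ((j : ℕ) + 1 = (i : ℕ) ∧ (i : ℕ) ≤ k - 2) ∨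
            ((i : ℕ) = k - 3 ∧ (j : ℕ) = k - 1) ∨
            ((j : ℕ) = k - 3 ∧ (i : ℕ) = k - 1)
      then 3 else 2

/-- Direct sum (disjoint union) of two Coxeter matrices. -/
def cmSum {a b : ℕ} (M : Matrix (Fin a) (Fin a) ℕ) (N : Matrix (Fin b) (Fin b) ℕ) :
    Matrix (Fin (a + b)) (Fin (a + b)) ℕ :=
  Matrix.of fun i j =>
    if hi : (i : ℕ) < a then
      if hj : (j : ℕ) < a then M ⟨i, hi⟩ ⟨j, hj⟩ else 2
    else
      if _hj : (j : ℕ) < a then 2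
      else N ⟨(i : ℕ) - a, by have := i.isLt; omega⟩ ⟨(j : ℕ) - a, by have := j.isLt; omega⟩

def cmAdd (x y : CM) : CM := ⟨x.1 + y.1, cmSum x.2 y.2⟩

def cmNil : CM := ⟨0, Matrix.of fun _ _ => 1⟩

/-- Disjoint union of a list of Coxeter diagrams. -/
def cmList (l : List CM) : CM := l.foldr cmAdd cmNil

def cA (k : ℕ) : CM := ⟨k, cmA k⟩
def cD (k : ℕ) : CM := ⟨k, cmD k⟩
def cE6 : CM := ⟨6, cmOfEdges 6 [(0,1,3),(1,2,3),(2,3,3),(3,4,3),(2,5,3)]⟩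
def cE7 : CM := ⟨7, cmOfEdges 7 [(0,1,3),(1,2,3),(2,3,3),(3,4,3),(4,5,3),(2,6,3)]⟩
def cE8 : CM := ⟨8, cmOfEdges 8 [(0,1,3),(1,2,3),(2,3,3),(3,4,3),(4,5,3),(5,6,3),(2,7,3)]⟩
def cF4 : CM := ⟨4, cmOfEdges 4 [(0,1,3),(1,2,4),(2,3,3)]⟩
def cH3 : CM := ⟨3, cmOfEdges 3 [(0,1,5),(1,2,3)]⟩
def cH4 : CM := ⟨4, cmOfEdges 4 [(0,1,5),(1,2,3),(2,3,3)]⟩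
/-- `G₂^{(5)} = I₂(5)`. -/
def cG25 : CM := ⟨2, cmOfEdges 2 [(0,1,5)]⟩

/-- The affine (Euclidean) Coxeter matrix `Ã₃` (a 4-cycle). -/
def cmA3t : Matrix (Fin 4) (Fin 4) ℕ := cmOfEdges 4 [(0,1,3),(1,2,3),(2,3,3),(0,3,3)]
/-- The affine Coxeter matrix `D̃₄`. -/
def cmD4t : Matrix (Fin 5) (Fin 5) ℕ := cmOfEdges 5 [(0,1,3),(0,2,3),(0,3,3),(0,4,3)]
/-- The affine Coxeter matrix `C̃₄`. -/
def cmC4t : Matrix (Fin 5) (Fin 5) ℕ := cmOfEdges 5 [(0,1,4),(1,2,3),(2,3,3),(3,4,4)]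
/-- The affine Coxeter matrix `F̃₄`. -/
def cmF4t : Matrix (Fin 5) (Fin 5) ℕ := cmOfEdges 5 [(0,1,3),(1,2,3),(2,3,4),(3,4,3)]
/-- The affine Coxeter matrix `C̃₂` (the Euclidean (2,4,4)-triangle). -/
def cmC2t : Matrix (Fin 3) (Fin 3) ℕ := cmOfEdges 3 [(0,1,4),(1,2,4)]
/-- The affine Coxeter matrix `G̃₂` (the Euclidean (2,3,6)-triangle). -/
def cmG2t : Matrix (Fin 3) (Fin 3) ℕ := cmOfEdges 3 [(0,1,6),(1,2,3)]

/-- Connectedness of a Coxeter diagram. -/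
def cmConnected (c : CM) : Prop :=
  ∀ i j : Fin c.1, Relation.ReflTransGen (fun a b => 3 ≤ c.2 a b ∨ c.2 a b = 0) i j

/-! ## Hyperbolic space `H^n`: the hyperboloid model. -/

/-- The Minkowski bilinear form of signature `(n,1)` on `ℝ^{n+1}`. -/
def mink (n : ℕ) (x y : EuclideanSpace ℝ (Fin (n + 1))) : ℝ :=
  -(x 0 * y 0) + ∑ i : Fin n, x i.succ * y i.succ

/-- The hyperboloid model of hyperbolic `n`-space:
`{x ∈ ℝ^{n+1} : ⟨x,x⟩ = -1, x₀ > 0}`. -/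
def hypSet (n : ℕ) : Set (EuclideanSpace ℝ (Fin (n + 1))) :=
  {x | mink n x x = -1 ∧ 0 < x 0}

/-- The closed half-space of `H^n` with (spacelike unit) outward normal `v`. -/
def hHalf (n : ℕ) (v : EuclideanSpace ℝ (Fin (n + 1))) : Set ↥(hypSet n) :=
  {x | mink n v x.val ≤ 0}

/-- The hyperplane of `H^n` with (spacelike unit) normal `v`. -/
def hWall (n : ℕ) (v : EuclideanSpace ℝ (Fin (n + 1))) : Set ↥(hypSet n) :=
  {x | mink n v x.val = 0}

/-- Projection of the hyperboloid to the Beltrami–Klein ball. -/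
def klein (n : ℕ) (x : ↥(hypSet n)) : Fin n → ℝ := fun i => x.val i.succ / x.val 0

/-- The hyperbolic (Riemannian) volume of a subset of `H^n`, computed in the
Beltrami–Klein model, where the volume element is `(1-|y|²)^{-(n+1)/2} dy`. -/
def hVol (n : ℕ) (S : Set ↥(hypSet n)) : ℝ≥0∞ :=
  ∫⁻ y in klein n '' S,
    ENNReal.ofReal ((1 - ∑ i, y i ^ 2) ^ (-((n : ℝ) + 1) / 2)) ∂(volume)

/-- An isometry of `H^n`: a bijection preserving the Minkowski product
(equivalently, the hyperbolic distance `arcosh(-⟨x,y⟩)`). -/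
def hIsIsom (n : ℕ) (g : ↥(hypSet n) → ↥(hypSet n)) : Prop :=
  Function.Bijective g ∧ ∀ x y, mink n (g x).val (g y).val = mink n x.val y.val

/-- Two subsets of `H^n` are congruent if an isometry carries one onto the other. -/
def hCongr (n : ℕ) (A B : Set ↥(hypSet n)) : Prop :=
  ∃ g, hIsIsom n g ∧ g '' A = B

/-- The ambient reflection of `ℝ^{n+1}` in the hyperplane with spacelike unit normal `v`. -/
def hReflect (n : ℕ) (v x : EuclideanSpace ℝ (Fin (n + 1))) :
    EuclideanSpace ℝ (Fin (n + 1)) :=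
  x - (2 * mink n v x) • v

/-- `S` is a facet ((n-1)-dimensional face) of the polyhedron `P ⊆ H^n`:
`S = P ∩ Π` for a supporting hyperplane `Π` of `P`, and `S` lies in no other
hyperplane (so it is genuinely `(n-1)`-dimensional). -/
def hIsFacet (n : ℕ) (P S : Set ↥(hypSet n)) : Prop :=
  S.Nonempty ∧ ∃ v, mink n v v = 1 ∧ P ⊆ hHalf n v ∧ S = P ∩ hWall n v ∧
    ∀ u, mink n u u = 1 → S ⊆ hWall n u → hWall n u = hWall n v

/-- A convex polyhedron in `H^n`: an intersection of finitely many closed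
half-spaces with nonempty interior and finite volume. -/
def hIsPoly (n : ℕ) (P : Set ↥(hypSet n)) : Prop :=
  ∃ (k : ℕ) (v : Fin k → EuclideanSpace ℝ (Fin (n + 1))),
    (∀ i, mink n (v i) (v i) = 1) ∧ P = ⋂ i, hHalf n (v i) ∧
    (interior P).Nonempty ∧ hVol n P < ⊤

/-- A Coxeter polyhedron in `H^n`: a convex polyhedron all of whose dihedral
angles are of the form `π/k`, `k ≥ 2` (the dihedral angle along a ridge with
outward unit normals `u, v` is `π/k` iff `⟨u,v⟩ = -cos (π/k)`). -/
def hIsCoxPoly (n : ℕ) (P : Set ↥(hypSet n)) : Prop :=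
  ∃ (k : ℕ) (v : Fin k → EuclideanSpace ℝ (Fin (n + 1))),
    (∀ i, mink n (v i) (v i) = 1) ∧ P = ⋂ i, hHalf n (v i) ∧
    (interior P).Nonempty ∧ hVol n P < ⊤ ∧
    ∀ i j, hWall n (v i) ≠ hWall n (v j) →
      (∃ x ∈ P, x ∈ hWall n (v i) ∩ hWall n (v j)) →
      ∃ m : ℕ, 2 ≤ m ∧ mink n (v i) (v j) = -Real.cos (Real.pi / (m : ℝ))

/-- A simplex in `H^n` (possibly with ideal vertices): a convex polyhedron with
exactly `n+1` facets. -/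
def hIsSimplex (n : ℕ) (P : Set ↥(hypSet n)) : Prop :=
  hIsPoly n P ∧ {S | hIsFacet n P S}.ncard = n + 1

/-- A Coxeter decomposition of `P ⊆ H^n`: a decomposition of `P` into finitely
many tiles with pairwise disjoint interiors, each tile a Coxeter polyhedron,
such that any two tiles having a common facet are symmetric with respect to
(the hyperplane of) this facet. -/
def hIsCoxDecomp (n : ℕ) (P : Set ↥(hypSet n)) (𝒯 : Set (Set ↥(hypSet n))) : Prop :=
  𝒯.Finite ∧ 𝒯.Nonempty ∧ (∀ T ∈ 𝒯, hIsCoxPoly n T) ∧ ⋃₀ 𝒯 = P ∧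
  (∀ T₁ ∈ 𝒯, ∀ T₂ ∈ 𝒯, T₁ ≠ T₂ → interior T₁ ∩ interior T₂ = ∅) ∧
  (∀ T₁ ∈ 𝒯, ∀ T₂ ∈ 𝒯, T₁ ≠ T₂ → ∀ S, hIsFacet n T₁ S → hIsFacet n T₂ S →
    ∃ v, mink n v v = 1 ∧ S ⊆ hWall n v ∧
      T₂ = {y | ∃ x ∈ T₁, (y : EuclideanSpace ℝ (Fin (n + 1))) = hReflect n v x.val})

/-- A hyperplane (with unit normal `v`) is a mirror of the decomposition `𝒯` of `P`
if it contains a facet of some tile but no facet of `P`. -/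
def hIsMirror (n : ℕ) (P : Set ↥(hypSet n)) (𝒯 : Set (Set ↥(hypSet n)))
    (v : EuclideanSpace ℝ (Fin (n + 1))) : Prop :=
  mink n v v = 1 ∧ (∃ T ∈ 𝒯, ∃ S, hIsFacet n T S ∧ S ⊆ hWall n v) ∧
  ¬∃ S, hIsFacet n P S ∧ S ⊆ hWall n v

/-- The decomposition `𝒯` of `P` is of the second type: every dihedral angle of `P`
is fundamental, i.e. no mirror contains the intersection of two facets of `P`. -/
def hSecondType (n : ℕ) (P : Set ↥(hypSet n)) (𝒯 : Set (Set ↥(hypSet n))) : Prop :=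
  ∀ α β, hIsFacet n P α → hIsFacet n P β → α ≠ β → (α ∩ β).Nonempty →
    ¬∃ v, hIsMirror n P 𝒯 v ∧ α ∩ β ⊆ hWall n v

/-- Decompositions obtainable by the inductive algorithm (decompositions of the
first type), with fundamental simplex `F`: start from (isometric copies of) `F`,
and repeatedly glue two previously obtained decomposed simplices along a common
facet so that the union is again a simplex and the union of the two
decompositions is a Coxeter decomposition of it. -/
inductive hFirstType (n : ℕ) (F : Set ↥(hypSet n)) :
    Set ↥(hypSet n) → Set (Set ↥(hypSet n)) → Prop
  | base (P : Set ↥(hypSet n)) : hCongr n F P → hIsSimplex n P → hFirstType n F P {P}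
  | congr (P : Set ↥(hypSet n)) (𝒯 : Set (Set ↥(hypSet n)))
      (g : ↥(hypSet n) → ↥(hypSet n)) :
      hIsIsom n g → hFirstType n F P 𝒯 → hFirstType n F (g '' P) ((fun T => g '' T) '' 𝒯)
  | glue (P₁ P₂ : Set ↥(hypSet n)) (𝒯₁ 𝒯₂ : Set (Set ↥(hypSet n))) (S : Set ↥(hypSet n)) :
      hFirstType n F P₁ 𝒯₁ → hFirstType n F P₂ 𝒯₂ →
      hIsFacet n P₁ S → hIsFacet n P₂ S →
      interior P₁ ∩ interior P₂ = ∅ →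
      hIsSimplex n (P₁ ∪ P₂) →
      hIsCoxDecomp n (P₁ ∪ P₂) (𝒯₁ ∪ 𝒯₂) →
      hFirstType n F (P₁ ∪ P₂) (𝒯₁ ∪ 𝒯₂)

/-- A vertex of the simplex `P ⊆ H^n`: a point of `P` lying on at least `n` facets. -/
def hIsVertex (n : ℕ) (P : Set ↥(hypSet n)) (x : ↥(hypSet n)) : Prop :=
  x ∈ P ∧ n ≤ {S | hIsFacet n P S ∧ x ∈ S}.ncard

/-- The cone over `S ⊆ H^n` in `ℝ^{n+1}`. -/
def hCone (n : ℕ) (S : Set ↥(hypSet n)) : Set (EuclideanSpace ℝ (Fin (n + 1))) :=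
  {y | ∃ x ∈ S, ∃ t : ℝ, 0 < t ∧ y = t • (x : EuclideanSpace ℝ (Fin (n + 1)))}

/-- The ideal vertices of `P ⊆ H^n`: lightlike directions (normalized by `w₀ = 1`)
in the closure of the cone over `P`. -/
def hIdealVerts (n : ℕ) (P : Set ↥(hypSet n)) : Set (EuclideanSpace ℝ (Fin (n + 1))) :=
  {w | mink n w w = 0 ∧ w 0 = 1 ∧ w ∈ closure (hCone n P)}

/-- The ideal vertex `w` of `P` has horospherical link of the Euclidean type given
by the (affine) Coxeter matrix `M`: the facets of `P` incident to `w` can be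
indexed so that their unit normals have Gram matrix `-cos (π / M i j)`. -/
def hIdealLink (n : ℕ) (P : Set ↥(hypSet n)) (w : EuclideanSpace ℝ (Fin (n + 1)))
    {k : ℕ} (M : Matrix (Fin k) (Fin k) ℕ) : Prop :=
  ∃ e : Fin k → EuclideanSpace ℝ (Fin (n + 1)),
    (∀ i, mink n (e i) (e i) = 1) ∧
    (∀ i, mink n (e i) w = 0) ∧
    (∀ i j, i ≠ j → mink n (e i) (e j) = -Real.cos (Real.pi / (M i j : ℝ))) ∧
    (∀ i j, i ≠ j → hWall n (e i) ≠ hWall n (e j)) ∧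
    {S | hIsFacet n P S ∧ w ∈ closure (hCone n S)} =
      Set.range fun i => P ∩ hWall n (e i)

/-- The number of tiles of `𝒯` incident to the ideal point `w`. -/
def hTilesAt (n : ℕ) (𝒯 : Set (Set ↥(hypSet n)))
    (w : EuclideanSpace ℝ (Fin (n + 1))) : ℕ :=
  {T | T ∈ 𝒯 ∧ w ∈ closure (hCone n T)}.ncard

/-- An occurrence, in the Coxeter diagram of `P`, of a subdiagram of type `M`:
a set `𝒜` of `k` facets of `P` whose unit normals have Gram matrix
`-cos (π / M i j)`. -/
def hSubOcc (n : ℕ) (P : Set ↥(hypSet n)) {k : ℕ} (M : Matrix (Fin k) (Fin k) ℕ)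
    (𝒜 : Set (Set ↥(hypSet n))) : Prop :=
  ∃ e : Fin k → EuclideanSpace ℝ (Fin (n + 1)),
    (∀ i, mink n (e i) (e i) = 1) ∧
    (∀ i j, i ≠ j → mink n (e i) (e j) = -Real.cos (Real.pi / (M i j : ℝ))) ∧
    (∀ i, hIsFacet n P (P ∩ hWall n (e i))) ∧
    𝒜 = Set.range (fun i => P ∩ hWall n (e i)) ∧ 𝒜.ncard = k

/-- The polyhedron `P ⊆ H^n` is a Coxeter simplex with Coxeter diagram (matrix) `M`. -/
def hOfType (n : ℕ) (P : Set ↥(hypSet n)) {k : ℕ} (M : Matrix (Fin k) (Fin k) ℕ) : Prop :=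
  (∀ i, M i i = 1) ∧ (∀ i j, M i j = M j i) ∧
  ∃ e : Fin k → EuclideanSpace ℝ (Fin (n + 1)),
    (∀ i, mink n (e i) (e i) = 1) ∧
    (∀ i j, i ≠ j → mink n (e i) (e j) = -Real.cos (Real.pi / (M i j : ℝ))) ∧
    P = ⋂ i, hHalf n (e i) ∧ (∀ i, hIsFacet n P (P ∩ hWall n (e i)))

/-- Equivalence of two decompositions of the same polyhedron `P`, up to an
isometry preserving `P`. -/
def hDecompEquiv (n : ℕ) (P : Set ↥(hypSet n)) (𝒯₁ 𝒯₂ : Set (Set ↥(hypSet n))) : Prop :=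
  ∃ g, hIsIsom n g ∧ g '' P = P ∧ (fun T => g '' T) '' 𝒯₁ = 𝒯₂

/-- A Coxeter decomposition of the second type of `P` with fundamental simplex `F`. -/
def hSTDecomp (n : ℕ) (P F : Set ↥(hypSet n)) (𝒯 : Set (Set ↥(hypSet n))) : Prop :=
  hIsCoxDecomp n P 𝒯 ∧ (∀ T ∈ 𝒯, hCongr n F T) ∧ hSecondType n P 𝒯

def hCoxSimplex (n : ℕ) (P : Set ↥(hypSet n)) : Prop := hIsCoxPoly n P ∧ hIsSimplex n P

/-! ## The sphere `S^n ⊂ ℝ^{n+1}`. -/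

/-- The Euclidean dot product on `ℝ^{n+1}`. -/
def sdot (n : ℕ) (x y : EuclideanSpace ℝ (Fin (n + 1))) : ℝ := ∑ i, x i * y i

/-- The unit sphere `S^n ⊂ ℝ^{n+1}`. -/
def sSet (n : ℕ) : Set (EuclideanSpace ℝ (Fin (n + 1))) := {x | sdot n x x = 1}

/-- The closed hemisphere of `S^n` with (unit) outward normal `v`. -/
def sHalf (n : ℕ) (v : EuclideanSpace ℝ (Fin (n + 1))) : Set ↥(sSet n) :=
  {x | sdot n v x.val ≤ 0}

/-- The great hypersphere of `S^n` with (unit) normal `v`. -/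
def sWall (n : ℕ) (v : EuclideanSpace ℝ (Fin (n + 1))) : Set ↥(sSet n) :=
  {x | sdot n v x.val = 0}

/-- The spherical (Riemannian) volume of `S ⊆ S^n`: `(n+1)` times the Lebesgue
measure of the cone over `S` truncated at radius `1`. -/
def sVol (n : ℕ) (S : Set ↥(sSet n)) : ℝ≥0∞ :=
  ((n : ℝ≥0∞) + 1) *
    volume {y : Fin (n + 1) → ℝ | ∃ x ∈ S, ∃ t : ℝ, 0 < t ∧ t ≤ 1 ∧
      y = fun i => t * (x : EuclideanSpace ℝ (Fin (n + 1))) i}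

/-- An isometry of `S^n`: a bijection preserving the dot product (equivalently,
the spherical distance). -/
def sIsIsom (n : ℕ) (g : ↥(sSet n) → ↥(sSet n)) : Prop :=
  Function.Bijective g ∧ ∀ x y, sdot n (g x).val (g y).val = sdot n x.val y.val

def sCongr (n : ℕ) (A B : Set ↥(sSet n)) : Prop := ∃ g, sIsIsom n g ∧ g '' A = B

/-- The ambient reflection of `ℝ^{n+1}` in the hyperplane with unit normal `v`. -/
def sReflect (n : ℕ) (v x : EuclideanSpace ℝ (Fin (n + 1))) :
    EuclideanSpace ℝ (Fin (n + 1)) :=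
  x - (2 * sdot n v x) • v

/-- `S` is a facet of the spherical polyhedron `P`. -/
def sIsFacet (n : ℕ) (P S : Set ↥(sSet n)) : Prop :=
  S.Nonempty ∧ ∃ v, sdot n v v = 1 ∧ P ⊆ sHalf n v ∧ S = P ∩ sWall n v ∧
    ∀ u, sdot n u u = 1 → S ⊆ sWall n u → sWall n u = sWall n v

/-- A convex polyhedron in `S^n`. -/
def sIsPoly (n : ℕ) (P : Set ↥(sSet n)) : Prop :=
  ∃ (k : ℕ) (v : Fin k → EuclideanSpace ℝ (Fin (n + 1))),
    (∀ i, sdot n (v i) (v i) = 1) ∧ P = ⋂ i, sHalf n (v i) ∧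
    (interior P).Nonempty ∧ sVol n P < ⊤

/-- A Coxeter polyhedron in `S^n`. -/
def sIsCoxPoly (n : ℕ) (P : Set ↥(sSet n)) : Prop :=
  ∃ (k : ℕ) (v : Fin k → EuclideanSpace ℝ (Fin (n + 1))),
    (∀ i, sdot n (v i) (v i) = 1) ∧ P = ⋂ i, sHalf n (v i) ∧
    (interior P).Nonempty ∧ sVol n P < ⊤ ∧
    ∀ i j, sWall n (v i) ≠ sWall n (v j) →
      (∃ x ∈ P, x ∈ sWall n (v i) ∩ sWall n (v j)) →
      ∃ m : ℕ, 2 ≤ m ∧ sdot n (v i) (v j) = -Real.cos (Real.pi / (m : ℝ))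

/-- A spherical simplex in `S^n`: the intersection of `S^n` with a simplicial cone,
i.e. a convex spherical polyhedron with exactly `n+1` facets. -/
def sIsSimplex (n : ℕ) (P : Set ↥(sSet n)) : Prop :=
  sIsPoly n P ∧ {S | sIsFacet n P S}.ncard = n + 1

/-- A Coxeter decomposition of `P ⊆ S^n`. -/
def sIsCoxDecomp (n : ℕ) (P : Set ↥(sSet n)) (𝒯 : Set (Set ↥(sSet n))) : Prop :=
  𝒯.Finite ∧ 𝒯.Nonempty ∧ (∀ T ∈ 𝒯, sIsCoxPoly n T) ∧ ⋃₀ 𝒯 = P ∧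
  (∀ T₁ ∈ 𝒯, ∀ T₂ ∈ 𝒯, T₁ ≠ T₂ → interior T₁ ∩ interior T₂ = ∅) ∧
  (∀ T₁ ∈ 𝒯, ∀ T₂ ∈ 𝒯, T₁ ≠ T₂ → ∀ S, sIsFacet n T₁ S → sIsFacet n T₂ S →
    ∃ v, sdot n v v = 1 ∧ S ⊆ sWall n v ∧
      T₂ = {y | ∃ x ∈ T₁, (y : EuclideanSpace ℝ (Fin (n + 1))) = sReflect n v x.val})

/-- Mirrors of a spherical Coxeter decomposition. -/
def sIsMirror (n : ℕ) (P : Set ↥(sSet n)) (𝒯 : Set (Set ↥(sSet n)))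
    (v : EuclideanSpace ℝ (Fin (n + 1))) : Prop :=
  sdot n v v = 1 ∧ (∃ T ∈ 𝒯, ∃ S, sIsFacet n T S ∧ S ⊆ sWall n v) ∧
  ¬∃ S, sIsFacet n P S ∧ S ⊆ sWall n v

/-- Second type: every dihedral angle of `P` is fundamental. -/
def sSecondType (n : ℕ) (P : Set ↥(sSet n)) (𝒯 : Set (Set ↥(sSet n))) : Prop :=
  ∀ α β, sIsFacet n P α → sIsFacet n P β → α ≠ β → (α ∩ β).Nonempty →
    ¬∃ v, sIsMirror n P 𝒯 v ∧ α ∩ β ⊆ sWall n v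

/-- `P ⊆ S^n` is a Coxeter simplex with Coxeter diagram (matrix) `M`. -/
def sOfType (n : ℕ) (P : Set ↥(sSet n)) {k : ℕ} (M : Matrix (Fin k) (Fin k) ℕ) : Prop :=
  (∀ i, M i i = 1) ∧ (∀ i j, M i j = M j i) ∧
  ∃ e : Fin k → EuclideanSpace ℝ (Fin (n + 1)),
    (∀ i, sdot n (e i) (e i) = 1) ∧
    (∀ i j, i ≠ j → sdot n (e i) (e j) = -Real.cos (Real.pi / (M i j : ℝ))) ∧
    P = ⋂ i, sHalf n (e i) ∧ (∀ i, sIsFacet n P (P ∩ sWall n (e i)))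

/-- `P ⊆ S^n` is a Coxeter simplex of the type given by the diagram `c`. -/
def sOfTypeCM (n : ℕ) (P : Set ↥(sSet n)) (c : CM) : Prop := sOfType n P c.2

/-! ## Euclidean space `E^n`. -/

/-- The dot product on `E^n`. -/
def edot (n : ℕ) (x y : EuclideanSpace ℝ (Fin n)) : ℝ := ∑ i, x i * y i

/-- The closed affine half-space `{x : ⟨v,x⟩ ≤ c}` of `E^n`. -/
def eHalf (n : ℕ) (v : EuclideanSpace ℝ (Fin n)) (c : ℝ) : Set (EuclideanSpace ℝ (Fin n)) :=
  {x | edot n v x ≤ c}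

/-- The affine hyperplane `{x : ⟨v,x⟩ = c}` of `E^n`. -/
def eWall (n : ℕ) (v : EuclideanSpace ℝ (Fin n)) (c : ℝ) : Set (EuclideanSpace ℝ (Fin n)) :=
  {x | edot n v x = c}

/-- Reflection of `E^n` in the affine hyperplane `{x : ⟨v,x⟩ = c}` (`v` a unit vector). -/
def eReflect (n : ℕ) (v : EuclideanSpace ℝ (Fin n)) (c : ℝ) (x : EuclideanSpace ℝ (Fin n)) :
    EuclideanSpace ℝ (Fin n) :=
  x - (2 * (edot n v x - c)) • v

/-- An isometry of `E^n`. -/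
def eIsIsom (n : ℕ) (g : EuclideanSpace ℝ (Fin n) → EuclideanSpace ℝ (Fin n)) : Prop :=
  Function.Bijective g ∧ ∀ x y, dist (g x) (g y) = dist x y

def eCongr (n : ℕ) (A B : Set (EuclideanSpace ℝ (Fin n))) : Prop :=
  ∃ g, eIsIsom n g ∧ g '' A = B

/-- A similarity transformation of `E^n` carries `A` onto `B`. -/
def eSimilar (n : ℕ) (A B : Set (EuclideanSpace ℝ (Fin n))) : Prop :=
  ∃ (f : EuclideanSpace ℝ (Fin n) → EuclideanSpace ℝ (Fin n)) (r : ℝ), 0 < r ∧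
    Function.Surjective f ∧ (∀ x y, dist (f x) (f y) = r * dist x y) ∧ f '' A = B

/-- `S` is a facet of the Euclidean polyhedron `P`. -/
def eIsFacet (n : ℕ) (P S : Set (EuclideanSpace ℝ (Fin n))) : Prop :=
  S.Nonempty ∧ ∃ v c, edot n v v = 1 ∧ P ⊆ eHalf n v c ∧ S = P ∩ eWall n v c ∧
    ∀ u d, edot n u u = 1 → S ⊆ eWall n u d → eWall n u d = eWall n v c

/-- A convex polyhedron in `E^n`. -/
def eIsPoly (n : ℕ) (P : Set (EuclideanSpace ℝ (Fin n))) : Prop :=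
  ∃ (k : ℕ) (v : Fin k → EuclideanSpace ℝ (Fin n)) (c : Fin k → ℝ),
    (∀ i, edot n (v i) (v i) = 1) ∧ P = ⋂ i, eHalf n (v i) (c i) ∧
    (interior P).Nonempty ∧ volume P < ⊤

/-- A Coxeter polyhedron in `E^n`. -/
def eIsCoxPoly (n : ℕ) (P : Set (EuclideanSpace ℝ (Fin n))) : Prop :=
  ∃ (k : ℕ) (v : Fin k → EuclideanSpace ℝ (Fin n)) (c : Fin k → ℝ),
    (∀ i, edot n (v i) (v i) = 1) ∧ P = ⋂ i, eHalf n (v i) (c i) ∧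
    (interior P).Nonempty ∧ volume P < ⊤ ∧
    ∀ i j, eWall n (v i) (c i) ≠ eWall n (v j) (c j) →
      (∃ x ∈ P, x ∈ eWall n (v i) (c i) ∩ eWall n (v j) (c j)) →
      ∃ m : ℕ, 2 ≤ m ∧ edot n (v i) (v j) = -Real.cos (Real.pi / (m : ℝ))

/-- A simplex in `E^n`: a convex polyhedron with exactly `n+1` facets. -/
def eIsSimplex (n : ℕ) (P : Set (EuclideanSpace ℝ (Fin n))) : Prop :=
  eIsPoly n P ∧ {S | eIsFacet n P S}.ncard = n + 1

/-- A Coxeter decomposition of `P ⊆ E^n`. -/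
def eIsCoxDecomp (n : ℕ) (P : Set (EuclideanSpace ℝ (Fin n)))
    (𝒯 : Set (Set (EuclideanSpace ℝ (Fin n)))) : Prop :=
  𝒯.Finite ∧ 𝒯.Nonempty ∧ (∀ T ∈ 𝒯, eIsCoxPoly n T) ∧ ⋃₀ 𝒯 = P ∧
  (∀ T₁ ∈ 𝒯, ∀ T₂ ∈ 𝒯, T₁ ≠ T₂ → interior T₁ ∩ interior T₂ = ∅) ∧
  (∀ T₁ ∈ 𝒯, ∀ T₂ ∈ 𝒯, T₁ ≠ T₂ → ∀ S, eIsFacet n T₁ S → eIsFacet n T₂ S →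
    ∃ v c, edot n v v = 1 ∧ S ⊆ eWall n v c ∧ T₂ = eReflect n v c '' T₁)

/-- Mirrors of a Euclidean Coxeter decomposition. -/
def eIsMirror (n : ℕ) (P : Set (EuclideanSpace ℝ (Fin n)))
    (𝒯 : Set (Set (EuclideanSpace ℝ (Fin n))))
    (v : EuclideanSpace ℝ (Fin n)) (c : ℝ) : Prop :=
  edot n v v = 1 ∧ (∃ T ∈ 𝒯, ∃ S, eIsFacet n T S ∧ S ⊆ eWall n v c) ∧
  ¬∃ S, eIsFacet n P S ∧ S ⊆ eWall n v c

/-- Second type: every dihedral angle of `P` is fundamental. -/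
def eSecondType (n : ℕ) (P : Set (EuclideanSpace ℝ (Fin n)))
    (𝒯 : Set (Set (EuclideanSpace ℝ (Fin n)))) : Prop :=
  ∀ α β, eIsFacet n P α → eIsFacet n P β → α ≠ β → (α ∩ β).Nonempty →
    ¬∃ v c, eIsMirror n P 𝒯 v c ∧ α ∩ β ⊆ eWall n v c

/-- `P ⊆ E^n` is a Coxeter simplex with Coxeter diagram (matrix) `M`. -/
def eOfType (n : ℕ) (P : Set (EuclideanSpace ℝ (Fin n))) {k : ℕ}
    (M : Matrix (Fin k) (Fin k) ℕ) : Prop :=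
  (∀ i, M i i = 1) ∧ (∀ i j, M i j = M j i) ∧
  ∃ (e : Fin k → EuclideanSpace ℝ (Fin n)) (c : Fin k → ℝ),
    (∀ i, edot n (e i) (e i) = 1) ∧
    (∀ i j, i ≠ j → edot n (e i) (e j) = -Real.cos (Real.pi / (M i j : ℝ))) ∧
    P = ⋂ i, eHalf n (e i) (c i) ∧ (∀ i, eIsFacet n P (P ∩ eWall n (e i) (c i)))

/-! ## The particular non-compact hyperbolic Coxeter simplices occurring in the
classification, identified by the structural data given in the paper
(dimension, compactness, number and types of ideal vertices, subdiagrams of the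
Coxeter diagram, and (relative) volumes). -/

/-- The Coxeter simplex `H₃⁴ ⊂ H⁴`: non-compact, with exactly one ideal vertex,
whose horospherical link is of Euclidean type `Ã₃`; volume `≈ 0.01370778`. -/
def IsH34 {n : ℕ} (P : Set ↥(hypSet n)) : Prop :=
  n = 4 ∧ hCoxSimplex n P ∧ ¬IsCompact P ∧ (hIdealVerts n P).ncard = 1 ∧
  (∀ w ∈ hIdealVerts n P, hIdealLink n P w cmA3t) ∧
  hVol n P ∈ Set.Ioo (ENNReal.ofReal 0.0137077) (ENNReal.ofReal 0.0137078)

/-- The Coxeter simplex `H₉⁴ ⊂ H⁴`: non-compact, with exactly three ideal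
vertices, each of type `Ã₃`, of volume exactly `10` times that of `H₃⁴`. -/
def IsH94 {n : ℕ} (P : Set ↥(hypSet n)) : Prop :=
  n = 4 ∧ hCoxSimplex n P ∧ ¬IsCompact P ∧ (hIdealVerts n P).ncard = 3 ∧
  (∀ w ∈ hIdealVerts n P, hIdealLink n P w cmA3t) ∧
  ∀ F : Set ↥(hypSet n), IsH34 F → hVol n P = 10 * hVol n F

/-- The Coxeter simplex `H₄⁵ ⊂ H⁵`: non-compact, of volume `≈ 0.0010956247`. -/
def IsH45 {n : ℕ} (P : Set ↥(hypSet n)) : Prop :=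
  n = 5 ∧ hCoxSimplex n P ∧ ¬IsCompact P ∧
  hVol n P ∈ Set.Ioo (ENNReal.ofReal 0.0010956) (ENNReal.ofReal 0.0010957)

/-- The Coxeter simplex `H₅⁵ ⊂ H⁵`: non-compact, of volume `≈ 0.0018260413`,
whose Coxeter diagram contains exactly one parabolic subdiagram of type `C̃₄`
and exactly one of type `F̃₄`. -/
def IsH55 {n : ℕ} (P : Set ↥(hypSet n)) : Prop :=
  n = 5 ∧ hCoxSimplex n P ∧ ¬IsCompact P ∧
  {𝒜 | hSubOcc n P cmC4t 𝒜}.ncard = 1 ∧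
  {𝒜 | hSubOcc n P cmF4t 𝒜}.ncard = 1 ∧
  hVol n P ∈ Set.Ioo (ENNReal.ofReal 0.0018260) (ENNReal.ofReal 0.0018261)

/-- The Coxeter simplex `H₇⁵ ⊂ H⁵`: non-compact, of volume `≈ 0.0036520826`,
with three ideal vertices, whose Coxeter diagram contains no parabolic
subdiagram of type `D̃₄`. -/
def IsH75 {n : ℕ} (P : Set ↥(hypSet n)) : Prop :=
  n = 5 ∧ hCoxSimplex n P ∧ ¬IsCompact P ∧ (hIdealVerts n P).ncard = 3 ∧
  (¬∃ 𝒜, hSubOcc n P cmD4t 𝒜) ∧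
  hVol n P ∈ Set.Ioo (ENNReal.ofReal 0.0036520) (ENNReal.ofReal 0.0036521)

/-- The Coxeter simplex `H₁₁⁵ ⊂ H⁵`: non-compact, with five ideal vertices, one
of which has horospherical link of Euclidean type `D̃₄`; its volume is exactly
`20` times that of `H₄⁵` (and exactly `6` times that of `H₇⁵`). -/
def IsH115 {n : ℕ} (P : Set ↥(hypSet n)) : Prop :=
  n = 5 ∧ hCoxSimplex n P ∧ ¬IsCompact P ∧ (hIdealVerts n P).ncard = 5 ∧
  (∃ w ∈ hIdealVerts n P, hIdealLink n P w cmD4t) ∧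
  (∀ F : Set ↥(hypSet n), IsH45 F → hVol n P = 20 * hVol n F) ∧
  (∀ F : Set ↥(hypSet n), IsH75 F → hVol n P = 6 * hVol n F)

/-- The Coxeter simplex `H₁₂⁵ ⊂ H⁵`: non-compact, whose Coxeter diagram contains
exactly two parabolic subdiagrams of type `C̃₄` and exactly four of type `F̃₄`;
its volume is exactly `16` times that of `H₅⁵`. -/
def IsH125 {n : ℕ} (P : Set ↥(hypSet n)) : Prop :=
  n = 5 ∧ hCoxSimplex n P ∧ ¬IsCompact P ∧
  {𝒜 | hSubOcc n P cmC4t 𝒜}.ncard = 2 ∧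
  {𝒜 | hSubOcc n P cmF4t 𝒜}.ncard = 4 ∧
  ∀ F : Set ↥(hypSet n), IsH55 F → hVol n P = 16 * hVol n F

/-- The Coxeter simplex `H₁⁸ ⊂ H⁸`: the non-compact Coxeter simplex of minimal
volume in `H⁸`, with exactly one ideal vertex. -/
def IsH18 {n : ℕ} (P : Set ↥(hypSet n)) : Prop :=
  n = 8 ∧ hCoxSimplex n P ∧ ¬IsCompact P ∧ (hIdealVerts n P).ncard = 1 ∧
  ∀ Q : Set ↥(hypSet n), hCoxSimplex n Q → ¬IsCompact Q → hVol n P ≤ hVol n Q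

/-- The Coxeter simplex `H₄⁸ ⊂ H⁸`: non-compact, with exactly two ideal
vertices, whose Coxeter diagram contains a subdiagram of type `A₈`; its volume
is exactly `272` times that of `H₁⁸`. -/
def IsH48 {n : ℕ} (P : Set ↥(hypSet n)) : Prop :=
  n = 8 ∧ hCoxSimplex n P ∧ ¬IsCompact P ∧ (hIdealVerts n P).ncard = 2 ∧
  (∃ 𝒜, hSubOcc n P (cmA 8) 𝒜) ∧
  ∀ F : Set ↥(hypSet n), IsH18 F → hVol n P = 272 * hVol n F

/-- The Coxeter simplex `H₁⁹ ⊂ H⁹`: the non-compact Coxeter simplex of minimal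
volume in `H⁹`, with exactly one ideal vertex. -/
def IsH19 {n : ℕ} (P : Set ↥(hypSet n)) : Prop :=
  n = 9 ∧ hCoxSimplex n P ∧ ¬IsCompact P ∧ (hIdealVerts n P).ncard = 1 ∧
  ∀ Q : Set ↥(hypSet n), hCoxSimplex n Q → ¬IsCompact Q → hVol n P ≤ hVol n Q

/-- The Coxeter simplex `H₃⁹ ⊂ H⁹`: non-compact, with exactly three ideal
vertices; its volume is exactly `527` times that of `H₁⁹`. -/
def IsH39 {n : ℕ} (P : Set ↥(hypSet n)) : Prop :=
  n = 9 ∧ hCoxSimplex n P ∧ ¬IsCompact P ∧ (hIdealVerts n P).ncard = 3 ∧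
  ∀ F : Set ↥(hypSet n), IsH19 F → hVol n P = 527 * hVol n F


/-- Twice the pairing of the `i`-th rescaled normal of the path simplex with `∑ u j f j`. -/
def lin (i : Fin 6) (u : Fin 6 → ℝ) : ℝ :=
  ![4 * u 0 - 2 * u 1, 2 * u 1 - 2 * u 0 - u 2, 2 * u 2 - u 1 - u 3,
    2 * u 3 - u 2 - 2 * u 4, 4 * u 4 - 2 * u 3 - 2 * u 5, 4 * u 5 - 2 * u 4] i

def bq (u v : Fin 6 → ℝ) : ℝ := ∑ i, u i * lin i v

lemma bq_eq (u v : Fin 6 → ℝ) : bq u v = u 0 * (4 * v 0 - 2 * v 1) + u 1 * (2 * v 1 - 2 * v 0 - v 2)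
    + u 2 * (2 * v 2 - v 1 - v 3) + u 3 * (2 * v 3 - v 2 - 2 * v 4)
    + u 4 * (4 * v 4 - 2 * v 3 - 2 * v 5) + u 5 * (4 * v 5 - 2 * v 4) := by
  simp [bq, Fin.sum_univ_six, lin]

/-- Twice the Gram matrix of the hexagon simplex, three normals rescaled; `s` selects which. -/
def hexQ : Bool → Fin 6 → Fin 6 → ℝ
  | true => ![![2, -1, 0, 0, 0, -2], ![-1, 2, -1, 0, 0, 0], ![0, -1, 2, -2, 0, 0],
      ![0, 0, -2, 4, -2, 0], ![0, 0, 0, -2, 4, -2], ![-2, 0, 0, 0, -2, 4]]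
  | false => ![![4, -2, 0, 0, 0, -2], ![-2, 4, -2, 0, 0, 0], ![0, -2, 4, -2, 0, 0],
      ![0, 0, -2, 2, -1, 0], ![0, 0, 0, -1, 2, -1], ![-2, 0, 0, 0, -1, 2]]

structure Chart (s : Bool) (M : Fin 6 → Fin 6 → ℝ) : Prop where
  nn : ∀ j i, 0 ≤ M j i
  gram : ∀ j l, bq (M j) (M l) = hexQ s j l
  mono : ∀ i, i = 0 ∨ i = 5 → ∀ j l, j ≠ l → M j i = 0 ∨ M l i = 0
  ridge : ∀ i j l, j ≠ l → ∀ u v : ℝ, (∀ n, n ≠ i → u * M j n + v * M l n = 0) →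
    u * M j i + v * M l i ≠ 0 → (∀ n, n ≠ i → M j n = 0) ∨ ∀ n, n ≠ i → M l n = 0

/-- The tile with matrix `M` is adapted to the flag `σ` of faces of the large simplex. -/
structure Flag (M : Fin 6 → Fin 6 → ℝ) (σ τ : Fin 6 → Fin 6) : Prop where
  inj : Function.Injective τ
  last : τ 5 = 0 ∨ τ 5 = 5
  row0 : M (σ 0) = Pi.single (τ 0) 1
  row1 : M (σ 1) = Pi.single (τ 1) 1
  pos : ∀ s, 0 < M (σ s) (τ s)
  zero : ∀ s t, s < t → 2 ≤ t → M (σ s) (τ t) = 0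

lemma bq_single (u : Fin 6 → ℝ) (i : Fin 6) : bq u (Pi.single i 1) = lin i u := by
  fin_cases i <;> simp [bq_eq, lin] <;> ring

lemma Chart.lin_eq {s : Bool} {M : Fin 6 → Fin 6 → ℝ} (hM : Chart s M) {l i : Fin 6}
    (h : M l = Pi.single i 1) (j : Fin 6) : lin i (M j) = hexQ s j l := by
  rw [← bq_single, ← h, hM.gram]

lemma Chart.col {s : Bool} {M : Fin 6 → Fin 6 → ℝ} (hM : Chart s M) {i : Fin 6} (hi : i = 0 ∨ i = 5)
    {j : Fin 6} (hj : 0 < M j i) (l : Fin 6) (hl : j ≠ l) : M l i = 0 :=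
  (hM.mono i hi j l hl).resolve_left hj.ne'

lemma Flag.nodup {M : Fin 6 → Fin 6 → ℝ} {σ τ : Fin 6 → Fin 6} (h : Flag M σ τ) :
    [τ 0, τ 1, τ 2, τ 3, τ 4, τ 5].Nodup := by
  have := List.nodup_ofFn.2 h.inj
  simpa [List.ofFn_succ] using this

structure Adapted (s : Bool) (M : Fin 6 → Fin 6 → ℝ) (i j p q t k : Fin 6) : Prop where
  ch : Chart s M
  a : M 1 = Pi.single i 1
  b : M 2 = Pi.single j 1
  dp : 0 < M 4 p
  xq : 0 < M 0 q
  ct : 0 < M 3 t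
  yk : 0 < M 5 k
  dz : ∀ n, n ≠ i → n ≠ j → n ≠ p → M 4 n = 0
  xz : ∀ n, n ≠ i → n ≠ j → n ≠ p → n ≠ q → M 0 n = 0
  cz : ∀ n, n ≠ i → n ≠ j → n ≠ p → n ≠ q → n ≠ t → M 3 n = 0
  nd : [i, j, p, q, t, k].Nodup
  hk : k = 0 ∨ k = 5
  bd : ∀ n, M 0 n ≤ (if s then 1 else 2) * (M 4 n + M 3 n) + M 2 n


lemma eq_one_of_mul_self {t : ℝ} (h : 0 < t) (h1 : t * t = 1) : t = 1 :=
  (mul_self_eq_one_iff.1 h1).resolve_right (by linarith)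

lemma Adapted.q_ne {s : Bool} {M : Fin 6 → Fin 6 → ℝ} {i j p q t k : Fin 6}
    (h : Adapted s M i j p q t k) : ¬ (q = 0 ∨ q = 5) := fun hq ↦ by
  have h1 := h.bd q
  rw [h.dz q (by have := h.nd; grind) (by have := h.nd; grind) (by have := h.nd; grind),
      h.ch.col hq h.xq 3 (by decide), h.ch.col hq h.xq 2 (by decide)] at h1
  have := h.xq
  simp at h1
  linarith

set_option maxRecDepth 100000 in
lemma perm_one_two : ∀ p q s k : Fin 6, [1, 2, p, q, s, k].Nodup → (k = 0 ∨ k = 5) →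
    ¬ (q = 0 ∨ q = 5) → p = 0 ∨ p = 3 ∧ q = 4 ∨ p = 4 ∧ q = 3 ∧ s = 0 ∧ k = 5 ∨
    p = 4 ∧ q = 3 ∧ s = 5 ∧ k = 0 ∨ p = 5 ∧ k = 0 ∧ (q = 3 ∨ q = 4) := by decide

lemma not_adapted_one_two_zero {M : Fin 6 → Fin 6 → ℝ} {q s k : Fin 6}
    (h : Adapted true M 1 2 0 q s k) : False := by
  have x0 := h.ch.col (.inl rfl) h.dp 0 (by decide)
  have da := h.ch.lin_eq h.a 4
  have db := h.ch.lin_eq h.b 4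
  have xa := h.ch.lin_eq h.a 0
  have xb := h.ch.lin_eq h.b 0
  have dx := h.ch.gram 4 0
  simp [lin, hexQ, bq_eq, h.dz, x0] at da db xa xb dx
  have : M 4 0 * M 0 1 * 2 + M 4 1 = 0 := by linear_combination -dx + M 4 1 * xa + M 4 2 * xb
  nlinarith [mul_nonneg h.dp.le (h.ch.nn 0 1), h.dp]

lemma not_adapted_one_two_three_four {M : Fin 6 → Fin 6 → ℝ} {s k : Fin 6}
    (h : Adapted true M 1 2 3 4 s k) : False := by
  have da := h.ch.lin_eq h.a 4
  have db := h.ch.lin_eq h.b 4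
  have dx := h.ch.gram 4 0
  have xa := h.ch.lin_eq h.a 0
  have xb := h.ch.lin_eq h.b 0
  have xx := h.ch.gram 0 0
  simp [lin, hexQ, bq_eq, h.dz, h.xz] at da db dx xa xb xx
  have e2 : M 0 2 = 2 * M 0 1 + 1 := by linarith
  have e3 : M 0 3 = 3 * M 0 1 + 2 := by linarith
  have f3 : M 4 3 * (6 * M 0 3 - 3 * M 0 2 - 6 * M 0 4 - 1) = 0 := by
    have : M 4 3 = 3 * M 4 1 := by linarith
    linear_combination 3 * dx - 3 * M 4 1 * xa - 3 * M 4 2 * xb - this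
  have e4 : M 0 4 = 2 * M 0 1 + 4 / 3 := by
    linarith [(mul_eq_zero.1 f3).resolve_left h.dp.ne']
  rw [e2, e3, e4] at xx
  nlinarith [h.ch.nn 0 1]

lemma adapted_one_two_four_three {M : Fin 6 → Fin 6 → ℝ} {s k : Fin 6}
    (h : Adapted true M 1 2 4 3 s k) :
    (M 4 1 = 0 ∧ M 4 2 = 0 ∧ M 4 4 = 1) ∧ M 0 1 = 0 ∧ M 0 2 = 1 ∧ M 0 3 = 2 ∧ M 0 4 = 1 := by
  have da := h.ch.lin_eq h.a 4
  have db := h.ch.lin_eq h.b 4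
  have dx := h.ch.gram 4 0
  have xa := h.ch.lin_eq h.a 0
  have xb := h.ch.lin_eq h.b 0
  have xx := h.ch.gram 0 0
  have dd := h.ch.gram 4 4
  simp [lin, hexQ, bq_eq, h.dz, h.xz] at da db dx xa xb xx dd
  have d1 : M 4 1 = 0 := by linarith
  have d2 : M 4 2 = 0 := by linarith
  have d4 : M 4 4 = 1 := by
    rw [d1, d2] at dd
    exact eq_one_of_mul_self h.dp (by linarith)
  have e2 : M 0 2 = 2 * M 0 1 + 1 := by linarith
  have e3 : M 0 3 = 3 * M 0 1 + 2 := by linarith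
  have e4 : M 0 4 = (3 * M 0 1 + 2) / 2 := by rw [d1, d2, d4] at dx; linarith
  have e1 : M 0 1 = 0 := by
    rw [e2, e3, e4] at xx
    nlinarith [h.ch.nn 0 1]
  rw [e1] at e2 e3 e4
  exact ⟨⟨d1, d2, d4⟩, e1, by linarith, by linarith, by linarith⟩

lemma not_adapted_one_two_four_three_zero {M : Fin 6 → Fin 6 → ℝ} (h : Adapted true M 1 2 4 3 0 5) :
    False := by
  obtain ⟨⟨d1, d2, d4⟩, x1, x2, x3, x4⟩ := adapted_one_two_four_three h
  have y0 := h.ch.col (.inl rfl) h.ct 5 (by decide)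
  have b3 := h.bd 3
  have dc := h.ch.gram 4 3
  have ca := h.ch.lin_eq h.a 3
  have cb := h.ch.lin_eq h.b 3
  have ya := h.ch.lin_eq h.a 5
  have yb := h.ch.lin_eq h.b 5
  have dy := h.ch.gram 4 5
  have xy := h.ch.gram 0 5
  have cy := h.ch.gram 3 5
  simp [lin, hexQ, bq_eq, h.dz, h.xz, h.cz, h.b, x1, x2, x3, x4, d1, d2, d4,
      y0] at dc ca cb ya yb dy xy cy b3
  have y3 : 2 * M 5 3 - M 5 2 - 2 * M 5 4 = 0 := by linarith
  rw [ya, yb, dy, y3] at cy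
  nlinarith [h.ch.nn 3 4, mul_nonneg (h.ch.nn 3 0) (h.ch.nn 5 1)]

lemma not_adapted_one_two_four_three_five {M : Fin 6 → Fin 6 → ℝ} (h : Adapted true M 1 2 4 3 5 0) :
    False := by
  obtain ⟨⟨d1, d2, d4⟩, x1, x2, x3, x4⟩ := adapted_one_two_four_three h
  have y5 := h.ch.col (.inr rfl) h.ct 5 (by decide)
  have b3 := h.bd 3
  have dc := h.ch.gram 4 3
  have ca := h.ch.lin_eq h.a 3
  have cb := h.ch.lin_eq h.b 3
  have xc := h.ch.gram 0 3
  have ya := h.ch.lin_eq h.a 5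
  have yb := h.ch.lin_eq h.b 5
  have dy := h.ch.gram 4 5
  have xy := h.ch.gram 0 5
  have cy := h.ch.gram 3 5
  simp [lin, hexQ, bq_eq, h.dz, h.xz, h.cz, h.b, x1, x2, x3, x4, d1, d2, d4,
      y5] at dc ca cb xc ya yb dy xy cy b3
  have y3 : 2 * M 5 3 - M 5 2 - 2 * M 5 4 = 0 := by linarith
  rw [ya, yb, dy, y3] at cy
  have := mul_nonneg (h.ch.nn 3 5) (h.ch.nn 5 4)
  linarith [h.ch.nn 3 4, h.ch.nn 3 5]

lemma not_adapted_one_two_five {M : Fin 6 → Fin 6 → ℝ} {q s : Fin 6}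
    (h : Adapted true M 1 2 5 q s 0) : False := by
  have x5 := h.ch.col (.inr rfl) h.dp 0 (by decide)
  have x0 : M 0 0 = 0 := by
    have := h.nd
    exact h.xz 0 (by decide) (by decide) (by decide) (by rintro rfl; simp at this)
  have da := h.ch.lin_eq h.a 4
  have db := h.ch.lin_eq h.b 4
  have xa := h.ch.lin_eq h.a 0
  have xb := h.ch.lin_eq h.b 0
  have dx := h.ch.gram 4 0
  have xx := h.ch.gram 0 0
  simp [lin, hexQ, bq_eq, h.dz, x0, x5] at da db xa xb dx xx
  have d1 : M 4 1 = 0 := by linarith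
  have d2 : M 4 2 = 0 := by linarith
  have x4 : M 0 4 = 0 := by
    rw [d1, d2] at dx
    simpa [h.dp.ne'] using dx
  have e2 : M 0 2 = 2 * M 0 1 + 1 := by linarith
  have e3 : M 0 3 = 3 * M 0 1 + 2 := by linarith
  rw [e2, e3, x4] at xx
  nlinarith [h.ch.nn 0 1]

lemma not_adapted_one_two {M : Fin 6 → Fin 6 → ℝ} {p q s k : Fin 6}
    (h : Adapted true M 1 2 p q s k) : False := by
  rcases perm_one_two p q s k h.nd h.hk h.q_ne with
    rfl | ⟨rfl, rfl⟩ | ⟨rfl, rfl, rfl, rfl⟩ | ⟨rfl, rfl, rfl, rfl⟩ | ⟨rfl, rfl, -⟩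
  exacts [not_adapted_one_two_zero h, not_adapted_one_two_three_four h,
      not_adapted_one_two_four_three_zero h, not_adapted_one_two_four_three_five h,
      not_adapted_one_two_five h]

set_option maxRecDepth 100000 in
lemma perm_two_one : ∀ p q s k : Fin 6, [2, 1, p, q, s, k].Nodup → (k = 0 ∨ k = 5) →
    ¬ (q = 0 ∨ q = 5) → p = 0 ∨ p = 3 ∧ q = 4 ∧ s = 0 ∧ k = 5 ∨ p = 3 ∧ q = 4 ∧ s = 5 ∧ k = 0 ∨
    p = 4 ∧ q = 3 ∧ s = 0 ∧ k = 5 ∨ p = 4 ∧ q = 3 ∧ s = 5 ∧ k = 0 ∨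
    p = 5 ∧ q = 4 ∧ k = 0 ∨ p = 5 ∧ q = 3 ∧ s = 4 ∧ k = 0 := by decide

lemma not_adapted_two_one_zero {M : Fin 6 → Fin 6 → ℝ} {q s k : Fin 6}
    (h : Adapted true M 2 1 0 q s k) : False := by
  have x0 := h.ch.col (.inl rfl) h.dp 0 (by decide)
  have da := h.ch.lin_eq h.a 4
  have db := h.ch.lin_eq h.b 4
  have xa := h.ch.lin_eq h.a 0
  have xb := h.ch.lin_eq h.b 0
  have dx := h.ch.gram 4 0
  simp [lin, hexQ, bq_eq, h.dz, x0] at da db xa xb dx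
  have : M 4 0 * M 0 1 * 2 + M 4 2 = 0 := by linear_combination -dx + M 4 2 * xa + M 4 1 * xb
  nlinarith [mul_nonneg h.dp.le (h.ch.nn 0 1), h.dp]

lemma adapted_two_one_three_four {M : Fin 6 → Fin 6 → ℝ} {s k : Fin 6}
    (h : Adapted true M 2 1 3 4 s k) :
    3 * M 4 1 = M 4 3 ∧ M 4 3 ^ 2 = 3 ∧ M 0 4 = 2 * M 0 1 + 2 / 3 ∧ M 0 4 ^ 2 = 4 / 3 ∧
    M 0 3 = M 4 3 ∧ M 0 2 = 2 * M 0 1 ∧ M 4 2 = 2 * M 4 1 := by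
  have da := h.ch.lin_eq h.a 4
  have db := h.ch.lin_eq h.b 4
  have dx := h.ch.gram 4 0
  have xa := h.ch.lin_eq h.a 0
  have xb := h.ch.lin_eq h.b 0
  have xx := h.ch.gram 0 0
  have dd := h.ch.gram 4 4
  simp [lin, hexQ, bq_eq, h.dz, h.xz] at da db dx xa xb xx dd
  have e2 : M 0 2 = 2 * M 0 1 := by linarith
  have e3 : M 0 3 = 3 * M 0 1 + 1 := by linarith
  have d2 : M 4 2 = 2 * M 4 1 := by linarith
  have d3 : M 4 3 = 3 * M 4 1 := by linarith
  have f3 : M 4 3 * (6 * M 0 3 - 3 * M 0 2 - 6 * M 0 4 - 2) = 0 := by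
    linear_combination 3 * dx - 3 * M 4 2 * xa - 3 * M 4 1 * xb - 2 * d3 + 3 * d2
  have e4 : M 0 4 = 2 * M 0 1 + 2 / 3 := by
    linarith [(mul_eq_zero.1 f3).resolve_left h.dp.ne']
  have s4 : M 0 4 ^ 2 = 4 / 3 := by
    rw [e2, e3, e4] at xx
    rw [e4]
    linarith
  have s3 : M 4 3 ^ 2 = 3 := by
    rw [d2, d3] at dd
    rw [d3]
    linarith
  refine ⟨d3.symm, s3, e4, s4, ?_, e2, d2⟩
  refine (sq_eq_sq₀ (h.ch.nn 0 3) h.dp.le).1 ?_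
  rw [s3, e3, show 3 * M 0 1 + 1 = 3 / 2 * M 0 4 by linarith, mul_pow, s4]
  norm_num

lemma not_adapted_two_one_three_four_zero {M : Fin 6 → Fin 6 → ℝ} (h : Adapted true M 2 1 3 4 0 5) :
    False := by
  obtain ⟨d1, s3, e4, s4, x3, x2, d2⟩ := adapted_two_one_three_four h
  have y0 := h.ch.col (.inl rfl) h.ct 5 (by decide)
  have dy := h.ch.gram 4 5
  have xy := h.ch.gram 0 5
  have cy := h.ch.gram 3 5
  have ya := h.ch.lin_eq h.a 5
  have yb := h.ch.lin_eq h.b 5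
  simp [lin, hexQ, bq_eq, h.dz, h.xz, h.cz, y0] at dy xy cy ya yb
  rw [ya, yb] at dy xy cy
  have y4 : M 0 4 * (4 * M 5 4 - 2 * M 5 3 - 2 * M 5 5) = 0 := by
    linear_combination xy - dy - (2 * M 5 3 - M 5 2 - 2 * M 5 4) * x3
  rw [(mul_eq_zero.1 y4).resolve_left h.xq.ne'] at cy
  have c3 : M 3 3 = 0 := by
    have : M 3 3 * 2 = -(M 4 3 *
        (M 3 0 * (2 * M 5 1))) := by linear_combination M 3 3 * dy - M 4 3 * cy
    have := mul_nonneg h.dp.le (mul_nonneg h.ct.le (h.ch.nn 5 1))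
    linarith [h.ch.nn 3 3]
  have b4 := h.bd 4
  have dc := h.ch.gram 4 3
  have xc := h.ch.gram 0 3
  have ca := h.ch.lin_eq h.a 3
  have cb := h.ch.lin_eq h.b 3
  simp [lin, hexQ, bq_eq, h.dz, h.xz, h.cz, c3, h.b] at dc xc ca cb b4
  rw [ca, cb] at dc xc
  have : M 0 4 * (4 * M 3 4) = 2 * M 0 1 + 2 - 2 * M 4 1 := by
    linear_combination xc - dc - (- M 3 2 - 2 * M 3 4) * x3
  nlinarith [h.ch.nn 4 1, h.xq]

lemma not_adapted_two_one_three_four_five {M : Fin 6 → Fin 6 → ℝ} (h : Adapted true M 2 1 3 4 5 0) :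
    False := by
  obtain ⟨d1, s3, e4, s4, x3, x2, d2⟩ := adapted_two_one_three_four h
  have y5 := h.ch.col (.inr rfl) h.ct 5 (by decide)
  have dy := h.ch.gram 4 5
  have xy := h.ch.gram 0 5
  have cy := h.ch.gram 3 5
  have ya := h.ch.lin_eq h.a 5
  have yb := h.ch.lin_eq h.b 5
  simp [lin, hexQ, bq_eq, h.dz, h.xz, h.cz, y5] at dy xy cy ya yb
  rw [ya, yb] at dy xy cy
  have y4 : M 0 4 * (4 * M 5 4 - 2 * M 5 3) = 0 := by
    linear_combination xy - dy - (2 * M 5 3 - M 5 2 - 2 * M 5 4) * x3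
  rw [(mul_eq_zero.1 y4).resolve_left h.xq.ne'] at cy
  have c3 : M 3 3 = 0 := by
    have : M 3 3 * 2 = -(M 4 3 *
        (M 3 5 * (2 * M 5 4))) := by linear_combination M 3 3 * dy - M 4 3 * cy
    have := mul_nonneg h.dp.le (mul_nonneg h.ct.le (h.ch.nn 5 4))
    linarith [h.ch.nn 3 3]
  have ca := h.ch.lin_eq h.a 3
  have cb := h.ch.lin_eq h.b 3
  simp [lin, hexQ, h.cz, c3] at ca cb
  linarith [h.ch.nn 3 2]

lemma adapted_two_one_four_three {M : Fin 6 → Fin 6 → ℝ} {s k : Fin 6}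
    (h : Adapted true M 2 1 4 3 s k) :
    (M 4 1 = 0 ∧ M 4 2 = 0 ∧ M 4 4 = 1) ∧
      M 0 1 = 1 / 3 ∧ M 0 2 = 2 / 3 ∧ M 0 3 = 2 ∧ M 0 4 = 1 := by
  have da := h.ch.lin_eq h.a 4
  have db := h.ch.lin_eq h.b 4
  have dx := h.ch.gram 4 0
  have xa := h.ch.lin_eq h.a 0
  have xb := h.ch.lin_eq h.b 0
  have xx := h.ch.gram 0 0
  have dd := h.ch.gram 4 4
  simp [lin, hexQ, bq_eq, h.dz, h.xz] at da db dx xa xb xx dd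
  have d1 : M 4 1 = 0 := by linarith
  have d2 : M 4 2 = 0 := by linarith
  have d4 : M 4 4 = 1 := by
    rw [d1, d2] at dd
    exact eq_one_of_mul_self h.dp (by linarith)
  have e2 : M 0 2 = 2 * M 0 1 := by linarith
  have e3 : M 0 3 = 3 * M 0 1 + 1 := by linarith
  have e4 : M 0 4 = (3 * M 0 1 + 1) / 2 := by rw [d1, d2, d4] at dx; linarith
  have e1 : M 0 1 = 1 / 3 := by
    rw [e2, e3, e4] at xx
    nlinarith [h.ch.nn 0 1]
  rw [e1] at e2 e3 e4
  exact ⟨⟨d1, d2, d4⟩, e1, by linarith, by linarith, by linarith⟩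

lemma not_adapted_two_one_four_three_zero {M : Fin 6 → Fin 6 → ℝ} (h : Adapted true M 2 1 4 3 0 5) :
    False := by
  obtain ⟨⟨d1, d2, d4⟩, x1, x2, x3, x4⟩ := adapted_two_one_four_three h
  have y := h.ch.col (.inl rfl) h.ct 5 (by decide)
  have b3 := h.bd 3
  have dc := h.ch.gram 4 3
  have ya := h.ch.lin_eq h.a 5
  have yb := h.ch.lin_eq h.b 5
  have dy := h.ch.gram 4 5
  have xy := h.ch.gram 0 5
  have cy := h.ch.gram 3 5
  simp [lin, hexQ, bq_eq, h.dz, h.xz, h.cz, h.b, x1, x2, x3, x4, d1, d2, d4,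
      y] at dc ya yb dy xy cy b3
  have y3 : 2 * M 5 3 - M 5 2 - 2 * M 5 4 = 0 := by linarith
  rw [ya, yb, dy, y3] at cy
  have := mul_nonneg (h.ch.nn 3 0) (h.ch.nn 5 1)
  linarith [h.ch.nn 3 4, h.ch.nn 3 5]

lemma not_adapted_two_one_four_three_five {M : Fin 6 → Fin 6 → ℝ} (h : Adapted true M 2 1 4 3 5 0) :
    False := by
  obtain ⟨⟨d1, d2, d4⟩, x1, x2, x3, x4⟩ := adapted_two_one_four_three h
  have y := h.ch.col (.inr rfl) h.ct 5 (by decide)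
  have b3 := h.bd 3
  have dc := h.ch.gram 4 3
  have ya := h.ch.lin_eq h.a 5
  have yb := h.ch.lin_eq h.b 5
  have dy := h.ch.gram 4 5
  have xy := h.ch.gram 0 5
  have cy := h.ch.gram 3 5
  simp [lin, hexQ, bq_eq, h.dz, h.xz, h.cz, h.b, x1, x2, x3, x4, d1, d2, d4,
      y] at dc ya yb dy xy cy b3
  have y3 : 2 * M 5 3 - M 5 2 - 2 * M 5 4 = 0 := by linarith
  rw [ya, yb, dy, y3] at cy
  have := mul_nonneg (h.ch.nn 3 5) (h.ch.nn 5 4)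
  linarith [h.ch.nn 3 4, h.ch.nn 3 5]

lemma not_adapted_two_one_five_four {M : Fin 6 → Fin 6 → ℝ} {s : Fin 6}
    (h : Adapted true M 2 1 5 4 s 0) : False := by
  have x5 := h.ch.col (.inr rfl) h.dp 0 (by decide)
  have da := h.ch.lin_eq h.a 4
  have db := h.ch.lin_eq h.b 4
  have dx := h.ch.gram 4 0
  simp [lin, hexQ, bq_eq, h.dz, x5] at da db dx
  have d1 : M 4 1 = 0 := by linarith
  have d2 : M 4 2 = 0 := by linarith
  rw [d1, d2] at dx
  linarith [mul_pos h.dp h.xq]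

lemma not_adapted_two_one_five_three {M : Fin 6 → Fin 6 → ℝ} (h : Adapted true M 2 1 5 3 4 0) :
    False := by
  have x5 := h.ch.col (.inr rfl) h.dp 0 (by decide)
  have c5 := h.ch.col (.inr rfl) h.dp 3 (by decide)
  have da := h.ch.lin_eq h.a 4
  have db := h.ch.lin_eq h.b 4
  have dd := h.ch.gram 4 4
  have xa := h.ch.lin_eq h.a 0
  have xb := h.ch.lin_eq h.b 0
  have xx := h.ch.gram 0 0
  have dc := h.ch.gram 4 3
  have xc := h.ch.gram 0 3
  have ca := h.ch.lin_eq h.a 3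
  have cb := h.ch.lin_eq h.b 3
  simp [lin, hexQ, bq_eq, h.dz, h.xz, h.cz, x5, c5] at da db dd xa xb xx dc xc ca cb
  have d1 : M 4 1 = 0 := by linarith
  have d2 : M 4 2 = 0 := by linarith
  have d5 : M 4 5 = 1 := by
    rw [d1, d2] at dd
    exact eq_one_of_mul_self h.dp (by linarith)
  have e2 : M 0 2 = 2 * M 0 1 := by linarith
  have e3 : M 0 3 = 3 * M 0 1 + 1 := by linarith
  have e1 : M 0 1 = 0 := by
    rw [e2, e3] at xx
    nlinarith [h.ch.nn 0 1]
  rw [d1, d2, d5] at dc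
  rw [e3, e2, e1] at xc
  linarith [h.ch.nn 3 1]

lemma not_adapted_two_one {M : Fin 6 → Fin 6 → ℝ} {p q s k : Fin 6}
    (h : Adapted true M 2 1 p q s k) : False := by
  rcases perm_two_one p q s k h.nd h.hk h.q_ne with
    rfl | ⟨rfl, rfl, rfl, rfl⟩ | ⟨rfl, rfl, rfl, rfl⟩ | ⟨rfl, rfl, rfl, rfl⟩ |
    ⟨rfl, rfl, rfl, rfl⟩ | ⟨rfl, rfl, rfl⟩ | ⟨rfl, rfl, rfl, rfl⟩
  exacts [not_adapted_two_one_zero h, not_adapted_two_one_three_four_zero h,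
      not_adapted_two_one_three_four_five h, not_adapted_two_one_four_three_zero h,
      not_adapted_two_one_four_three_five h, not_adapted_two_one_five_four h,
      not_adapted_two_one_five_three h]

lemma mid_absurd {D X X' L L' C C' e : ℝ} (hD : 0 < D) (hX' : 0 < X') (hC : 0 ≤ C)
    (h1 : D * L = -2) (h2 : X * L + X' * L' = -2) (h3 : C * L + C' * L' + e = 0) (he : e ≤ 0)
    (hX : X < D) (hb : X' ≤ C') : False := by
  have hL : L < 0 := by
    by_contra! hL
    linarith [mul_nonneg hD.le hL]
  have hL' : L' < 0 := by
    by_contra! hL'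
    nlinarith [mul_nonneg hX'.le hL']
  nlinarith [mul_nonneg hC (neg_nonneg.2 hL.le)]

set_option maxRecDepth 100000 in
set_option synthInstance.maxSize 1000 in
lemma perm_two_three : ∀ p q s k : Fin 6, [2, 3, p, q, s, k].Nodup → (k = 0 ∨ k = 5) →
    ¬ (q = 0 ∨ q = 5) → p = 0 ∧ q = 1 ∨ p = 0 ∧ q = 4 ∧ s = 1 ∧ k = 5 ∨
    p = 1 ∧ q = 4 ∧ s = 0 ∧ k = 5 ∨ p = 1 ∧ q = 4 ∧ s = 5 ∧ k = 0 ∨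
    p = 4 ∧ q = 1 ∧ s = 0 ∧ k = 5 ∨ p = 4 ∧ q = 1 ∧ s = 5 ∧ k = 0 ∨
    p = 5 ∧ q = 4 ∨ p = 5 ∧ q = 1 ∧ s = 4 ∧ k = 0 := by decide

lemma not_adapted_two_three_zero_one {M : Fin 6 → Fin 6 → ℝ} {s k : Fin 6}
    (h : Adapted true M 2 3 0 1 s k) : False := by
  have x0 := h.ch.col (.inl rfl) h.dp 0 (by decide)
  have da := h.ch.lin_eq h.a 4
  have db := h.ch.lin_eq h.b 4
  have dx := h.ch.gram 4 0
  simp [lin, hexQ, bq_eq, h.dz, x0] at da db dx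
  have d2 : M 4 2 = 0 := by linarith
  have d3 : M 4 3 = 0 := by linarith
  rw [d2, d3] at dx
  linarith [mul_pos h.dp h.xq]

lemma not_adapted_two_three_five_four {M : Fin 6 → Fin 6 → ℝ} {s k : Fin 6}
    (h : Adapted true M 2 3 5 4 s k) : False := by
  have x5 := h.ch.col (.inr rfl) h.dp 0 (by decide)
  have da := h.ch.lin_eq h.a 4
  have db := h.ch.lin_eq h.b 4
  have dx := h.ch.gram 4 0
  simp [lin, hexQ, bq_eq, h.dz, x5] at da db dx
  have d2 : M 4 2 = 0 := by linarith
  have d3 : M 4 3 = 0 := by linarith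
  rw [d2, d3] at dx
  linarith [mul_pos h.dp h.xq]

lemma not_adapted_three_two_zero_one {M : Fin 6 → Fin 6 → ℝ} {s k : Fin 6}
    (h : Adapted true M 3 2 0 1 s k) : False := by
  have x0 := h.ch.col (.inl rfl) h.dp 0 (by decide)
  have da := h.ch.lin_eq h.a 4
  have db := h.ch.lin_eq h.b 4
  have dx := h.ch.gram 4 0
  simp [lin, hexQ, bq_eq, h.dz, x0] at da db dx
  have d2 : M 4 2 = 0 := by linarith
  have d3 : M 4 3 = 0 := by linarith
  rw [d2, d3] at dx
  linarith [mul_pos h.dp h.xq]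

lemma not_adapted_three_two_five_four {M : Fin 6 → Fin 6 → ℝ} {s k : Fin 6}
    (h : Adapted true M 3 2 5 4 s k) : False := by
  have x5 := h.ch.col (.inr rfl) h.dp 0 (by decide)
  have da := h.ch.lin_eq h.a 4
  have db := h.ch.lin_eq h.b 4
  have dx := h.ch.gram 4 0
  simp [lin, hexQ, bq_eq, h.dz, x5] at da db dx
  have d2 : M 4 2 = 0 := by linarith
  have d3 : M 4 3 = 0 := by linarith
  rw [d2, d3] at dx
  linarith [mul_pos h.dp h.xq]

lemma not_adapted_two_three_zero_four {M : Fin 6 → Fin 6 → ℝ} (h : Adapted true M 2 3 0 4 1 5) :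
    False := by
  have x0 := h.ch.col (.inl rfl) h.dp 0 (by decide)
  have c0 := h.ch.col (.inl rfl) h.dp 3 (by decide)
  have da := h.ch.lin_eq h.a 4
  have db := h.ch.lin_eq h.b 4
  have dd := h.ch.gram 4 4
  have xa := h.ch.lin_eq h.a 0
  have xb := h.ch.lin_eq h.b 0
  have xx := h.ch.gram 0 0
  have dc := h.ch.gram 4 3
  have xc := h.ch.gram 0 3
  have ca := h.ch.lin_eq h.a 3
  have cb := h.ch.lin_eq h.b 3
  simp [lin, hexQ, bq_eq, h.dz, h.xz, h.cz, x0, c0] at da db dd xa xb xx dc xc ca cb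
  have d2 : M 4 2 = 0 := by linarith
  have d3 : M 4 3 = 0 := by linarith
  have d0 : M 4 0 = 1 := by
    rw [d2, d3] at dd
    exact eq_one_of_mul_self h.dp (by linarith)
  rw [d2, d3, d0] at dc
  have e3 : M 0 3 = 2 * M 0 2 + 1 := by linarith
  have e4 : M 0 4 = (3 * M 0 2 + 2) / 2 := by linarith
  have e2 : M 0 2 = 0 := by
    rw [e3, e4] at xx
    nlinarith [h.ch.nn 0 2]
  rw [e3, e4, e2] at xc
  linarith [h.ch.nn 3 3]

lemma not_adapted_three_two_zero_four {M : Fin 6 → Fin 6 → ℝ} (h : Adapted true M 3 2 0 4 1 5) :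
    False := by
  have x0 := h.ch.col (.inl rfl) h.dp 0 (by decide)
  have c0 := h.ch.col (.inl rfl) h.dp 3 (by decide)
  have da := h.ch.lin_eq h.a 4
  have db := h.ch.lin_eq h.b 4
  have dd := h.ch.gram 4 4
  have xa := h.ch.lin_eq h.a 0
  have xb := h.ch.lin_eq h.b 0
  have xx := h.ch.gram 0 0
  have dc := h.ch.gram 4 3
  have xc := h.ch.gram 0 3
  have ca := h.ch.lin_eq h.a 3
  have cb := h.ch.lin_eq h.b 3
  simp [lin, hexQ, bq_eq, h.dz, h.xz, h.cz, x0, c0] at da db dd xa xb xx dc xc ca cb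
  have d2 : M 4 2 = 0 := by linarith
  have d3 : M 4 3 = 0 := by linarith
  have d0 : M 4 0 = 1 := by
    rw [d2, d3] at dd
    exact eq_one_of_mul_self h.dp (by linarith)
  rw [d2, d3, d0] at dc
  have e3 : M 0 3 = 2 * M 0 2 := by linarith
  have e4 : M 0 4 = (3 * M 0 2 + 1) / 2 := by linarith
  have e2 : M 0 2 = 1 / 3 := by
    rw [e3, e4] at xx
    nlinarith [h.ch.nn 0 2]
  rw [e3, e4, e2] at xc
  linarith [h.ch.nn 3 2]

lemma adapted_two_three_one_four {M : Fin 6 → Fin 6 → ℝ} {s k : Fin 6}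
    (h : Adapted true M 2 3 1 4 s k) :
    M 0 1 ^ 2 = 1 / 3 ∧ M 4 1 ^ 2 = 3 := by
  have da := h.ch.lin_eq h.a 4
  have db := h.ch.lin_eq h.b 4
  have dd := h.ch.gram 4 4
  have dx := h.ch.gram 4 0
  have xa := h.ch.lin_eq h.a 0
  have xb := h.ch.lin_eq h.b 0
  have xx := h.ch.gram 0 0
  simp [lin, hexQ, bq_eq, h.dz, h.xz] at da db dd dx xa xb xx
  have d2 : M 4 2 = 2 * M 4 3 := by linarith
  have d1 : M 4 1 = 3 * M 4 3 := by linarith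
  have f1 : M 4 1 * (2 * M 0 1 - M 0 2 - 2 / 3) = 0 := by
    linear_combination dx - M 4 2 * xa - M 4 3 * xb + d2 - 2 / 3 * d1
  have x2 : M 0 2 = 2 * M 0 1 - 2 / 3 := by
    linarith [(mul_eq_zero.1 f1).resolve_left h.dp.ne']
  have x3 : M 0 3 = 3 * M 0 1 - 1 / 3 := by linarith
  have x4 : M 0 4 = 2 * M 0 1 := by linarith
  rw [x2, x3, x4] at xx
  rw [d2, d1] at dd
  rw [d1]
  constructor <;> linarith

lemma adapted_three_two_one_four {M : Fin 6 → Fin 6 → ℝ} {s k : Fin 6}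
    (h : Adapted true M 3 2 1 4 s k) :
    M 0 1 ^ 2 = 1 / 3 ∧ M 4 1 ^ 2 = 3 := by
  have da := h.ch.lin_eq h.a 4
  have db := h.ch.lin_eq h.b 4
  have dd := h.ch.gram 4 4
  have dx := h.ch.gram 4 0
  have xa := h.ch.lin_eq h.a 0
  have xb := h.ch.lin_eq h.b 0
  have xx := h.ch.gram 0 0
  simp [lin, hexQ, bq_eq, h.dz, h.xz] at da db dd dx xa xb xx
  have d2 : M 4 2 = 2 * M 4 3 := by linarith
  have d1 : M 4 1 = 3 * M 4 3 := by linarith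
  have f1 : M 4 1 * (2 * M 0 1 - M 0 2 - 1 / 3) = 0 := by
    linear_combination dx - M 4 3 * xa - M 4 2 * xb - 1 / 3 * d1
  have x2 : M 0 2 = 2 * M 0 1 - 1 / 3 := by
    linarith [(mul_eq_zero.1 f1).resolve_left h.dp.ne']
  have x3 : M 0 3 = 3 * M 0 1 - 2 / 3 := by linarith
  have x4 : M 0 4 = 2 * M 0 1 := by linarith
  rw [x2, x3, x4] at xx
  rw [d2, d1] at dd
  rw [d1]
  constructor <;> linarith

lemma adapted_two_three_four_one {M : Fin 6 → Fin 6 → ℝ} {s k : Fin 6}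
    (h : Adapted true M 2 3 4 1 s k) :
    M 0 4 ^ 2 = 1 / 3 ∧ M 4 4 ^ 2 = 3 := by
  have da := h.ch.lin_eq h.a 4
  have db := h.ch.lin_eq h.b 4
  have dd := h.ch.gram 4 4
  have dx := h.ch.gram 4 0
  have xa := h.ch.lin_eq h.a 0
  have xb := h.ch.lin_eq h.b 0
  have xx := h.ch.gram 0 0
  simp [lin, hexQ, bq_eq, h.dz, h.xz] at da db dd dx xa xb xx
  have d3 : M 4 3 = 2 * M 4 2 := by linarith
  have d4 : M 4 4 = 3 / 2 * M 4 2 := by linarith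
  have f4 : M 4 4 * (4 * M 0 4 - 2 * M 0 3 - 2 / 3) = 0 := by
    linear_combination dx - M 4 2 * xa - M 4 3 * xb - 2 / 3 * d4
  have x4 : M 0 4 = M 0 3 / 2 + 1 / 6 := by
    linarith [(mul_eq_zero.1 f4).resolve_left h.dp.ne']
  have x3 : M 0 3 = M 0 2 + 1 / 3 := by linarith
  have x1 : M 0 1 = M 0 2 + 2 / 3 := by linarith
  rw [x4, x3, x1] at xx
  rw [d4, d3] at dd
  rw [d4, x4, x3]
  constructor <;> linarith

lemma adapted_three_two_four_one {M : Fin 6 → Fin 6 → ℝ} {s k : Fin 6}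
    (h : Adapted true M 3 2 4 1 s k) :
    M 0 4 ^ 2 = 1 / 3 ∧ M 4 4 ^ 2 = 3 := by
  have da := h.ch.lin_eq h.a 4
  have db := h.ch.lin_eq h.b 4
  have dd := h.ch.gram 4 4
  have dx := h.ch.gram 4 0
  have xa := h.ch.lin_eq h.a 0
  have xb := h.ch.lin_eq h.b 0
  have xx := h.ch.gram 0 0
  simp [lin, hexQ, bq_eq, h.dz, h.xz] at da db dd dx xa xb xx
  have d3 : M 4 3 = 2 * M 4 2 := by linarith
  have d4 : M 4 4 = 3 / 2 * M 4 2 := by linarith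
  have f4 : M 4 4 * (4 * M 0 4 - 2 * M 0 3 - 4 / 3) = 0 := by
    linear_combination dx - M 4 3 * xa - M 4 2 * xb + d3 - 4 / 3 * d4
  have x4 : M 0 4 = M 0 3 / 2 + 1 / 3 := by
    linarith [(mul_eq_zero.1 f4).resolve_left h.dp.ne']
  have x3 : M 0 3 = M 0 2 - 1 / 3 := by linarith
  have x1 : M 0 1 = M 0 2 + 1 / 3 := by linarith
  rw [x4, x3, x1] at xx
  rw [d4, d3] at dd
  rw [d4, x4, x3]
  constructor <;> linarith

lemma not_adapted_two_three_one_four_zero {M : Fin 6 → Fin 6 → ℝ} (h : Adapted true M 2 3 1 4 0 5) :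
    False := by
  obtain ⟨hx, hd⟩ := adapted_two_three_one_four h
  have y := h.ch.col (.inl rfl) h.ct 5 (by decide)
  have b := h.bd 4
  have ya := h.ch.lin_eq h.a 5
  have yb := h.ch.lin_eq h.b 5
  have dy := h.ch.gram 4 5
  have xy := h.ch.gram 0 5
  have cy := h.ch.gram 3 5
  simp [lin, hexQ, bq_eq, h.dz, h.xz, h.cz, h.b, y] at ya yb dy xy cy b
  rw [ya, yb] at dy xy cy
  have := mul_nonneg h.ct.le (h.ch.nn 5 1)
  refine mid_absurd (L := 2 * M 5 1 - M 5 2) (L' := 4 * M 5 4 - 2 * M 5 3 - 2 * M 5 5) (X := M 0 1)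
      (C' := M 3 4)
    h.dp h.xq (h.ch.nn 3 1) (by linarith) (by linarith) (by linarith)
    (show -(2 * (M 3 0 * M 5 1)) ≤ 0 by linarith) ?_ b
  exact lt_of_pow_lt_pow_left₀ 2 h.dp.le (by rw [hx, hd]; norm_num)

lemma not_adapted_two_three_one_four_five {M : Fin 6 → Fin 6 → ℝ} (h : Adapted true M 2 3 1 4 5 0) :
    False := by
  obtain ⟨hx, hd⟩ := adapted_two_three_one_four h
  have y := h.ch.col (.inr rfl) h.ct 5 (by decide)
  have b := h.bd 4
  have ya := h.ch.lin_eq h.a 5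
  have yb := h.ch.lin_eq h.b 5
  have dy := h.ch.gram 4 5
  have xy := h.ch.gram 0 5
  have cy := h.ch.gram 3 5
  simp [lin, hexQ, bq_eq, h.dz, h.xz, h.cz, h.b, y] at ya yb dy xy cy b
  rw [ya, yb] at dy xy cy
  have := mul_nonneg h.ct.le (h.ch.nn 5 4)
  refine mid_absurd (L := 2 * M 5 1 - 2 * M 5 0 - M 5 2) (L' := 4 * M 5 4 - 2 * M 5 3) (X := M 0 1)
      (C' := M 3 4)
    h.dp h.xq (h.ch.nn 3 1) (by linarith) (by linarith) (by linarith)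
    (show -(2 * (M 3 5 * M 5 4)) ≤ 0 by linarith) ?_ b
  exact lt_of_pow_lt_pow_left₀ 2 h.dp.le (by rw [hx, hd]; norm_num)

lemma not_adapted_two_three_four_one_zero {M : Fin 6 → Fin 6 → ℝ} (h : Adapted true M 2 3 4 1 0 5) :
    False := by
  obtain ⟨hx, hd⟩ := adapted_two_three_four_one h
  have y := h.ch.col (.inl rfl) h.ct 5 (by decide)
  have b := h.bd 1
  have ya := h.ch.lin_eq h.a 5
  have yb := h.ch.lin_eq h.b 5
  have dy := h.ch.gram 4 5
  have xy := h.ch.gram 0 5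
  have cy := h.ch.gram 3 5
  simp [lin, hexQ, bq_eq, h.dz, h.xz, h.cz, h.b, y] at ya yb dy xy cy b
  rw [ya, yb] at dy xy cy
  have := mul_nonneg h.ct.le (h.ch.nn 5 1)
  refine mid_absurd (L := 4 * M 5 4 - 2 * M 5 3 - 2 * M 5 5) (L' := 2 * M 5 1 - M 5 2) (X := M 0 4)
      (C' := M 3 1)
    h.dp h.xq (h.ch.nn 3 4) (by linarith) (by linarith) (by linarith)
    (show -(2 * (M 3 0 * M 5 1)) ≤ 0 by linarith) ?_ b
  exact lt_of_pow_lt_pow_left₀ 2 h.dp.le (by rw [hx, hd]; norm_num)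

lemma not_adapted_two_three_four_one_five {M : Fin 6 → Fin 6 → ℝ} (h : Adapted true M 2 3 4 1 5 0) :
    False := by
  obtain ⟨hx, hd⟩ := adapted_two_three_four_one h
  have y := h.ch.col (.inr rfl) h.ct 5 (by decide)
  have b := h.bd 1
  have ya := h.ch.lin_eq h.a 5
  have yb := h.ch.lin_eq h.b 5
  have dy := h.ch.gram 4 5
  have xy := h.ch.gram 0 5
  have cy := h.ch.gram 3 5
  simp [lin, hexQ, bq_eq, h.dz, h.xz, h.cz, h.b, y] at ya yb dy xy cy b
  rw [ya, yb] at dy xy cy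
  have := mul_nonneg h.ct.le (h.ch.nn 5 4)
  refine mid_absurd (L := 4 * M 5 4 - 2 * M 5 3) (L' := 2 * M 5 1 - 2 * M 5 0 - M 5 2) (X := M 0 4)
      (C' := M 3 1)
    h.dp h.xq (h.ch.nn 3 4) (by linarith) (by linarith) (by linarith)
    (show -(2 * (M 3 5 * M 5 4)) ≤ 0 by linarith) ?_ b
  exact lt_of_pow_lt_pow_left₀ 2 h.dp.le (by rw [hx, hd]; norm_num)

lemma not_adapted_three_two_one_four_zero {M : Fin 6 → Fin 6 → ℝ} (h : Adapted true M 3 2 1 4 0 5) :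
    False := by
  obtain ⟨hx, hd⟩ := adapted_three_two_one_four h
  have y := h.ch.col (.inl rfl) h.ct 5 (by decide)
  have b := h.bd 4
  have ya := h.ch.lin_eq h.a 5
  have yb := h.ch.lin_eq h.b 5
  have dy := h.ch.gram 4 5
  have xy := h.ch.gram 0 5
  have cy := h.ch.gram 3 5
  simp [lin, hexQ, bq_eq, h.dz, h.xz, h.cz, h.b, y] at ya yb dy xy cy b
  rw [ya, yb] at dy xy cy
  have := mul_nonneg h.ct.le (h.ch.nn 5 1)
  refine mid_absurd (L := 2 * M 5 1 - M 5 2) (L' := 4 * M 5 4 - 2 * M 5 3 - 2 * M 5 5) (X := M 0 1)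
      (C' := M 3 4)
    h.dp h.xq (h.ch.nn 3 1) (by linarith) (by linarith) (by linarith)
    (show -(2 * (M 3 0 * M 5 1)) ≤ 0 by linarith) ?_ b
  exact lt_of_pow_lt_pow_left₀ 2 h.dp.le (by rw [hx, hd]; norm_num)

lemma not_adapted_three_two_one_four_five {M : Fin 6 → Fin 6 → ℝ} (h : Adapted true M 3 2 1 4 5 0) :
    False := by
  obtain ⟨hx, hd⟩ := adapted_three_two_one_four h
  have y := h.ch.col (.inr rfl) h.ct 5 (by decide)
  have b := h.bd 4
  have ya := h.ch.lin_eq h.a 5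
  have yb := h.ch.lin_eq h.b 5
  have dy := h.ch.gram 4 5
  have xy := h.ch.gram 0 5
  have cy := h.ch.gram 3 5
  simp [lin, hexQ, bq_eq, h.dz, h.xz, h.cz, h.b, y] at ya yb dy xy cy b
  rw [ya, yb] at dy xy cy
  have := mul_nonneg h.ct.le (h.ch.nn 5 4)
  refine mid_absurd (L := 2 * M 5 1 - 2 * M 5 0 - M 5 2) (L' := 4 * M 5 4 - 2 * M 5 3) (X := M 0 1)
      (C' := M 3 4)
    h.dp h.xq (h.ch.nn 3 1) (by linarith) (by linarith) (by linarith)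
    (show -(2 * (M 3 5 * M 5 4)) ≤ 0 by linarith) ?_ b
  exact lt_of_pow_lt_pow_left₀ 2 h.dp.le (by rw [hx, hd]; norm_num)

lemma not_adapted_three_two_four_one_zero {M : Fin 6 → Fin 6 → ℝ} (h : Adapted true M 3 2 4 1 0 5) :
    False := by
  obtain ⟨hx, hd⟩ := adapted_three_two_four_one h
  have y := h.ch.col (.inl rfl) h.ct 5 (by decide)
  have b := h.bd 1
  have ya := h.ch.lin_eq h.a 5
  have yb := h.ch.lin_eq h.b 5
  have dy := h.ch.gram 4 5
  have xy := h.ch.gram 0 5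
  have cy := h.ch.gram 3 5
  simp [lin, hexQ, bq_eq, h.dz, h.xz, h.cz, h.b, y] at ya yb dy xy cy b
  rw [ya, yb] at dy xy cy
  have := mul_nonneg h.ct.le (h.ch.nn 5 1)
  refine mid_absurd (L := 4 * M 5 4 - 2 * M 5 3 - 2 * M 5 5) (L' := 2 * M 5 1 - M 5 2) (X := M 0 4)
      (C' := M 3 1)
    h.dp h.xq (h.ch.nn 3 4) (by linarith) (by linarith) (by linarith)
    (show -(2 * (M 3 0 * M 5 1)) ≤ 0 by linarith) ?_ b
  exact lt_of_pow_lt_pow_left₀ 2 h.dp.le (by rw [hx, hd]; norm_num)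

lemma not_adapted_three_two_four_one_five {M : Fin 6 → Fin 6 → ℝ} (h : Adapted true M 3 2 4 1 5 0) :
    False := by
  obtain ⟨hx, hd⟩ := adapted_three_two_four_one h
  have y := h.ch.col (.inr rfl) h.ct 5 (by decide)
  have b := h.bd 1
  have ya := h.ch.lin_eq h.a 5
  have yb := h.ch.lin_eq h.b 5
  have dy := h.ch.gram 4 5
  have xy := h.ch.gram 0 5
  have cy := h.ch.gram 3 5
  simp [lin, hexQ, bq_eq, h.dz, h.xz, h.cz, h.b, y] at ya yb dy xy cy b
  rw [ya, yb] at dy xy cy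
  have := mul_nonneg h.ct.le (h.ch.nn 5 4)
  refine mid_absurd (L := 4 * M 5 4 - 2 * M 5 3) (L' := 2 * M 5 1 - 2 * M 5 0 - M 5 2) (X := M 0 4)
      (C' := M 3 1)
    h.dp h.xq (h.ch.nn 3 4) (by linarith) (by linarith) (by linarith)
    (show -(2 * (M 3 5 * M 5 4)) ≤ 0 by linarith) ?_ b
  exact lt_of_pow_lt_pow_left₀ 2 h.dp.le (by rw [hx, hd]; norm_num)

lemma not_adapted_two_three_five_one {M : Fin 6 → Fin 6 → ℝ} (h : Adapted true M 2 3 5 1 4 0) :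
    False := by
  have x5 := h.ch.col (.inr rfl) h.dp 0 (by decide)
  have c5 := h.ch.col (.inr rfl) h.dp 3 (by decide)
  have b1 := h.bd 1
  have da := h.ch.lin_eq h.a 4
  have db := h.ch.lin_eq h.b 4
  have dd := h.ch.gram 4 4
  have xa := h.ch.lin_eq h.a 0
  have xb := h.ch.lin_eq h.b 0
  have xx := h.ch.gram 0 0
  have dc := h.ch.gram 4 3
  have xc := h.ch.gram 0 3
  have ca := h.ch.lin_eq h.a 3
  have cb := h.ch.lin_eq h.b 3
  simp [lin, hexQ, bq_eq, h.dz, h.xz, h.cz, x5, c5, h.b] at da db dd xa xb xx dc xc ca cb b1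
  have d2 : M 4 2 = 0 := by linarith
  have d3 : M 4 3 = 0 := by linarith
  have d5 : M 4 5 = 1 := by
    rw [d2, d3] at dd
    exact eq_one_of_mul_self h.dp (by linarith)
  rw [d2, d3, d5] at dc
  have e2 : M 0 2 = 2 * M 0 3 := by linarith
  have e1 : M 0 1 = 3 * M 0 3 + 1 := by linarith
  have e3 : M 0 3 = 0 := by
    rw [e2, e1] at xx
    nlinarith [h.ch.nn 0 3]
  rw [e2, e1, e3] at xc
  linarith

lemma not_adapted_three_two_five_one {M : Fin 6 → Fin 6 → ℝ} {s k : Fin 6}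
    (h : Adapted true M 3 2 5 1 s k) : False := by
  have x5 := h.ch.col (.inr rfl) h.dp 0 (by decide)
  have xa := h.ch.lin_eq h.a 0
  have xb := h.ch.lin_eq h.b 0
  have xx := h.ch.gram 0 0
  simp [lin, hexQ, bq_eq, h.xz, x5] at xa xb xx
  have e2 : M 0 2 = 2 * M 0 3 + 1 := by linarith
  have e1 : M 0 1 = 3 * M 0 3 + 2 := by linarith
  rw [e2, e1] at xx
  nlinarith [h.ch.nn 0 3]

lemma not_adapted_two_three {M : Fin 6 → Fin 6 → ℝ} {p q s k : Fin 6}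
    (h : Adapted true M 2 3 p q s k) : False := by
  rcases perm_two_three p q s k h.nd h.hk h.q_ne with
    ⟨rfl, rfl⟩ | ⟨rfl, rfl, rfl, rfl⟩ | ⟨rfl, rfl, rfl, rfl⟩ | ⟨rfl, rfl, rfl, rfl⟩ |
    ⟨rfl, rfl, rfl, rfl⟩ | ⟨rfl, rfl, rfl, rfl⟩ | ⟨rfl, rfl⟩ | ⟨rfl, rfl, rfl, rfl⟩
  exacts [not_adapted_two_three_zero_one h, not_adapted_two_three_zero_four h,
      not_adapted_two_three_one_four_zero h, not_adapted_two_three_one_four_five h,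
      not_adapted_two_three_four_one_zero h, not_adapted_two_three_four_one_five h,
      not_adapted_two_three_five_four h,
      not_adapted_two_three_five_one h]

lemma not_adapted_three_two {M : Fin 6 → Fin 6 → ℝ} {p q s k : Fin 6}
    (h : Adapted true M 3 2 p q s k) : False := by
  rcases perm_two_three p q s k ((List.Perm.swap _ _ _).nodup_iff.1 h.nd) h.hk h.q_ne with
    ⟨rfl, rfl⟩ | ⟨rfl, rfl, rfl, rfl⟩ | ⟨rfl, rfl, rfl, rfl⟩ | ⟨rfl, rfl, rfl, rfl⟩ |
    ⟨rfl, rfl, rfl, rfl⟩ | ⟨rfl, rfl, rfl, rfl⟩ | ⟨rfl, rfl⟩ | ⟨rfl, rfl, rfl, rfl⟩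
  exacts [not_adapted_three_two_zero_one h, not_adapted_three_two_zero_four h,
      not_adapted_three_two_one_four_zero h, not_adapted_three_two_one_four_five h,
      not_adapted_three_two_four_one_zero h, not_adapted_three_two_four_one_five h,
      not_adapted_three_two_five_four h,
      not_adapted_three_two_five_one h]

lemma perm_four_five : ∀ p q s k : Fin 6, [4, 5, p, q, s, k].Nodup → (k = 0 ∨ k = 5) →
    ¬ (q = 0 ∨ q = 5) → p = 1 ∧ q = 2 ∨ p = 2 ∧ q = 1 ∨ p = 3 ∨ p = 1 ∧ q = 3 ∨ p = 2 ∧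
        q = 3 := by decide

lemma not_adapted_four_five {M : Fin 6 → Fin 6 → ℝ} {p q s k : Fin 6}
    (h : Adapted false M 4 5 p q s k) :
    False := by
  have d5 := h.ch.col (.inr rfl) (show 0 < M 2 5 by simp [h.b]) 4 (by decide)
  have x5 := h.ch.col (.inr rfl) (show 0 < M 2 5 by simp [h.b]) 0 (by decide)
  have da := h.ch.lin_eq h.a 4
  have db := h.ch.lin_eq h.b 4
  have xa := h.ch.lin_eq h.a 0
  have xb := h.ch.lin_eq h.b 0
  simp [lin, hexQ, d5, x5] at da db xa xb
  rw [db] at da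
  simp at da
  rw [xb] at xa
  have x3 : M 0 3 = 1 := by linarith
  rcases perm_four_five p q s k (by simpa [and_comm, eq_comm] using h.nd) h.hk h.q_ne with
    ⟨rfl, rfl⟩ | ⟨rfl, rfl⟩ | rfl | ⟨rfl, rfl⟩ | ⟨rfl, rfl⟩
  · simp [h.xz 3] at x3
  · simp [h.xz 3] at x3
  · exact h.dp.ne' da
  · have dx := h.ch.gram 4 0
    have xx := h.ch.gram 0 0
    simp [bq_eq, hexQ, h.dz, h.xz, d5, x5, db, xb] at dx xx
    rw [dx.resolve_left h.dp.ne', x3] at xx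
    linarith
  · have dx := h.ch.gram 4 0
    have xx := h.ch.gram 0 0
    simp [bq_eq, hexQ, h.dz, h.xz, d5, x5, db, xb] at dx xx
    have x2 : M 0 2 = 1 / 2 := by
      linarith [dx.resolve_left h.dp.ne']
    rw [x2, x3] at xx
    linarith

lemma not_adapted_five_four {M : Fin 6 → Fin 6 → ℝ} {p q s k : Fin 6}
    (h : Adapted false M 5 4 p q s k) :
    False := by
  have d5 := h.ch.col (.inr rfl) (show 0 < M 1 5 by simp [h.a]) 4 (by decide)
  have x5 := h.ch.col (.inr rfl) (show 0 < M 1 5 by simp [h.a]) 0 (by decide)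
  have da := h.ch.lin_eq h.a 4
  have db := h.ch.lin_eq h.b 4
  have xa := h.ch.lin_eq h.a 0
  have xb := h.ch.lin_eq h.b 0
  simp [lin, hexQ, d5, x5] at da db xa xb
  rw [da] at db
  simp at db
  have x4 : M 0 4 = 1 := by linarith
  rw [x4] at xb
  have x3 : M 0 3 = 2 := by linarith
  rcases perm_four_five p q s k (by simpa [and_comm, eq_comm] using
      (List.Perm.swap _ _ _).nodup_iff.1 h.nd) h.hk h.q_ne with
    ⟨rfl, rfl⟩ | ⟨rfl, rfl⟩ | rfl | ⟨rfl, rfl⟩ | ⟨rfl, rfl⟩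
  · simp [h.xz 3] at x3
  · simp [h.xz 3] at x3
  · exact h.dp.ne' db
  · have dx := h.ch.gram 4 0
    simp [bq_eq, hexQ, h.dz, h.xz, d5, x5, da, h.dp.ne'] at dx
    have hz : ∀ n, n ≠ 3 → 1 * M 0 n + -1 * M 2 n = 0 := by
      intro n hn
      fin_cases n <;> simp_all [h.b, h.xz]
    rcases h.ch.ridge 3 0 2 (by decide) 1 (-1) hz (by simp [h.b, x3]) with h3 | h3
    · linarith [h3 4 (by decide)]
    · simpa [h.b] using h3 4 (by decide)
  · have dx := h.ch.gram 4 0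
    have xx := h.ch.gram 0 0
    simp [bq_eq, hexQ, h.dz, h.xz, d5, x5, da] at dx xx
    have x2 : M 0 2 = 1 := by
      linarith [dx.resolve_left h.dp.ne']
    rw [x2, x3, x4] at xx
    linarith

/-- The tile `M` is adapted to a flag that starts with rows `2, 3, 1` and ends with `u, 0, w`. -/
structure FlagBC (s : Bool) (M : Fin 6 → Fin 6 → ℝ) (u w i j p q t k : Fin 6) : Prop where
  ch : Chart s M
  b : M 2 = Pi.single i 1
  c : M 3 = Pi.single j 1
  ap : 0 < M 1 p
  uq : 0 < M u q
  xt : 0 < M 0 t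
  wk : 0 < M w k
  az : ∀ n, n ≠ i → n ≠ j → n ≠ p → M 1 n = 0
  uz : ∀ n, n ≠ i → n ≠ j → n ≠ p → n ≠ q → M u n = 0
  xz : ∀ n, n ≠ i → n ≠ j → n ≠ p → n ≠ q → n ≠ t → M 0 n = 0
  nd : [i, j, p, q, t, k].Nodup
  hk : k = 0 ∨ k = 5

/-- Twice the Gram matrix of the path simplex, three normals rescaled. -/
def pathQ : Fin 6 → Fin 6 → ℤ :=
  ![![4, -2, 0, 0, 0, 0], ![-2, 2, -1, 0, 0, 0], ![0, -1, 2, -1, 0, 0], ![0, 0, -1, 2, -2, 0],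
    ![0, 0, 0, -2, 4, -2], ![0, 0, 0, 0, -2, 4]]

lemma lin_single (i j : Fin 6) : lin i (Pi.single j 1) = pathQ i j := by
  fin_cases i <;> fin_cases j <;> simp [lin, pathQ]

lemma lin_single_cases {s : Bool} {i j : Fin 6} (hi : lin i (Pi.single i 1) = hexQ s 2 2)
    (hj : lin j (Pi.single j 1) = hexQ s 3 3) (hij : lin i (Pi.single j 1) = hexQ s 3 2) :
    s = false ∧ i = 0 ∧ j = 1 ∨ s = true ∧ i = 1 ∧ j = 0 ∨
    s = true ∧ i = 3 ∧ j = 4 ∨ s = false ∧ i = 4 ∧ j = 3 := by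
  have h22 : hexQ s 2 2 = ((bif s then 2 else 4 : ℤ) : ℝ) := by cases s <;> simp [hexQ]
  have h33 : hexQ s 3 3 = ((bif s then 4 else 2 : ℤ) : ℝ) := by cases s <;> simp [hexQ]
  have h32 : hexQ s 3 2 = ((-2 : ℤ) : ℝ) := by cases s <;> simp [hexQ]
  simp only [lin_single, h22, h33, h32, Int.cast_inj] at hi hj hij
  clear h22 h33 h32
  revert s i j
  decide

lemma FlagBC.bc_cases {s : Bool} {M : Fin 6 → Fin 6 → ℝ} {u w i j p q t k : Fin 6}
    (h : FlagBC s M u w i j p q t k) : s = false ∧ i = 0 ∧ j = 1 ∨ s = true ∧ i = 1 ∧ j = 0 ∨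
    s = true ∧ i = 3 ∧ j = 4 ∨ s = false ∧ i = 4 ∧ j = 3 := by
  have bb := h.ch.lin_eq h.b 2
  have cc := h.ch.lin_eq h.c 3
  have bc := h.ch.lin_eq h.b 3
  rw [h.b] at bb
  rw [h.c] at bc cc
  exact lin_single_cases bb cc bc

lemma not_flagBC_zero_one {M : Fin 6 → Fin 6 → ℝ} {u w p q t k : Fin 6}
    (h : FlagBC false M u w 0 1 p q t k) : False := by
  have a0 := h.ch.col (.inl rfl) (show 0 < M 2 0 by simp [h.b]) 1 (by decide)
  have ab := h.ch.lin_eq h.b 1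
  have ac := h.ch.lin_eq h.c 1
  have aa := h.ch.gram 1 1
  simp [lin, hexQ, bq_eq, a0] at ab ac aa
  have a2 : M 1 2 = 2 := by linarith
  have hp : p = 2 := by
    by_contra hp
    linarith [h.az 2 (by decide) (by decide) (Ne.symm hp)]
  subst hp
  simp [h.az, ab, a2] at aa
  norm_num at aa

lemma flagBC_one_zero {M : Fin 6 → Fin 6 → ℝ} {u w p q t k : Fin 6}
    (h : FlagBC true M u w 1 0 p q t k) : p = 2 ∧ M 1 = Pi.single 2 1 := by
  have a0 := h.ch.col (.inl rfl) (show 0 < M 3 0 by simp [h.c]) 1 (by decide)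
  have ab := h.ch.lin_eq h.b 1
  have ac := h.ch.lin_eq h.c 1
  simp [lin, hexQ, a0] at ab ac
  have a2 : M 1 2 = 1 := by linarith
  have hp : p = 2 := by
    by_contra hp
    linarith [h.az 2 (by decide) (by decide) (Ne.symm hp)]
  subst hp
  refine ⟨rfl, funext fun n => ?_⟩
  fin_cases n <;> simp [h.az, a0, ac, a2]

lemma perm_three_four : ∀ p q s k : Fin 6, [3, 4, p, q, s, k].Nodup →
    p = 2 ∨ p = 5 ∨ p = 0 ∨ p = 1 := by decide

lemma flagBC_three_four {M : Fin 6 → Fin 6 → ℝ} {u w p q t k : Fin 6}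
    (h : FlagBC true M u w 3 4 p q t k) : p = 2 ∧ M 1 = Pi.single 2 1 := by
  have ab := h.ch.lin_eq h.b 1
  have ac := h.ch.lin_eq h.c 1
  have aa := h.ch.gram 1 1
  have n4 := h.ch.nn 1 4
  rcases perm_three_four p q t k h.nd with rfl | rfl | rfl | rfl <;>
    simp [lin, hexQ, bq_eq, h.az] at ab ac aa
  · have e3 : M 1 3 = 2 * M 1 4 := by linarith
    have e2 : M 1 2 = 2 * M 1 4 + 1 := by linarith
    rw [e3, e2] at aa
    have e4 : M 1 4 = 0 := by nlinarith
    rw [e4] at e2 e3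
    refine ⟨rfl, funext fun n => ?_⟩
    fin_cases n <;> simp [h.az, e2, e3, e4]
  · have e3 : M 1 3 = M 1 4 - 1 / 2 := by linarith
    have e5 : M 1 5 = M 1 4 + 1 / 2 := by linarith
    have := h.ch.nn 1 3
    rw [e3, e5] at aa
    nlinarith
  all_goals linarith

lemma flagBC_four_three {M : Fin 6 → Fin 6 → ℝ} {u w p q t k : Fin 6}
    (h : FlagBC false M u w 4 3 p q t k) : p = 5 ∧ M 1 = Pi.single 5 1 := by
  have ab := h.ch.lin_eq h.b 1
  have ac := h.ch.lin_eq h.c 1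
  have aa := h.ch.gram 1 1
  have n4 := h.ch.nn 1 4
  rcases perm_three_four p q t k ((List.Perm.swap _ _ _).nodup_iff.1 h.nd) with
    rfl | rfl | rfl | rfl <;> simp [lin, hexQ, bq_eq, h.az] at ab ac aa
  · have e3 : M 1 3 = 2 * M 1 4 + 1 := by linarith
    have e2 : M 1 2 = 2 * M 1 4 + 2 := by linarith
    rw [e3, e2] at aa
    nlinarith
  · have e3 : M 1 3 = M 1 4 := by linarith
    have e5 : M 1 5 = M 1 4 + 1 := by linarith
    rw [e3, e5] at aa
    have e4 : M 1 4 = 0 := by nlinarith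
    rw [e4] at e5 e3
    refine ⟨rfl, funext fun n => ?_⟩
    fin_cases n <;> simp [h.az, e5, e3, e4]
  all_goals linarith

/-- The two rescaled tiles that the flag starting with rows `2, 3, 1, 4` leaves over. -/
def tileA : Fin 6 → Fin 6 → ℝ :=
  ![Pi.single 1 1, Pi.single 2 1, Pi.single 3 1, Pi.single 4 1, Pi.single 5 1, ![2, 2, 2, 2, 1, 0]]

def tileB : Fin 6 → Fin 6 → ℝ :=
  ![![0, 2, 2, 2, 1, 0], Pi.single 5 1, Pi.single 4 1, Pi.single 3 1, Pi.single 2 1,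
    ![1, 1, 0, 0, 0, 0]]

lemma perm_one_zero_two : ∀ q s k : Fin 6, [1, 0, 2, q, s, k].Nodup → (k = 0 ∨ k = 5) →
    k = 5 ∧ (q = 4 ∧ s = 3 ∨ q = 3) := by decide

lemma perm_three_four_two : ∀ q s k : Fin 6, [3, 4, 2, q, s, k].Nodup → (k = 0 ∨ k = 5) →
    q = 0 ∨ q = 5 ∧ s = 1 ∧ k = 0 ∨ q = 1 ∧ s = 5 ∧ k = 0 ∨ q = 1 ∧ s = 0 ∧ k = 5 := by decide

lemma perm_four_three_five : ∀ q s k : Fin 6, [4, 3, 5, q, s, k].Nodup → (k = 0 ∨ k = 5) →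
    k = 0 ∧ (q = 2 ∧ s = 1 ∨ q = 1 ∧ s = 2) := by decide

lemma not_flagBC_four_one_zero_two {M : Fin 6 → Fin 6 → ℝ} {q t k : Fin 6}
    (h : FlagBC true M 4 5 1 0 2 q t k) : False := by
  have ha := (flagBC_one_zero h).2
  have d0 := h.ch.col (.inl rfl) (show 0 < M 3 0 by simp [h.c]) 4 (by decide)
  have dc := h.ch.lin_eq h.c 4
  have db := h.ch.lin_eq h.b 4
  have da := h.ch.lin_eq ha 4
  simp [lin, hexQ, d0] at dc db da
  have d2 : M 4 2 = 2 := by linarith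
  have d3 : M 4 3 = 3 := by linarith
  have hq : q = 3 := by
    by_contra hq
    linarith [h.uz 3 (by decide) (by decide) (by decide) (Ne.symm hq)]
  subst hq
  have dd := h.ch.gram 4 4
  simp [bq_eq, hexQ, h.uz, dc, d0, d2, d3] at dd
  norm_num at dd

lemma not_flagBC_four_three_four_two_one {M : Fin 6 → Fin 6 → ℝ} {s k : Fin 6}
    (h : FlagBC true M 4 5 3 4 2 1 s k) : False := by
  have ha := (flagBC_three_four h).2
  have dc := h.ch.lin_eq h.c 4
  have db := h.ch.lin_eq h.b 4
  have da := h.ch.lin_eq ha 4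
  have dd := h.ch.gram 4 4
  simp [lin, hexQ, bq_eq, h.uz] at dc db da dd
  have e1 : M 4 1 = M 4 2 + 1 := by linarith
  have e3 : M 4 3 = M 4 2 - 1 := by linarith
  have e4 : M 4 4 = M 4 2 / 2 - 1 := by linarith
  have := h.ch.nn 4 3
  rw [e1, e4, e3] at dd
  nlinarith

lemma flagBC_four_three_four_two_five {M : Fin 6 → Fin 6 → ℝ}
    (h : FlagBC true M 4 5 3 4 2 5 1 0) : M = tileA := by
  have ha := (flagBC_three_four h).2
  have dc := h.ch.lin_eq h.c 4
  have db := h.ch.lin_eq h.b 4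
  have da := h.ch.lin_eq ha 4
  have dd := h.ch.gram 4 4
  simp [lin, hexQ, bq_eq, h.uz] at dc db da dd
  have e3 : M 4 3 = 2 * M 4 2 := by linarith
  have e4 : M 4 4 = 3 / 2 * M 4 2 := by linarith
  have e5 : M 4 5 = M 4 2 + 1 := by linarith
  have e2 : M 4 2 = 0 := by
    rw [e3, e4, e5] at dd
    nlinarith [h.ch.nn 4 2]
  rw [e2] at e3 e4 e5
  have hd : M 4 = Pi.single 5 1 := by
    ext n
    fin_cases n <;> simp [h.uz, e2, e3, e4, e5]
  have x5 := h.ch.col (.inr rfl) h.uq 0 (by decide)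
  have y5 := h.ch.col (.inr rfl) h.uq 5 (by decide)
  have xd := h.ch.lin_eq hd 0
  have yd := h.ch.lin_eq hd 5
  have xa := h.ch.lin_eq ha 0
  have xb := h.ch.lin_eq h.b 0
  have xc := h.ch.lin_eq h.c 0
  have xy := h.ch.gram 0 5
  have ya := h.ch.lin_eq ha 5
  have yb := h.ch.lin_eq h.b 5
  have yc := h.ch.lin_eq h.c 5
  simp [lin, hexQ, bq_eq, x5, y5, h.xz] at xd yd xa xb xc xy ya yb yc
  have y4 : M 5 4 = 1 := by linarith
  have y3 : M 5 3 = 2 := by linarith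
  have y2 : M 5 2 = 2 := by linarith
  have y1 : M 5 1 = 2 := by linarith
  have x3 : M 0 3 = 0 := by linarith
  have x2 : M 0 2 = 0 := by linarith
  have x1 : M 0 1 = 1 := by linarith
  have y0 : M 5 0 = 2 := by
    simp [x1, x2, x3, xd] at xy
    linarith
  ext m n
  fin_cases m <;> simp [tileA, ha, h.b, h.c, hd] <;>
    fin_cases n <;> simp [h.xz, x1, x2, x3, x5, xd, y0, y1, y2, y3, y4, y5]

lemma flagBC_four_three_four_two {M : Fin 6 → Fin 6 → ℝ} {q t k : Fin 6}
    (h : FlagBC true M 4 5 3 4 2 q t k) : M = tileA := by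
  rcases perm_three_four_two q t k h.nd h.hk with
    rfl | ⟨rfl, rfl, rfl⟩ | ⟨rfl, rfl, rfl⟩ | ⟨rfl, rfl, rfl⟩
  · have ha := (flagBC_three_four h).2
    have dc := h.ch.lin_eq h.c 4
    have db := h.ch.lin_eq h.b 4
    have da := h.ch.lin_eq ha 4
    simp [lin, hexQ, h.uz] at dc db da
    linarith [h.ch.nn 4 2]
  · exact flagBC_four_three_four_two_five h
  · exact (not_flagBC_four_three_four_two_one h).elim
  · exact (not_flagBC_four_three_four_two_one h).elim

lemma flagBC_four_four_three_five {M : Fin 6 → Fin 6 → ℝ} {q t k : Fin 6}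
    (h : FlagBC false M 4 5 4 3 5 q t k) : M = tileB := by
  have ha := (flagBC_four_three h).2
  have d5 := h.ch.col (.inr rfl) h.ap 4 (by decide)
  have x5 := h.ch.col (.inr rfl) h.ap 0 (by decide)
  have y5 := h.ch.col (.inr rfl) h.ap 5 (by decide)
  have da := h.ch.lin_eq ha 4
  have db := h.ch.lin_eq h.b 4
  have dc := h.ch.lin_eq h.c 4
  simp [lin, hexQ, d5] at da db dc
  rw [da] at db dc
  simp at db
  rw [db] at dc
  have d2 : M 4 2 = 1 := by linarith
  have hq : q = 2 ∧ t = 1 ∧ k = 0 := by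
    rcases perm_four_three_five q t k h.nd h.hk with ⟨rfl, ⟨rfl, rfl⟩ | ⟨rfl, rfl⟩⟩
    · simp
    · simp [h.uz] at d2
  obtain ⟨rfl, rfl, rfl⟩ := hq
  have hd : M 4 = Pi.single 2 1 := by
    ext n
    fin_cases n <;> simp [h.uz, d2, db, da, d5]
  have xd := h.ch.lin_eq hd 0
  have yd := h.ch.lin_eq hd 5
  have xa := h.ch.lin_eq ha 0
  have xb := h.ch.lin_eq h.b 0
  have xc := h.ch.lin_eq h.c 0
  have xy := h.ch.gram 0 5
  have ya := h.ch.lin_eq ha 5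
  have yb := h.ch.lin_eq h.b 5
  have yc := h.ch.lin_eq h.c 5
  simp [lin, hexQ, bq_eq, x5, y5, h.xz] at xd yd xa xb xc xy ya yb yc
  have x4 : M 0 4 = 1 := by linarith
  have x3 : M 0 3 = 2 := by linarith
  have x2 : M 0 2 = 2 := by linarith
  have x1 : M 0 1 = 2 := by linarith
  have y3 : M 5 3 = 0 := by linarith
  have y2 : M 5 2 = 0 := by linarith
  have y1 : M 5 1 = 1 := by linarith
  have y0 : M 5 0 = 1 := by
    simp [x1, x2, x3, x4, y1, y2, y3, ya] at xy
    linarith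
  ext m n
  fin_cases m <;> simp [tileB, ha, h.b, h.c, hd] <;>
    fin_cases n <;> simp [h.xz, x1, x2, x3, x4, x5, y0, y1, y2, y3, ya, y5]

lemma FlagBC.tile_cases {s : Bool} {M : Fin 6 → Fin 6 → ℝ} {i j p q t k : Fin 6}
    (h : FlagBC s M 4 5 i j p q t k) : s = true ∧ M = tileA ∨ s = false ∧ M = tileB := by
  rcases h.bc_cases with ⟨rfl, rfl, rfl⟩ | ⟨rfl, rfl, rfl⟩ | ⟨rfl, rfl, rfl⟩ | ⟨rfl, rfl, rfl⟩
  · exact (not_flagBC_zero_one h).elim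
  · obtain ⟨rfl, -⟩ := flagBC_one_zero h
    exact (not_flagBC_four_one_zero_two h).elim
  · obtain ⟨rfl, -⟩ := flagBC_three_four h
    exact .inl ⟨rfl, flagBC_four_three_four_two h⟩
  · obtain ⟨rfl, -⟩ := flagBC_four_three h
    exact .inr ⟨rfl, flagBC_four_four_three_five h⟩

lemma not_flagBC_five_one_zero_two {M : Fin 6 → Fin 6 → ℝ} {q t : Fin 6}
    (h : FlagBC true M 5 4 1 0 2 q t 5)
    (hst : ∀ n, M 5 n ≤ 2 * (M 0 n + M 1 n + M 2 n) + M 3 n) : False := by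
  have ha := (flagBC_one_zero h).2
  have x0 := h.ch.col (.inl rfl) (show 0 < M 3 0 by simp [h.c]) 0 (by decide)
  have y0 := h.ch.col (.inl rfl) (show 0 < M 3 0 by simp [h.c]) 5 (by decide)
  have ya := h.ch.lin_eq ha 5
  have yb := h.ch.lin_eq h.b 5
  have yc := h.ch.lin_eq h.c 5
  have xa := h.ch.lin_eq ha 0
  have xb := h.ch.lin_eq h.b 0
  have xc := h.ch.lin_eq h.c 0
  simp [lin, hexQ, x0, y0] at ya yb yc xa xb xc
  rw [yc] at ya yb
  have y2 : M 5 2 = 0 := by linarith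
  have y3 : M 5 3 = 0 := by linarith
  have hq : q = 4 ∧ t = 3 := by
    rcases (perm_one_zero_two q t 5 h.nd h.hk).2 with hq | rfl
    · exact hq
    · exact absurd y3 h.uq.ne'
  obtain ⟨rfl, rfl⟩ := hq
  have x3 : M 0 3 = 1 := by linarith
  have yy := h.ch.gram 5 5
  have xy := h.ch.gram 0 5
  have b4 := hst 4
  simp [bq_eq, hexQ, h.uz, h.xz, ha, h.b, h.c, y0, yc, y2, x0, x3] at yy xy b4
  have y4 : M 5 4 = 1 := eq_one_of_mul_self h.uq (by linarith)
  rw [y4] at xy b4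
  linarith

lemma not_flagBC_five_four_three_five {M : Fin 6 → Fin 6 → ℝ} {q t : Fin 6}
    (h : FlagBC false M 5 4 4 3 5 q t 0)
    (hst : ∀ n, M 5 n ≤ M 0 n + M 1 n + M 2 n + M 3 n) : False := by
  have ha := (flagBC_four_three h).2
  have x5 := h.ch.col (.inr rfl) h.ap 0 (by decide)
  have y5 := h.ch.col (.inr rfl) h.ap 5 (by decide)
  have ya := h.ch.lin_eq ha 5
  have yb := h.ch.lin_eq h.b 5
  have yc := h.ch.lin_eq h.c 5
  have xa := h.ch.lin_eq ha 0
  have xb := h.ch.lin_eq h.b 0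
  have xc := h.ch.lin_eq h.c 0
  simp [lin, hexQ, x5, y5] at ya yb yc xa xb xc
  rw [ya] at yb yc
  simp at yb
  rw [yb] at yc
  simp at yc
  have hq : q = 1 ∧ t = 2 := by
    rcases (perm_four_three_five q t 0 h.nd h.hk).2 with ⟨rfl, -⟩ | hq
    · exact absurd yc h.uq.ne'
    · exact hq
  obtain ⟨rfl, rfl⟩ := hq
  have x4 : M 0 4 = 1 := by linarith
  have x3 : M 0 3 = 2 := by linarith
  have x2 : M 0 2 = 2 := by linarith
  have yy := h.ch.gram 5 5
  have xy := h.ch.gram 0 5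
  have b1 := hst 1
  simp [bq_eq, hexQ, h.uz, h.xz, ha, h.b, h.c, y5, ya, yb, x4, x3, x2] at yy xy b1
  have y1 : M 5 1 = 1 := eq_one_of_mul_self h.uq (by linarith)
  rw [y1] at xy b1
  linarith

lemma not_flagBC_five_three_four_two_zero {M : Fin 6 → Fin 6 → ℝ} {t k : Fin 6}
    (h : FlagBC true M 5 4 3 4 2 0 t k)
    (hst : ∀ n, M 5 n ≤ 2 * (M 0 n + M 1 n + M 2 n) + M 3 n) : False := by
  have ha := (flagBC_three_four h).2
  have b := hst 0
  simp [h.ch.col (.inl rfl) h.uq 0 (by decide), ha, h.b, h.c] at b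
  linarith [h.uq]

lemma not_flagBC_five_three_four_two_five {M : Fin 6 → Fin 6 → ℝ} {t k : Fin 6}
    (h : FlagBC true M 5 4 3 4 2 5 t k)
    (hst : ∀ n, M 5 n ≤ 2 * (M 0 n + M 1 n + M 2 n) + M 3 n) : False := by
  have ha := (flagBC_three_four h).2
  have b := hst 5
  simp [h.ch.col (.inr rfl) h.uq 0 (by decide), ha, h.b, h.c] at b
  linarith [h.uq]

lemma flagBC_five_three_four_two_one {M : Fin 6 → Fin 6 → ℝ} {s k : Fin 6}
    (h : FlagBC true M 5 4 3 4 2 1 s k) : M 5 = ![0, 2, 2, 2, 1, 0] := by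
  have ha := (flagBC_three_four h).2
  have ya := h.ch.lin_eq ha 5
  have yb := h.ch.lin_eq h.b 5
  have yc := h.ch.lin_eq h.c 5
  have yy := h.ch.gram 5 5
  simp [lin, hexQ, bq_eq, h.uz] at ya yb yc yy
  have y3 : M 5 3 = 2 * M 5 4 := by linarith
  have y2 : M 5 2 = 2 * M 5 4 := by linarith
  have y1 : M 5 1 = 2 * M 5 4 := by linarith
  rw [y1, y2, y3] at yy
  have y4 : M 5 4 = 1 := eq_one_of_mul_self (by linarith [h.uq]) (by linarith)
  rw [y4] at y3 y2 y1
  ext n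
  fin_cases n <;> simp [h.uz, y1, y2, y3, y4]

lemma not_flagBC_five_three_four_two_one_five_zero {M : Fin 6 → Fin 6 → ℝ}
    (h : FlagBC true M 5 4 3 4 2 1 5 0)
    (hst : ∀ n, M 5 n ≤ 2 * (M 0 n + M 1 n + M 2 n) + M 3 n) : False := by
  have ha := (flagBC_three_four h).2
  have hy := flagBC_five_three_four_two_one h
  have d5 := h.ch.col (.inr rfl) h.xt 4 (by decide)
  have b1 := hst 1
  have dy := h.ch.gram 5 4
  have xy := h.ch.gram 0 5
  have xd := h.ch.gram 0 4
  have dc := h.ch.lin_eq h.c 4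
  have db := h.ch.lin_eq h.b 4
  have da := h.ch.lin_eq ha 4
  have xc := h.ch.lin_eq h.c 0
  simp [lin, hexQ, bq_eq, hy, h.xz, d5, ha, h.b, h.c] at b1 dy xy xd dc db da xc
  have l1 : 2 * M 4 1 - 2 * M 4 0 - M 4 2 = 0 := by linarith
  rw [l1, db, da, dc] at xd
  have x5 : M 0 5 = M 0 1 + 1 := by linarith
  have := mul_nonneg h.xt.le (h.ch.nn 4 4)
  have x4 : M 0 4 = 0 := by linarith [h.ch.nn 0 4]
  linarith [h.ch.nn 0 3, h.xt]

lemma not_flagBC_five_three_four_two_one_zero_five {M : Fin 6 → Fin 6 → ℝ}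
    (h : FlagBC true M 5 4 3 4 2 1 0 5)
    (hst : ∀ n, M 0 n ≤ M 5 n + M 4 n + M 3 n + M 2 n) : False := by
  have b := hst 0
  simp [h.ch.col (.inl rfl) h.xt 4 (by decide), flagBC_five_three_four_two_one h, h.b, h.c] at b
  linarith [h.xt]

/-- `√2 / 2`. -/
def rt : ℝ := √2 / 2

lemma rt_pos : 0 < rt := by unfold rt; positivity

lemma rt_mul : rt * rt = 1 / 2 := by
  have := Real.mul_self_sqrt (show (0 : ℝ) ≤ 2 by norm_num)
  unfold rt
  linarith

/-- The pairing of the `i`-th unit normal of the path simplex with `∑ u j g j`. -/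
def pairF (i : Fin 6) (u : Fin 6 → ℝ) : ℝ :=
  ![u 0 - rt * u 1, u 1 - rt * u 0 - u 2 / 2, u 2 - u 1 / 2 - u 3 / 2,
    u 3 - u 2 / 2 - rt * u 4, u 4 - rt * u 3 - u 5 / 2, u 5 - u 4 / 2] i

def gramF (u v : Fin 6 → ℝ) : ℝ := ∑ i, u i * pairF i v

def hexGram : Fin 6 → Fin 6 → ℝ :=
  ![![1, -1/2, 0, 0, 0, -rt], ![-1/2, 1, -1/2, 0, 0, 0], ![0, -1/2, 1, -rt, 0, 0],
    ![0, 0, -rt, 1, -1/2, 0], ![0, 0, 0, -1/2, 1, -1/2], ![-rt, 0, 0, 0, -1/2, 1]]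

def pathCode : Fin 6 → Fin 6 → Fin 4 :=
  ![![3, 1, 0, 0, 0, 0], ![1, 3, 2, 0, 0, 0], ![0, 2, 3, 2, 0, 0], ![0, 0, 2, 3, 1, 0],
    ![0, 0, 0, 1, 3, 2], ![0, 0, 0, 0, 2, 3]]

lemma pairF_single (i j : Fin 6) :
    pairF i (Pi.single j 1) = (![0, -rt, -1/2, 1] : Fin 4 → ℝ) (pathCode i j) := by
  fin_cases i <;> fin_cases j <;> simp [pairF, pathCode] <;> norm_num

lemma rt_bounds : 1 / 2 < rt ∧ rt < 1 := by
  constructor <;> nlinarith [rt_mul, rt_pos]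

lemma code_injective : Function.Injective (![0, -rt, -1/2, 1] : Fin 4 → ℝ) := by
  intro a b h
  have := rt_bounds
  fin_cases a <;> fin_cases b <;> simp at h ⊢ <;> linarith

/-- Coefficients, with respect to the normals of a tile, of the normals of the large simplex. -/
structure RawChart (C : Fin 6 → Fin 6 → ℝ) : Prop where
  nn : ∀ j i, 0 ≤ C j i
  gram : ∀ j l, gramF (C j) (C l) = hexGram j l
  mono : ∀ i, i = 0 ∨ i = 5 → ∀ j l, j ≠ l → C j i = 0 ∨ C l i = 0
  ridge : ∀ i j l, j ≠ l → ∀ u v : ℝ, (∀ n, n ≠ i → u * C j n + v * C l n = 0) →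
    u * C j i + v * C l i ≠ 0 → (∀ n, n ≠ i → C j n = 0) ∨ ∀ n, n ≠ i → C l n = 0

def rowScale : Bool → Fin 6 → ℝ
  | true => ![1, 1, 1, 2 * rt, 2 * rt, 2 * rt]
  | false => ![2 * rt, 2 * rt, 2 * rt, 1, 1, 1]

def colScale : Fin 6 → ℝ := ![rt, 1, 1, 1, rt, rt]

def scale (s : Bool) (C : Fin 6 → Fin 6 → ℝ) : Fin 6 → Fin 6 → ℝ :=
  fun j i => rowScale s j * colScale i * C j i

lemma rowScale_pos (s : Bool) (j : Fin 6) : 0 < rowScale s j := by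
  have := rt_pos
  cases s <;> fin_cases j <;> simp [rowScale, this]

lemma colScale_pos (i : Fin 6) : 0 < colScale i := by
  have := rt_pos
  fin_cases i <;> simp [colScale, this]

lemma scale_eq_zero {s : Bool} {C : Fin 6 → Fin 6 → ℝ} {j i : Fin 6} :
    scale s C j i = 0 ↔ C j i = 0 := by
  simp [scale, (rowScale_pos s j).ne', (colScale_pos i).ne']

lemma scale_pos {s : Bool} {C : Fin 6 → Fin 6 → ℝ} {j i : Fin 6} (h : 0 < C j i) :
    0 < scale s C j i := mul_pos (mul_pos (rowScale_pos s j) (colScale_pos i)) h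

lemma bq_scale (s : Bool) (C : Fin 6 → Fin 6 → ℝ) (j l : Fin 6) :
    bq (scale s C j) (scale s C l) = rowScale s j * rowScale s l * (2 * gramF (C j) (C l)) := by
  have := rt_mul
  simp only [bq_eq, scale, gramF, Fin.sum_univ_six, pairF, colScale]
  simp
  generalize rowScale s j = a
  generalize rowScale s l = b
  linear_combination (4 * a * b * (C j 0 * C l 0 + C j 4 * C l 4 + C j 5 * C l 5)
    - 2 * a * b * (C j 4 * C l 5 + C j 5 * C l 4)) * this

lemma hexQ_eq (s : Bool) (j l : Fin 6) :
    hexQ s j l = rowScale s j * rowScale s l * (2 * hexGram j l) := by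
  have := rt_mul
  cases s <;> fin_cases j <;> fin_cases l <;> simp [hexQ, rowScale, hexGram] <;> linarith

lemma RawChart.scale {C : Fin 6 → Fin 6 → ℝ} (h : RawChart C) (s : Bool) : Chart s (scale s C) where
  nn j i := mul_nonneg (mul_pos (rowScale_pos s j) (colScale_pos i)).le (h.nn j i)
  gram j l := by rw [bq_scale, h.gram, hexQ_eq]
  mono i hi j l hjl := by simpa only [scale_eq_zero] using h.mono i hi j l hjl
  ridge i j l hjl u v h0 h1 := by
    simp only [scale_eq_zero]
    have key : ∀ n, u * CD.scale s C j n + v * CD.scale s C l n =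
        colScale n * (u * rowScale s j * C j n + v * rowScale s l * C l n) := by
      intro n
      simp only [CD.scale]
      ring
    refine h.ridge i j l hjl (u * rowScale s j) (v * rowScale s l) (fun n hn => ?_) ?_
    · have := h0 n hn
      rw [key] at this
      exact (mul_eq_zero.1 this).resolve_left (colScale_pos n).ne'
    · rw [key] at h1
      exact right_ne_zero_of_mul h1

lemma Flag.scale {C : Fin 6 → Fin 6 → ℝ} {σ τ : Fin 6 → Fin 6} (h : Flag C σ τ) {s : Bool}
    (h0 : rowScale s (σ 0) * colScale (τ 0) = 1) (h1 : rowScale s (σ 1) * colScale (τ 1) = 1) :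
    Flag (scale s C) σ τ where
  inj := h.inj
  last := h.last
  row0 := by
    ext n
    by_cases hn : n = τ 0
    · subst hn; simp [CD.scale, h.row0, h0]
    · simp [CD.scale, h.row0, hn]
  row1 := by
    ext n
    by_cases hn : n = τ 1
    · subst hn; simp [CD.scale, h.row1, h1]
    · simp [CD.scale, h.row1, hn]
  pos t := scale_pos (h.pos t)
  zero a b hab hb := scale_eq_zero.2 (h.zero a b hab hb)

lemma Flag.zero_of {M : Fin 6 → Fin 6 → ℝ} {σ τ : Fin 6 → Fin 6} (h : Flag M σ τ) {a n : Fin 6}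
    (ha : 1 ≤ a) (hn : ∀ t, t ≤ a → n ≠ τ t) : M (σ a) n = 0 := by
  obtain ⟨t, rfl⟩ := Finite.surjective_of_injective h.inj n
  have : a < t := not_le.1 fun hta => hn t hta rfl
  exact h.zero a t this (by omega)

/-- The combinatorial data carried by a decomposition of the hexagon simplex into path simplices. -/
structure Tiling {ι : Type*} (C : ι → Fin 6 → Fin 6 → ℝ) : Prop where
  chart : ∀ T, RawChart (C T)
  overlap : ∀ (T T' : ι) (s s' : Fin 6 → ℝ), (∀ n, 0 < s n) → (∀ n, 0 < s' n) →
    (∀ j, ∑ n, C T j n * s n = ∑ n, C T' j n * s' n) → T = T'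
  flag : ∀ σ : Fin 6 → Fin 6, Function.Injective σ → ∃ T τ, Flag (C T) σ τ

lemma gramF_single (i : Fin 6) (v : Fin 6 → ℝ) : gramF (Pi.single i 1) v = pairF i v := by
  simp [gramF, Pi.single_apply]

lemma two_rt_mul : 2 * rt * rt = 1 := by linarith [rt_mul]

lemma RawChart.pathCode_eq {C : Fin 6 → Fin 6 → ℝ} (h : RawChart C) {j l i n : Fin 6}
    (hj : C j = Pi.single i 1) (hl : C l = Pi.single n 1) {c : Fin 4}
    (hc : hexGram j l = (![0, -rt, -1/2, 1] : Fin 4 → ℝ) c) : pathCode i n = c := by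
  apply code_injective
  rw [← hc, ← h.gram, hj, hl, gramF_single, pairF_single]

lemma exists_flagBC {C : Fin 6 → Fin 6 → ℝ} (h : RawChart C) {σ τ : Fin 6 → Fin 6} {u w : Fin 6}
    (hσ : σ = ![2, 3, 1, u, 0, w]) (hf : Flag C σ τ) :
    ∃ s, FlagBC s (scale s C) u w (τ 0) (τ 1) (τ 2) (τ 3) (τ 4) (τ 5) := by
  have h0 := hf.row0
  have h1 := hf.row1
  have hc : ∀ i j : Fin 6, pathCode i j = 1 →
      i = 0 ∧ j = 1 ∨ i = 1 ∧ j = 0 ∨ i = 3 ∧ j = 4 ∨ i = 4 ∧ j = 3 := by decide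
  simp only [hσ] at h0 h1
  have hs : ∃ s, rowScale s (σ 0) * colScale (τ 0) = 1 ∧ rowScale s (σ 1) * colScale (τ 1) = 1 := by
    simp only [hσ]
    rcases hc _ _ (h.pathCode_eq h0 h1 (by simp [hexGram])) with h' | h' | h' | h' <;>
      rw [h'.1, h'.2]
    exacts [⟨false, by simp [rowScale, colScale, two_rt_mul]⟩,
      ⟨true, by simp [rowScale, colScale, two_rt_mul]⟩,
      ⟨true, by simp [rowScale, colScale, two_rt_mul]⟩,
      ⟨false, by simp [rowScale, colScale, two_rt_mul]⟩]
  obtain ⟨s, hs0, hs1⟩ := hs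
  have hF := hf.scale hs0 hs1
  refine ⟨s, h.scale s, by simpa [hσ] using hF.row0, by simpa [hσ] using hF.row1,
    by simpa [hσ] using hF.pos 2, by simpa [hσ] using hF.pos 3, by simpa [hσ] using hF.pos 4,
    by simpa [hσ] using hF.pos 5, fun n a b c => ?_, fun n a b c d => ?_, fun n a b c d e => ?_,
    hf.nodup, hf.last⟩
  · simpa [hσ] using hF.zero_of (a := 2) (n := n) (by decide) (by
      intro t ht; fin_cases t <;> first | assumption | exact absurd ht (by decide))
  · simpa [hσ] using hF.zero_of (a := 3) (n := n) (by decide) (by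
      intro t ht; fin_cases t <;> first | assumption | exact absurd ht (by decide))
  · simpa [hσ] using hF.zero_of (a := 4) (n := n) (by decide) (by
      intro t ht; fin_cases t <;> first | assumption | exact absurd ht (by decide))

lemma exists_adapted {C : Fin 6 → Fin 6 → ℝ} (h : RawChart C) {σ τ : Fin 6 → Fin 6}
    (hσ : σ = ![1, 2, 4, 0, 3, 5]) (hf : Flag C σ τ)
    (hbd : ∀ s n, scale s C 0 n ≤
      (if s then 1 else 2) * (scale s C 4 n + scale s C 3 n) + scale s C 2 n) :
    ∃ s, Adapted s (scale s C) (τ 0) (τ 1) (τ 2) (τ 3) (τ 4) (τ 5) ∧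
      (s = true ∧ (τ 0 = 1 ∧ τ 1 = 2 ∨ τ 0 = 2 ∧ τ 1 = 1 ∨ τ 0 = 2 ∧ τ 1 = 3 ∨ τ 0 = 3 ∧ τ 1 = 2) ∨
      s = false ∧ (τ 0 = 4 ∧ τ 1 = 5 ∨ τ 0 = 5 ∧ τ 1 = 4)) := by
  have h0 := hf.row0
  have h1 := hf.row1
  have hc : ∀ i j : Fin 6, pathCode i j = 2 → ∃ s : Bool,
      s = true ∧ (i = 1 ∧ j = 2 ∨ i = 2 ∧ j = 1 ∨ i = 2 ∧ j = 3 ∨ i = 3 ∧ j = 2) ∨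
      s = false ∧ (i = 4 ∧ j = 5 ∨ i = 5 ∧ j = 4) := by decide
  simp only [hσ] at h0 h1
  obtain ⟨s, hs⟩ := hc _ _ (h.pathCode_eq h0 h1 (by simp [hexGram]))
  have hs' : rowScale s (σ 0) * colScale (τ 0) = 1 ∧ rowScale s (σ 1) * colScale (τ 1) = 1 := by
    simp only [hσ]
    rcases hs with ⟨rfl, h' | h' | h' | h'⟩ | ⟨rfl, h' | h'⟩ <;> rw [h'.1, h'.2] <;>
      simp [rowScale, colScale, two_rt_mul]
  have hF := hf.scale hs'.1 hs'.2
  refine ⟨s, ⟨h.scale s, by simpa [hσ] using hF.row0, by simpa [hσ] using hF.row1,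
    by simpa [hσ] using hF.pos 2, by simpa [hσ] using hF.pos 3, by simpa [hσ] using hF.pos 4,
    by simpa [hσ] using hF.pos 5, fun n a b c => ?_, fun n a b c d => ?_, fun n a b c d e => ?_,
    hf.nodup, hf.last, hbd s⟩, hs⟩
  · simpa [hσ] using hF.zero_of (a := 2) (n := n) (by decide) (by
      intro t ht; fin_cases t <;> first | assumption | exact absurd ht (by decide))
  · simpa [hσ] using hF.zero_of (a := 3) (n := n) (by decide) (by
      intro t ht; fin_cases t <;> first | assumption | exact absurd ht (by decide))
  · simpa [hσ] using hF.zero_of (a := 4) (n := n) (by decide) (by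
      intro t ht; fin_cases t <;> first | assumption | exact absurd ht (by decide))

lemma Adapted.absurd {s : Bool} {M : Fin 6 → Fin 6 → ℝ} {i j p q t k : Fin 6}
    (h : Adapted s M i j p q t k)
    (hs : s = true ∧ (i = 1 ∧ j = 2 ∨ i = 2 ∧ j = 1 ∨ i = 2 ∧ j = 3 ∨ i = 3 ∧ j = 2) ∨
      s = false ∧ (i = 4 ∧ j = 5 ∨ i = 5 ∧ j = 4)) : False := by
  rcases hs with ⟨rfl, ⟨rfl, rfl⟩ | ⟨rfl, rfl⟩ | ⟨rfl, rfl⟩ | ⟨rfl, rfl⟩⟩ |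
    ⟨rfl, ⟨rfl, rfl⟩ | ⟨rfl, rfl⟩⟩
  exacts [not_adapted_one_two h, not_adapted_two_one h, not_adapted_two_three h,
      not_adapted_three_two h, not_adapted_four_five h, not_adapted_five_four h]

section Tiling

variable {ι : Type*} {C : ι → Fin 6 → Fin 6 → ℝ}

lemma Tiling.scale_overlap (h : Tiling C) (s : Bool) {T T' : ι} {a a' : Fin 6 → ℝ}
    (ha : ∀ n, 0 < a n) (ha' : ∀ n, 0 < a' n)
    (hc : ∀ j, ∑ n, scale s (C T) j n * a n = ∑ n, scale s (C T') j n * a' n) : T = T' := by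
  refine h.overlap T T' (fun n => colScale n * a n) (fun n => colScale n * a' n)
    (fun n => mul_pos (colScale_pos n) (ha n)) (fun n => mul_pos (colScale_pos n) (ha' n))
    fun j => ?_
  have hj := hc j
  simp only [scale, mul_assoc, ← Finset.mul_sum] at hj
  have := mul_left_cancel₀ (rowScale_pos s j).ne' hj
  simpa only [mul_left_comm, mul_assoc] using this

lemma Chart.sum_pos {s : Bool} {M : Fin 6 → Fin 6 → ℝ} (h : Chart s M) (j : Fin 6)
    {a : Fin 6 → ℝ} (ha : ∀ n, 0 < a n) : 0 < ∑ n, M j n * a n := by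
  have h0 : ∀ n, 0 ≤ M j n * a n := fun n => mul_nonneg (h.nn j n) (ha n).le
  refine (Finset.sum_nonneg fun n _ => h0 n).lt_of_ne' fun h1 => ?_
  have h2 : M j = 0 := funext fun n => by
    simpa [(ha n).ne'] using (Finset.sum_eq_zero_iff_of_nonneg fun n _ => h0 n).1 h1 n
  have h3 := h.gram j j
  rw [h2] at h3
  cases s <;> fin_cases j <;> simp [bq_eq, hexQ] at h3

lemma hexGram_rev (j l : Fin 6) : hexGram j.rev l.rev = hexGram j l := by
  fin_cases j <;> fin_cases l <;> rfl

lemma Tiling.rev (h : Tiling C) : Tiling fun T j => C T j.rev where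
  chart T := ⟨fun j => (h.chart T).nn _, fun j l => by rw [(h.chart T).gram, hexGram_rev],
    fun i hi j l hjl => (h.chart T).mono i hi _ _ (Fin.rev_injective.ne hjl),
    fun i j l hjl => (h.chart T).ridge i _ _ (Fin.rev_injective.ne hjl)⟩
  overlap T T' a a' ha ha' hc := h.overlap T T' a a' ha ha' fun j => by simpa using hc j.rev
  flag σ hσ := by
    obtain ⟨T, τ, hf⟩ := h.flag (fun n => (σ n).rev) (Fin.rev_injective.comp hσ)
    exact ⟨T, τ, hf.inj, hf.last, hf.row0, hf.row1, hf.pos, hf.zero⟩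

end Tiling

section Tiling

variable {ι : Type*} {C : ι → Fin 6 → Fin 6 → ℝ}

lemma exists_pos_add_mul {A δ : ℝ} (hδ : 0 < δ) : ∃ N : ℝ, 0 ≤ N ∧ 0 < A + N * δ := by
  refine ⟨(|A| + 1) / δ, by positivity, ?_⟩
  rw [div_mul_cancel₀ _ hδ.ne']
  linarith [neg_abs_le A]

lemma sum_bump (u : Fin 6 → ℝ) (N : ℝ) (n : Fin 6) :
    ∑ m, u m * (1 + N * (Pi.single n 1 : Fin 6 → ℝ) m) = ∑ m, u m + N * u n := by
  simp [mul_add, Finset.sum_add_distrib, Pi.single_apply]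
  ring

lemma bump_pos {N : ℝ} (hN : 0 ≤ N) (n m : Fin 6) :
    0 < 1 + N * (Pi.single n 1 : Fin 6 → ℝ) m := by
  have : 0 ≤ (Pi.single n 1 : Fin 6 → ℝ) m := by
    by_cases h : m = n
    · subst h; simp
    · simp [h]
  positivity

lemma Tiling.le_of_tileA (h : Tiling C) {T₀ T : ι} (h₀ : scale true (C T₀) = tileA) (hT : T ≠ T₀)
    (n : Fin 6) : scale true (C T) 5 n ≤
      2 * (scale true (C T) 0 n + scale true (C T) 1 n + scale true (C T) 2 n)
        + scale true (C T) 3 n := by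
  by_contra! hlt
  have hM := (h.chart T).scale true
  generalize hMd : scale true (C T) = M at hM hlt
  obtain ⟨N, hN, hpos⟩ := exists_pos_add_mul (sub_pos.2 hlt)
    (A := ∑ m, M 5 m - (2 * (∑ m, M 0 m + ∑ m, M 1 m + ∑ m, M 2 m) + ∑ m, M 3 m))
  set t : Fin 6 → ℝ := fun j => ∑ m, M j m * (1 + N * (Pi.single n 1 : Fin 6 → ℝ) m) with ht
  have htp : ∀ j, 0 < t j := fun j => hM.sum_pos j (bump_pos hN n)
  refine hT (h.scale_overlap true (a := fun m => 1 + N * (Pi.single n 1 : Fin 6 → ℝ) m)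
    (a' := ![(t 5 - (2 * (t 0 + t 1 + t 2) + t 3)) / 2, t 0, t 1, t 2, t 3, t 4])
    (bump_pos hN n) (fun m => ?_) fun j => ?_)
  · have h0 : 0 < t 5 - (2 * (t 0 + t 1 + t 2) + t 3) := by
      simp only [ht, sum_bump]
      linarith
    fin_cases m <;> simp [htp] <;> linarith
  · rw [hMd, h₀]
    change t j = _
    fin_cases j <;> simp [Fin.sum_univ_six, tileA]
    ring

lemma Tiling.le_of_tileB (h : Tiling C) {T₀ T : ι} (h₀ : scale false (C T₀) = tileB) (hT : T ≠ T₀)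
    {k : Fin 6} (hk : k = 0 ∨ k = 5) (h5 : 0 < C T 5 k) (n : Fin 6) : scale false (C T) 0 n ≤
      2 * (scale false (C T) 4 n + scale false (C T) 3 n) + scale false (C T) 2 n := by
  by_contra! hlt
  have hM := (h.chart T).scale false
  replace h5 := scale_pos h5 (s := false)
  generalize hMd : scale false (C T) = M at hM hlt h5
  obtain ⟨N, hN, hpos⟩ := exists_pos_add_mul (sub_pos.2 hlt)
    (A := ∑ m, M 0 m - (2 * (∑ m, M 4 m + ∑ m, M 3 m) + ∑ m, M 2 m))
  set v : Fin 6 → ℝ := fun j => ∑ m, M j m * (1 + N * (Pi.single n 1 : Fin 6 → ℝ) m) with hv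
  obtain ⟨N', hN', hpos'⟩ := exists_pos_add_mul h5
    (A := v 5 - ((v 0 - v 2) / 2 - v 4 - v 3))
  have ha : ∀ m,
      0 < 1 + N * (Pi.single n 1 : Fin 6 → ℝ) m + N' * (Pi.single k 1 : Fin 6 → ℝ) m := by
    intro m
    linarith [bump_pos hN n m, bump_pos hN' k m, bump_pos hN n m,
      show 0 ≤ N' * (Pi.single k 1 : Fin 6 → ℝ) m from mul_nonneg hN' (by
        by_cases h : m = k
        · subst h; simp
        · simp [h])]
  have ht : ∀ j, ∑ m, M j m * (1 + N * (Pi.single n 1 : Fin 6 → ℝ) m +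
      N' * (Pi.single k 1 : Fin 6 → ℝ) m) = v j + N' * M j k := by
    intro j
    simp [hv, mul_add, Finset.sum_add_distrib, Pi.single_apply]
    ring
  have htv : ∀ j, j ≠ 5 → ∑ m, M j m * (1 + N * (Pi.single n 1 : Fin 6 → ℝ) m +
      N' * (Pi.single k 1 : Fin 6 → ℝ) m) = v j := by
    intro j hj
    rw [ht, hM.col hk h5 j hj.symm]
    simp
  have hvp : ∀ j, j ≠ 5 → 0 < v j := fun j hj => htv j hj ▸ hM.sum_pos j ha
  refine hT (h.scale_overlap false
    (a' := ![v 5 + N' * M 5 k - ((v 0 - v 2) / 2 - v 4 - v 3), (v 0 - v 2) / 2 - v 4 - v 3,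
      v 4, v 3, v 2, v 1]) ha (fun m => ?_) fun j => ?_)
  · have h0 : 0 < v 0 - (2 * (v 4 + v 3) + v 2) := by
      simp only [hv, sum_bump]
      linarith
    fin_cases m <;> simp <;> first | linarith | exact hvp _ (by decide)
  · rw [hMd, h₀]
    by_cases hj : j = 5
    · rw [hj, ht]
      simp [Fin.sum_univ_six, tileB]
    · rw [htv j hj]
      fin_cases j <;> simp [Fin.sum_univ_six, tileB] at hj ⊢
      ring

lemma scale_true_mul (M : Fin 6 → Fin 6 → ℝ) (j n : Fin 6) :
    rowScale true j * scale false M j n = rowScale false j * scale true M j n := by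
  simp only [scale]
  ring

lemma Tiling.ne_tileB (h : Tiling C) (T₀ : ι) : scale false (C T₀) ≠ tileB := by
  intro h₀
  obtain ⟨T, τ, hf⟩ := h.flag ![1, 2, 4, 0, 3, 5] (by decide)
  have hT : T ≠ T₀ := by
    rintro rfl
    have hz : ∀ n, C T 0 n = 0 → n = 0 ∨ n = 5 := by
      intro n hn
      rw [← scale_eq_zero (s := false), h₀] at hn
      fin_cases n <;> simp [tileB] at hn ⊢
    have h4 := hz _ (by simpa using hf.zero 3 4 (by decide) (by decide))
    have h5 := hz _ (by simpa using hf.zero 3 5 (by decide) (by decide))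
    have ha : τ 0 = 5 := by
      have := hf.row0
      have h1 := congr_fun (congr_fun h₀ 1) (τ 0)
      simp [tileB] at this h1
      by_contra hne
      simp [scale, this, hne, (rowScale_pos _ _).ne', (colScale_pos _).ne'] at h1
    have n1 := hf.inj.ne (show (4 : Fin 6) ≠ 0 by decide)
    have n2 := hf.inj.ne (show (5 : Fin 6) ≠ 0 by decide)
    have n3 := hf.inj.ne (show (5 : Fin 6) ≠ 4 by decide)
    rw [ha] at n1 n2
    exact n3 ((h5.resolve_right n2).trans (h4.resolve_right n1).symm)
  have hb := h.le_of_tileB h₀ hT hf.last (by simpa using hf.pos 5)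
  obtain ⟨s, hA, hs⟩ := exists_adapted (h.chart T) rfl hf fun s n => by
    cases s
    · simpa using hb n
    · have e : ∀ j, _ := fun j => scale_true_mul (C T) j n
      have e0 := e 0
      have e2 := e 2
      have e3 := e 3
      have e4 := e 4
      simp [rowScale] at e0 e2 e3 e4 ⊢
      have := hb n
      rw [e0, e2] at this
      refine le_of_mul_le_mul_left ?_ (mul_pos two_pos rt_pos)
      rw [← e3, ← e4]
      linear_combination this - 4 * (scale false (C T) 3 n + scale false (C T) 4 n) * rt_mul
  exact hA.absurd hs

lemma Tiling.exists_tileA (h : Tiling C) : ∃ T, scale true (C T) = tileA := by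
  obtain ⟨T, τ, hf⟩ := h.flag ![2, 3, 1, 4, 0, 5] (by decide)
  obtain ⟨s, hs⟩ := exists_flagBC (h.chart T) rfl hf
  rcases hs.tile_cases with ⟨rfl, hT⟩ | ⟨rfl, hT⟩
  exacts [⟨T, hT⟩, (h.ne_tileB T hT).elim]

theorem not_tiling : ¬ Tiling C := by
  intro h
  obtain ⟨T₀, h₀⟩ := h.exists_tileA
  obtain ⟨T₁, h₁⟩ := h.rev.exists_tileA
  obtain ⟨T, τ, hf⟩ := h.flag ![2, 3, 1, 5, 0, 4] (by decide)
  have hT : T ≠ T₀ := by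
    rintro rfl
    have hz : ∀ n, C T 5 n = 0 → n = 5 := by
      intro n hn
      rw [← scale_eq_zero (s := true), h₀] at hn
      fin_cases n <;> simp [tileA] at hn ⊢
    exact absurd ((hz _ (by simpa using hf.zero 3 4 (by decide) (by decide))).trans
      (hz _ (by simpa using hf.zero 3 5 (by decide) (by decide))).symm) (hf.inj.ne (by decide))
  have hst := h.le_of_tileA h₀ hT
  have hst' : T ≠ T₁ → ∀ n, scale true (C T) 0 n ≤ scale true (C T) 5 n + scale true (C T) 4 n +
      scale true (C T) 3 n + scale true (C T) 2 n := by
    intro hT₁ n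
    have h1 := h.rev.le_of_tileA h₁ hT₁ n
    simp [scale, rowScale, Fin.rev] at h1 ⊢
    have h2 := mul_le_mul_of_nonneg_left h1 rt_pos.le
    linear_combination h2 - 2 * colScale n * (C T 0 n - C T 2 n) * rt_mul
  obtain ⟨s, hs⟩ := exists_flagBC (h.chart T) rfl hf
  revert hs
  generalize τ 0 = i, τ 1 = j, τ 2 = p, τ 3 = q, τ 4 = t, τ 5 = k
  intro hs
  rcases hs.bc_cases with ⟨rfl, rfl, rfl⟩ | ⟨rfl, rfl, rfl⟩ | ⟨rfl, rfl, rfl⟩ | ⟨rfl, rfl, rfl⟩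
  · exact not_flagBC_zero_one hs
  · obtain ⟨rfl, -⟩ := flagBC_one_zero hs
    obtain ⟨rfl, -⟩ := perm_one_zero_two q t k hs.nd hs.hk
    exact not_flagBC_five_one_zero_two hs hst
  · obtain ⟨rfl, -⟩ := flagBC_three_four hs
    rcases perm_three_four_two q t k hs.nd hs.hk with
      rfl | ⟨rfl, rfl, rfl⟩ | ⟨rfl, rfl, rfl⟩ | ⟨rfl, rfl, rfl⟩
    · exact not_flagBC_five_three_four_two_zero hs hst
    · exact not_flagBC_five_three_four_two_five hs hst
    · exact not_flagBC_five_three_four_two_one_five_zero hs hst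
    · refine not_flagBC_five_three_four_two_one_zero_five hs (hst' ?_)
      rintro rfl
      have h2 := congr_fun (congr_fun h₁ 2) 3
      have h3 : C T 3 3 = 0 := by
        rw [← scale_eq_zero (s := true), hs.c]
        simp
      simp [scale, tileA, Fin.rev, h3] at h2
  · obtain ⟨rfl, -⟩ := flagBC_four_three hs
    obtain ⟨rfl, -⟩ := perm_four_three_five q t k hs.nd hs.hk
    refine not_flagBC_five_four_three_five hs fun n => ?_
    have e : ∀ j, _ := fun j => scale_true_mul (C T) j n
    have e0 := e 0
    have e1 := e 1
    have e2 := e 2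
    have e3 := e 3
    have e5 := e 5
    simp [rowScale] at e0 e1 e2 e3 e5
    have := hst n
    rw [← e5, ← e3] at this
    refine le_of_mul_le_mul_left ?_ (mul_pos two_pos rt_pos)
    rw [e0, e1, e2]
    linear_combination this -
      4 * (scale true (C T) 0 n + scale true (C T) 1 n + scale true (C T) 2 n) * rt_mul

end Tiling

/-- The ambient vector space of the hyperboloid model. -/
abbrev V (n : ℕ) : Type := EuclideanSpace ℝ (Fin (n + 1))

section Mink
variable {n : ℕ}

lemma mink_comm (x y : V n) : mink n x y = mink n y x := by
  simp only [mink, mul_comm]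

/-- The Minkowski form as a bilinear form. -/
def minkB (n : ℕ) : LinearMap.BilinForm ℝ (V n) :=
  LinearMap.mk₂ ℝ (mink n)
    (fun x y z => by simp [mink, add_mul, Finset.sum_add_distrib]; ring)
    (fun c x z => by simp [mink, mul_add, Finset.mul_sum, mul_assoc])
    (fun x y z => by simp [mink, mul_add, Finset.sum_add_distrib]; ring)
    (fun c x z => by simp [mink, mul_add, Finset.mul_sum, mul_left_comm])

lemma minkB_apply (x y : V n) : minkB n x y = mink n x y := rfl

@[simp] lemma mink_add_left (x y z : V n) : mink n (x + y) z = mink n x z + mink n y z := by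
  simp [← minkB_apply]

@[simp] lemma mink_add_right (x y z : V n) : mink n x (y + z) = mink n x y + mink n x z := by
  simp [← minkB_apply]

@[simp] lemma mink_sub_left (x y z : V n) : mink n (x - y) z = mink n x z - mink n y z := by
  simp [← minkB_apply]

@[simp] lemma mink_sub_right (x y z : V n) : mink n x (y - z) = mink n x y - mink n x z := by
  simp [← minkB_apply]

@[simp] lemma mink_smul_left (c : ℝ) (x y : V n) : mink n (c • x) y = c * mink n x y := by
  simp [← minkB_apply]

@[simp] lemma mink_smul_right (c : ℝ) (x y : V n) : mink n x (c • y) = c * mink n x y := by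
  simp [← minkB_apply]

@[simp] lemma mink_neg_left (x y : V n) : mink n (-x) y = -mink n x y := by
  simp [← minkB_apply]

@[simp] lemma mink_neg_right (x y : V n) : mink n x (-y) = -mink n x y := by
  simp [← minkB_apply]

@[simp] lemma mink_zero_left (x : V n) : mink n 0 x = 0 := by simp [← minkB_apply]

@[simp] lemma mink_zero_right (x : V n) : mink n x 0 = 0 := by simp [← minkB_apply]

lemma mink_sum_left {ι : Type*} (s : Finset ι) (f : ι → V n) (y : V n) :
    mink n (∑ i ∈ s, f i) y = ∑ i ∈ s, mink n (f i) y := by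
  simp [← minkB_apply]

lemma mink_sum_right {ι : Type*} (s : Finset ι) (f : ι → V n) (y : V n) :
    mink n y (∑ i ∈ s, f i) = ∑ i ∈ s, mink n y (f i) := by
  simp [← minkB_apply]

lemma eq_zero_of_mink (x : V n) (h : ∀ y, mink n x y = 0) : x = 0 := by
  ext i
  have := h (EuclideanSpace.single i 1)
  refine i.cases (fun h => ?_) (fun j h => ?_) this
  · simpa [mink] using h
  · simpa [mink, (Fin.succ_ne_zero j).symm] using h

lemma continuous_mink_right (v : V n) : Continuous fun x : V n => mink n v x := by
  unfold mink
  fun_prop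

/-- A timelike vector strictly dominates its orthogonal complement. -/
lemma mink_self_pos {x y : V n} (hx : mink n x x < 0) (hy : mink n y x = 0) (h0 : y ≠ 0) :
    0 < mink n y y := by
  have hc := Finset.sum_mul_sq_le_sq_mul_sq Finset.univ (fun i : Fin n => y i.succ)
    fun i => x i.succ
  simp only [mink, ← sq] at hx hy ⊢
  set a := ∑ i : Fin n, y i.succ ^ 2 with ha
  set b := ∑ i : Fin n, x i.succ ^ 2
  set c := ∑ i : Fin n, y i.succ * x i.succ
  have ha0 : 0 ≤ a := by positivity
  have hb0 : 0 ≤ b := by positivity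
  rcases ha0.eq_or_lt with h | h
  · exfalso
    apply h0
    have hz := (Finset.sum_eq_zero_iff_of_nonneg fun i _ => sq_nonneg (y (Fin.succ i))).1 h.symm
    have hy0 : y 0 ^ 2 * x 0 ^ 2 ≤ 0 := by
      have : c = y 0 * x 0 := by linarith
      rw [← mul_pow, ← this]
      simpa [← h] using hc
    have hx0 : 0 < x 0 ^ 2 := by linarith
    have : y 0 = 0 := by
      by_contra hne
      have := mul_pos (pow_pos (abs_pos.2 hne) 2) hx0
      rw [sq_abs] at this
      linarith
    ext i
    refine i.cases this fun j => ?_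
    simpa using hz j (Finset.mem_univ j)
  · have hcc : c = y 0 * x 0 := by linarith
    have hx0 : 0 < x 0 ^ 2 := by linarith
    have : y 0 ^ 2 * x 0 ^ 2 < a * x 0 ^ 2 := by
      rw [← mul_pow, ← hcc]
      exact hc.trans_lt (mul_lt_mul_of_pos_left (by linarith) h)
    linarith [lt_of_mul_lt_mul_right this hx0.le]

lemma mink_neg_of_future {x y : V n} (hx : mink n x x < 0) (hx0 : 0 < x 0) (hy : mink n y y ≤ 0)
    (hy0 : 0 < y 0) : mink n x y < 0 := by
  have hc := Finset.sum_mul_sq_le_sq_mul_sq Finset.univ (fun i : Fin n => x i.succ)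
    fun i => y i.succ
  simp only [mink, ← sq] at hx hy ⊢
  set a := ∑ i : Fin n, y i.succ ^ 2
  set b := ∑ i : Fin n, x i.succ ^ 2
  set c := ∑ i : Fin n, x i.succ * y i.succ
  have hb0 : 0 ≤ b := by positivity
  have h1 : c ^ 2 < (x 0 * y 0) ^ 2 := by
    rw [mul_pow]
    calc c ^ 2 ≤ b * a := hc
      _ ≤ b * y 0 ^ 2 := mul_le_mul_of_nonneg_left (by linarith) hb0
      _ < x 0 ^ 2 * y 0 ^ 2 := mul_lt_mul_of_pos_right (by linarith) (by positivity)
  linarith [lt_of_pow_lt_pow_left₀ 2 (mul_pos hx0 hy0).le h1]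

lemma apply_zero_ne {y : V n} (hy : mink n y y ≤ 0) (h : y ≠ 0) : y 0 ≠ 0 := by
  intro h0
  apply h
  simp only [mink, ← sq, h0] at hy
  have h1 : ∑ i : Fin n, y i.succ ^ 2 = 0 := le_antisymm (by linarith) (by positivity)
  have hz := (Finset.sum_eq_zero_iff_of_nonneg fun i _ => sq_nonneg (y (Fin.succ i))).1 h1
  ext i
  refine i.cases h0 fun j => ?_
  simpa using hz j (Finset.mem_univ j)

lemma normalize_mem {z : V n} (hz : mink n z z < 0) (h0 : 0 < z 0) :
    (√(-mink n z z))⁻¹ • z ∈ hypSet n := by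
  have hs : 0 < √(-mink n z z) := Real.sqrt_pos.2 (by linarith)
  refine ⟨?_, mul_pos (inv_pos.2 hs) h0⟩
  have h2 := Real.mul_self_sqrt (show 0 ≤ -mink n z z by linarith)
  rw [mink_smul_left, mink_smul_right, ← mul_assoc, ← mul_inv, h2, inv_neg, neg_mul,
    inv_mul_cancel₀ hz.ne]

lemma exists_normalized {z : V n} (hz : mink n z z < 0) (h0 : 0 < z 0) :
    ∃ c : ℝ, 0 < c ∧ ∃ x : hypSet n, x.val = c • z :=
  ⟨_, inv_pos.2 (Real.sqrt_pos.2 (neg_pos.2 hz)), ⟨_, normalize_mem hz h0⟩, rfl⟩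

lemma mem_hHalf {v : V n} {x : hypSet n} : x ∈ hHalf n v ↔ mink n v x.val ≤ 0 := Iff.rfl

lemma mem_hWall {v : V n} {x : hypSet n} : x ∈ hWall n v ↔ mink n v x.val = 0 := Iff.rfl

lemma isOpen_mink_neg (v : V n) : IsOpen {x : hypSet n | mink n v x.val < 0} :=
  isOpen_lt ((continuous_mink_right v).comp continuous_subtype_val) continuous_const

/-- Sufficiently near multiples of a hyperboloid point, perturbations normalise to nearby points. -/
lemma exists_perturb {U : Set (hypSet n)} (hU : IsOpen U) {z : hypSet n} (hz : z ∈ U) (v : V n) :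
    ∃ δ > 0, ∀ t : ℝ, |t| < δ → ∃ c : ℝ, 0 < c ∧ ∃ x ∈ U, x.val = c • (z.val + t • v) := by
  obtain ⟨W, hW, rfl⟩ := isOpen_induced_iff.1 hU
  have hf : ContinuousAt (fun t : ℝ => (√(-mink n (z.val + t • v) (z.val + t • v)))⁻¹ •
      (z.val + t • v)) 0 := by
    have h0 : √(-mink n (z.val + (0 : ℝ) • v) (z.val + (0 : ℝ) • v)) ≠ 0 := by simp [z.2.1]
    have h1 : Continuous fun t : ℝ => √(-mink n (z.val + t • v) (z.val + t • v)) := by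
      unfold mink
      fun_prop
    have h2 : Continuous fun t : ℝ => z.val + t • v := by fun_prop
    exact (h1.continuousAt.inv₀ h0).smul h2.continuousAt
  have h1 : ∀ᶠ t : ℝ in nhds 0, (√(-mink n (z.val + t • v) (z.val + t • v)))⁻¹ •
      (z.val + t • v) ∈ W := hf (hW.mem_nhds (by simpa [z.2.1] using hz))
  have h2 : ∀ᶠ t : ℝ in nhds 0, mink n (z.val + t • v) (z.val + t • v) < 0 := by
    refine ContinuousAt.eventually_lt ?_ continuousAt_const (by simp [z.2.1])
    unfold mink
    fun_prop
  have h3 : ∀ᶠ t : ℝ in nhds 0, 0 < (z.val + t • v) 0 := by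
    refine ContinuousAt.eventually_lt continuousAt_const (Continuous.continuousAt ?_)
      (by simpa using z.2.2)
    simp only [PiLp.add_apply, PiLp.smul_apply]
    fun_prop
  obtain ⟨δ, hδ, h⟩ := Metric.eventually_nhds_iff.1 (h1.and (h2.and h3))
  refine ⟨δ, hδ, fun t ht => ?_⟩
  obtain ⟨h1, h2, h3⟩ := h (y := t) (by simpa using ht)
  exact ⟨_, inv_pos.2 (Real.sqrt_pos.2 (neg_pos.2 h2)), ⟨_, normalize_mem h2 h3⟩, h1, rfl⟩

lemma mink_neg_of_mem_interior {v : V n} (hv : mink n v v = 1) {S : Set (hypSet n)}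
    (hS : S ⊆ hHalf n v) {z : hypSet n} (hz : z ∈ interior S) : mink n v z.val < 0 := by
  obtain ⟨δ, hδ, h⟩ := exists_perturb isOpen_interior hz v
  obtain ⟨c, hc, x, hx, hxc⟩ := h (δ / 2) (by rw [abs_of_pos] <;> linarith)
  have := hS (interior_subset hx)
  simp only [mem_hHalf, hxc, mink_smul_right, mink_add_right, hv] at this
  nlinarith [nonpos_of_mul_nonpos_right this hc]

end Mink

section Volume
open scoped Pointwise

/-- Euclidean length on `Fin 5 → ℝ`, whose norm is the sup norm. -/
def len (y : Fin 5 → ℝ) : ℝ := √(∑ i, y i ^ 2)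

lemma len_smul {s : ℝ} (hs : 0 ≤ s) (y : Fin 5 → ℝ) : len (s • y) = s * len y := by
  simp only [len, Pi.smul_apply, smul_eq_mul, mul_pow, ← Finset.mul_sum]
  rw [Real.sqrt_mul (sq_nonneg s), Real.sqrt_sq hs]

lemma sq_len (y : Fin 5 → ℝ) : len y ^ 2 = ∑ i, y i ^ 2 := Real.sq_sqrt (by positivity)

lemma continuous_len : Continuous len := by
  unfold len
  fun_prop

lemma len_nonneg (y : Fin 5 → ℝ) : 0 ≤ len y := Real.sqrt_nonneg _

/-- The pairing of `v` with the vector `(a, y)`. -/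
def slope (v : V 5) (a : ℝ) (y : Fin 5 → ℝ) : ℝ := ∑ i, v (Fin.succ i) * y i - v 0 * a

lemma slope_smul (s : ℝ) (v : V 5) (a : ℝ) (y : Fin 5 → ℝ) :
    slope v (s * a) (s • y) = s * slope v a y := by
  simp only [slope, Pi.smul_apply, smul_eq_mul, mul_sub, Finset.mul_sum]
  congr 1
  · exact Finset.sum_congr rfl fun i _ => by ring
  · ring

/-- The truncation at height `s` of the open cone where all slopes are below `-η`. -/
def sector {k : ℕ} (v : Fin k → V 5) (η s : ℝ) : Set (Fin 5 → ℝ) :=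
  {y | len y < s ∧ ∀ j, slope (v j) (len y) y < -(η * len y)}

variable {k : ℕ} {v : Fin k → V 5} {η : ℝ}

lemma sector_eq_smul {s : ℝ} (hs : 0 < s) : sector v η s = s • sector v η 1 := by
  ext y
  rw [mem_smul_set_iff_inv_smul_mem₀ hs.ne']
  have hi := inv_pos.2 hs
  simp only [sector, mem_ofPred_eq, len_smul hi.le, slope_smul]
  refine and_congr ?_ (forall_congr' fun j => ?_)
  · rw [inv_mul_lt_iff₀ hs, mul_one]
  · rw [mul_left_comm η, ← mul_neg s⁻¹, mul_lt_mul_iff_right₀ hi]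

lemma isOpen_sector (s : ℝ) : IsOpen (sector v η s) := by
  have := continuous_len
  refine (isOpen_lt this continuous_const).inter ?_
  change IsOpen {y | ∀ j, slope (v j) (len y) y < -(η * len y)}
  simp only [ofPred_forall]
  refine isOpen_iInter_of_finite fun j => isOpen_lt ?_ (by fun_prop)
  unfold slope
  fun_prop

lemma volume_sector_lt_top : volume (sector v η 1) < ⊤ := by
  refine (measure_mono fun y hy => ?_).trans_lt (measure_ball_lt_top (x := (0 : Fin 5 → ℝ))
      (r := 1))
  rw [mem_ball_zero_iff, pi_norm_lt_iff one_pos]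
  intro i
  rw [Real.norm_eq_abs]
  refine lt_of_le_of_lt ?_ hy.1
  exact Real.abs_le_sqrt (Finset.single_le_sum (f := fun i => y i ^ 2)
    (fun _ _ => sq_nonneg _) (Finset.mem_univ i))

lemma volume_sector {s : ℝ} (hs : 0 < s) :
    volume (sector v η s) = ENNReal.ofReal (s ^ 5) * volume (sector v η 1) := by
  rw [sector_eq_smul hs, Measure.addHaar_smul]
  simp [abs_of_pos hs]

lemma mem_klein_image {X : Set (hypSet 5)} (hX : X = ⋂ i, hHalf 5 (v i)) {y : Fin 5 → ℝ}
    (hy : len y < 1) (h : ∀ j, slope (v j) 1 y ≤ 0) : y ∈ klein 5 '' X := by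
  let z : V 5 := WithLp.toLp 2 (Fin.cons 1 y)
  have hz : mink 5 z z < 0 := by
    have : len y ^ 2 < 1 := pow_lt_one₀ (len_nonneg y) hy two_ne_zero
    rw [sq_len] at this
    simp only [mink, z, Fin.cons_zero, Fin.cons_succ, ← sq]
    linarith
  have hz0 : z 0 = 1 := rfl
  obtain ⟨c, hc, x, hx⟩ := exists_normalized hz (by rw [hz0]; exact one_pos)
  refine ⟨x, ?_, ?_⟩
  · rw [hX, mem_iInter]
    intro j
    rw [mem_hHalf, hx, mink_smul_right]
    refine mul_nonpos_of_nonneg_of_nonpos hc.le (le_of_eq_of_le ?_ (h j))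
    simp only [mink, slope, z, Fin.cons_zero, Fin.cons_succ]
    ring
  · ext i
    simp [klein, hx, z, hc.ne']

lemma shell_le_hVol {X : Set (hypSet 5)} (hX : X = ⋂ i, hHalf 5 (v i)) {ε : ℝ} (hε : 0 < ε)
    (hε4 : ε < 1 / 4) (h : ∀ j, |v j 0| * (2 * ε) < η * (1 - 2 * ε)) (hη : 0 < η) :
    ENNReal.ofReal (((4 * ε) ^ 3)⁻¹) * volume (sector v η (1 - ε) \ sector v η (1 - 2 * ε)) ≤
      hVol 5 X := by
  have hm : MeasurableSet (sector v η (1 - ε) \ sector v η (1 - 2 * ε)) :=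
    (isOpen_sector _).measurableSet.diff (isOpen_sector _).measurableSet
  rw [← setLIntegral_const]
  have hlen : ∀ y ∈ sector v η (1 - ε) \ sector v η (1 - 2 * ε),
      1 - 2 * ε ≤ len y ∧ len y < 1 - ε := fun y hy =>
    ⟨not_lt.1 fun hlt => hy.2 ⟨hlt, hy.1.2⟩, hy.1.1⟩
  refine (setLIntegral_mono' hm fun y hy => ?_).trans
    (lintegral_mono_set (s := sector v η (1 - ε) \ sector v η (1 - 2 * ε)) fun y hy => ?_)
  · obtain ⟨h1, h2⟩ := hlen y hy
    refine ENNReal.ofReal_le_ofReal ?_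
    rw [← sq_len]
    have h3 : 0 < 1 - len y ^ 2 := by nlinarith [len_nonneg y]
    have : (-(((5 : ℕ) : ℝ) + 1) / 2) = -((3 : ℕ) : ℝ) := by norm_num
    rw [this, Real.rpow_neg h3.le, Real.rpow_natCast]
    refine inv_anti₀ (by positivity) (pow_le_pow_left₀ h3.le ?_ 3)
    nlinarith
  · obtain ⟨h1, h2⟩ := hlen y hy
    refine mem_klein_image hX (by linarith) fun j => ?_
    have h3 := hy.1.2 j
    have h4 := h j
    have h5 : -(v j 0) * (1 - len y) ≤ |v j 0| * (2 * ε) :=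
      mul_le_mul (neg_le_abs _) (by linarith) (by linarith) (abs_nonneg _)
    have h6 : η * (1 - 2 * ε) ≤ η * len y := mul_le_mul_of_nonneg_left h1 hη.le
    simp only [slope] at h3 ⊢
    linarith

lemma hVol_eq_top {X : Set (hypSet 5)} (hX : X = ⋂ i, hHalf 5 (v i)) {l : V 5}
    (hl : mink 5 l l = 0) (hl0 : 0 < l 0) (h : ∀ j, mink 5 (v j) l < 0) : hVol 5 X = ⊤ := by
  wlog h1 : l 0 = 1 generalizing l
  · refine this (l := (l 0)⁻¹ • l) (by simp [hl]) ?_ (fun j => ?_) ?_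
    · simp [hl0.ne']
    · rw [mink_smul_right]
      exact mul_neg_of_pos_of_neg (inv_pos.2 hl0) (h j)
    · simp [hl0.ne']
  set y : Fin 5 → ℝ := fun i => l i.succ
  have hy : len y = 1 := by
    simp only [mink, h1, ← sq] at hl
    rw [len, show ∑ i, y i ^ 2 = 1 by linarith, Real.sqrt_one]
  have hs : ∀ j, slope (v j) 1 y < 0 := fun j => by
    refine lt_of_eq_of_lt ?_ (h j)
    simp only [mink, slope, h1, y]
    ring
  obtain ⟨η, hη, hη0⟩ : ∃ η : ℝ, (∀ j, slope (v j) 1 y < -η) ∧ 0 < η := by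
    have h2 : ∀ᶠ η : ℝ in nhdsWithin 0 (Ioi 0), ∀ j, slope (v j) 1 y < -η := by
      refine Filter.eventually_all.2 fun j => nhdsWithin_le_nhds ?_
      exact ContinuousAt.eventually_lt continuousAt_const (by fun_prop) (by simpa using hs j)
    exact (h2.and self_mem_nhdsWithin).exists
  have hpos : 0 < volume (sector v η 1) := by
    refine (isOpen_sector 1).measure_pos volume ⟨(2⁻¹ : ℝ) • y, ?_, fun j => ?_⟩
    · rw [len_smul (by norm_num), hy]
      norm_num
    · rw [len_smul (by norm_num), slope_smul, hy]
      linarith [hη j]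
  by_contra htop
  set m := (volume (sector v η 1)).toReal
  have hm : 0 < m := ENNReal.toReal_pos hpos.ne' volume_sector_lt_top.ne
  have hmv {s : ℝ} (hs : 0 < s) : volume (sector v η s) = ENNReal.ofReal (s ^ 5 * m) := by
    rw [ENNReal.ofReal_mul (by positivity), ENNReal.ofReal_toReal volume_sector_lt_top.ne,
      volume_sector hs]
  have key : ∀ᶠ ε : ℝ in nhdsWithin 0 (Ioi 0), m ≤ 1024 * (hVol 5 X).toReal * ε ^ 2 := by
    have h2 : ∀ᶠ ε : ℝ in nhdsWithin 0 (Ioi 0), ∀ j, |v j 0| * (2 * ε) < η * (1 - 2 * ε) := by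
      refine Filter.eventually_all.2 fun j => nhdsWithin_le_nhds ?_
      exact ContinuousAt.eventually_lt (by fun_prop) (by fun_prop) (by simpa using hη0)
    filter_upwards [h2, self_mem_nhdsWithin, Ioo_mem_nhdsGT (show (0 : ℝ) < 1 / 4 by norm_num)]
      with ε he hε hε4
    have hε0 : (0 : ℝ) < ε := hε
    have hle := shell_le_hVol hX hε0 hε4.2 he hη0
    have hsub : volume (sector v η (1 - ε)) - volume (sector v η (1 - 2 * ε)) ≤
        volume (sector v η (1 - ε) \ sector v η (1 - 2 * ε)) := le_measure_sdiff
    rw [hmv (by linarith [hε4.2]), hmv (by linarith [hε4.2]), ← ENNReal.ofReal_sub _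
      (mul_nonneg (pow_nonneg (by linarith [hε4.2]) 5) hm.le)] at hsub
    have h3 := (mul_le_mul_right hsub (ENNReal.ofReal (((4 * ε) ^ 3)⁻¹))).trans hle
    rw [← ENNReal.ofReal_mul (by positivity)] at h3
    have h4 := ENNReal.ofReal_le_iff_le_toReal htop |>.1 h3
    rw [inv_mul_le_iff₀ (by positivity)] at h4
    have h5 : m * (ε / 16) ≤ (1 - ε) ^ 5 * m - (1 - 2 * ε) ^ 5 * m := by
      rw [← sub_mul, mul_comm]
      refine mul_le_mul_of_nonneg_right ?_ hm.le
      have e : (1 - ε) ^ 5 - (1 - 2 * ε) ^ 5 = ε * ((1 - ε) ^ 4 + (1 - ε) ^ 3 * (1 - 2 * ε) +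
        (1 - ε) ^ 2 * (1 - 2 * ε) ^ 2 + (1 - ε) * (1 - 2 * ε) ^ 3 + (1 - 2 * ε) ^ 4) := by ring
      have h1 : (1 / 2) ^ 4 ≤ (1 - ε) ^ 4 :=
        pow_le_pow_left₀ (by norm_num) (by linarith [hε4.2]) 4
      have h2 : 0 < 1 - ε := by linarith [hε4.2]
      have h3 : 0 < 1 - 2 * ε := by linarith [hε4.2]
      rw [e, div_eq_mul_inv]
      refine mul_le_mul_of_nonneg_left ?_ hε0.le
      have : 0 ≤ (1 - ε) ^ 3 * (1 - 2 * ε) + (1 - ε) ^ 2 * (1 - 2 * ε) ^ 2 +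
        (1 - ε) * (1 - 2 * ε) ^ 3 + (1 - 2 * ε) ^ 4 := by positivity
      linarith
    have h6 := h5.trans h4
    refine le_of_mul_le_mul_left ?_ hε0
    linarith
  have h7 : ∀ᶠ ε : ℝ in nhdsWithin 0 (Ioi 0), 1024 * (hVol 5 X).toReal * ε ^ 2 < m := by
    refine nhdsWithin_le_nhds ?_
    exact ContinuousAt.eventually_lt (by fun_prop) continuousAt_const (by simpa using hm)
  obtain ⟨ε, h8, h9⟩ := (key.and h7).exists
  linarith

lemma zero_lt_of_mink_neg {n : ℕ} {x y : V n} (hx : mink n x x < 0) (hx0 : 0 < x 0)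
    (hy : mink n y y ≤ 0) (h : mink n x y < 0) : 0 < y 0 := by
  have hne : y ≠ 0 := by rintro rfl; simp at h
  refine lt_of_le_of_ne (not_lt.1 fun hlt => ?_) (apply_zero_ne hy hne).symm
  have := mink_neg_of_future hx hx0 (y := -y) (by simpa using hy) (by simpa using hlt)
  rw [mink_neg_right] at this
  linarith

lemma mink_single_succ {n : ℕ} (i : Fin n) :
    mink n (EuclideanSpace.single i.succ 1) (EuclideanSpace.single i.succ 1) = 1 := by
  simp [mink, PiLp.single_apply, eq_comm]

/-- The cone of a polyhedron of finite volume contains no spacelike vector. -/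
lemma mink_self_nonpos {X : Set (hypSet 5)} (hX : X = ⋂ i, hHalf 5 (v i))
    (hv : ∀ i, mink 5 (v i) (v i) = 1) (hi : (interior X).Nonempty) (hvol : hVol 5 X < ⊤) {z : V 5}
    (hz : ∀ j, mink 5 (v j) z ≤ 0) : mink 5 z z ≤ 0 := by
  by_contra! hpos
  obtain ⟨x, hx⟩ := hi
  have hneg : ∀ j, mink 5 (v j) x.val < 0 := fun j =>
    mink_neg_of_mem_interior (hv j) (hX.trans_subset (iInter_subset _ j)) hx
  obtain ⟨δ, hδ, hδ0⟩ : ∃ δ : ℝ, 0 < mink 5 (z + δ • x.val) (z + δ • x.val) ∧ 0 < δ := by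
    have h2 : ∀ᶠ δ : ℝ in nhdsWithin 0 (Ioi 0), 0 < mink 5 (z + δ • x.val) (z + δ • x.val) := by
      refine nhdsWithin_le_nhds (ContinuousAt.eventually_lt continuousAt_const ?_ (by simpa))
      simp only [mink_add_left, mink_add_right, mink_smul_left, mink_smul_right]
      fun_prop
    exact (h2.and self_mem_nhdsWithin).exists
  set s := z + δ • x.val with hs
  set a := mink 5 s x.val with ha
  set b := mink 5 s s
  have hsq := Real.mul_self_sqrt (show 0 ≤ a * a + b by nlinarith)
  have hr : |a| < √(a * a + b) := by
    rw [← Real.sqrt_mul_self_eq_abs]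
    exact Real.sqrt_lt_sqrt (mul_self_nonneg a) (by linarith)
  set r := √(a * a + b)
  have hr0 : 0 < r := (abs_nonneg a).trans_lt hr
  have har : 0 < a + r := by linarith [neg_abs_le a]
  have hl : mink 5 (s + (a + r) • x.val) (s + (a + r) • x.val) = 0 := by
    simp only [mink_add_left, mink_add_right, mink_smul_left, mink_smul_right, x.2.1,
      mink_comm x.val s, ← ha]
    linear_combination -hsq
  refine hvol.ne (hVol_eq_top hX hl ?_ fun j => ?_)
  · refine zero_lt_of_mink_neg (x := x.val) (by simp [x.2.1]) x.2.2 hl.le ?_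
    rw [mink_add_right, mink_smul_right, x.2.1, mink_comm x.val s]
    linarith
  · rw [hs, mink_add_right, mink_add_right, mink_smul_right, mink_smul_right]
    have h1 := mul_neg_of_pos_of_neg hδ0 (hneg j)
    have h2 := mul_neg_of_pos_of_neg har (hneg j)
    linarith [hz j]

lemma zero_le_of_mem_cone {X : Set (hypSet 5)} (hX : X = ⋂ i, hHalf 5 (v i))
    (hv : ∀ i, mink 5 (v i) (v i) = 1) (hi : (interior X).Nonempty) (hvol : hVol 5 X < ⊤) {z : V 5}
    (hz : ∀ j, mink 5 (v j) z ≤ 0) : 0 ≤ z 0 := by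
  by_contra! hlt
  have hzz := mink_self_nonpos hX hv hi hvol hz
  obtain ⟨x, hx⟩ := hi
  have hx1 : mink 5 x.val x.val < 0 := by simp [x.2.1]
  have ha := mink_neg_of_future hx1 x.2.2 (y := -z) (by simpa using hzz) (by simpa using hlt)
  rw [mink_neg_right] at ha
  set u := z + mink 5 x.val z • x.val
  have hu : ∀ j, mink 5 (v j) u < 0 := fun j => by
    have h1 := mink_neg_of_mem_interior (hv j) (hX.trans_subset (iInter_subset _ j)) hx
    have h2 := mul_neg_of_pos_of_neg (neg_lt_zero.1 ha) h1
    rw [mink_add_right, mink_smul_right]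
    linarith [hz j]
  have hux : mink 5 u x.val = 0 := by
    simp only [u, mink_add_left, mink_smul_left, x.2.1, mink_comm z]
    ring
  refine (mink_self_nonpos hX hv ⟨x, hx⟩ hvol fun j => (hu j).le).not_gt (mink_self_pos hx1 hux ?_)
  intro h0
  rcases isEmpty_or_nonempty (Fin k) with hk | ⟨⟨j⟩⟩
  · have := mink_self_nonpos hX hv ⟨x, hx⟩ hvol
      (z := EuclideanSpace.single (Fin.succ 0) 1) fun j => hk.elim j
    rw [mink_single_succ] at this
    linarith
  · have := hu j
    simp [h0] at this

end Volume

section Facets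
variable {n : ℕ}

lemma mink_neg_of_causal {a b : V n} (ha : mink n a a ≤ 0) (ha0 : 0 < a 0) (hb : mink n b b ≤ 0)
    (hb0 : 0 < b 0) (hne : b 0 • a ≠ a 0 • b) : mink n a b < 0 := by
  by_contra! h
  refine apply_zero_ne (y := b 0 • a - a 0 • b) ?_ (sub_ne_zero.2 hne) (by simp [mul_comm])
  simp only [mink_sub_left, mink_sub_right, mink_smul_left, mink_smul_right, mink_comm b a]
  have h1 := mul_nonneg (mul_pos ha0 hb0).le h
  have h2 := mul_nonpos_of_nonneg_of_nonpos (mul_pos hb0 hb0).le ha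
  have h3 := mul_nonpos_of_nonneg_of_nonpos (mul_pos ha0 ha0).le hb
  linarith

lemma timelike_add {a b : V n} (ha : mink n a a < 0 ∧ 0 < a 0) (hb : mink n b b < 0 ∧ 0 < b 0) :
    mink n (a + b) (a + b) < 0 ∧ 0 < (a + b) 0 := by
  have h := mink_neg_of_future ha.1 ha.2 hb.1.le hb.2
  refine ⟨?_, add_pos ha.2 hb.2⟩
  simp only [mink_add_left, mink_add_right, mink_comm b a]
  linarith [ha.1, hb.1]

lemma timelike_val (x : hypSet n) : mink n x.val x.val < 0 ∧ 0 < x.val 0 :=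
  ⟨by simp [x.2.1], x.2.2⟩

lemma timelike_smul {c : ℝ} (hc : 0 < c) {a : V n} (ha : mink n a a < 0 ∧ 0 < a 0) :
    mink n (c • a) (c • a) < 0 ∧ 0 < (c • a) 0 := by
  refine ⟨?_, mul_pos hc ha.2⟩
  rw [mink_smul_left, mink_smul_right, ← mul_assoc]
  exact mul_neg_of_pos_of_neg (mul_pos hc hc) ha.1

lemma eq_or_eq_neg_of_orthogonal {u v : V n} (hu : mink n u u = 1) (hv : mink n v v = 1)
    (h : ∀ y, mink n v y = 0 → mink n u y = 0) : u = v ∨ u = -v := by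
  have key : u = mink n u v • v := by
    rw [← sub_eq_zero]
    refine eq_zero_of_mink _ fun w => ?_
    have := h (w - mink n v w • v) (by simp [hv])
    simp only [mink_sub_right, mink_smul_right] at this
    simp only [mink_sub_left, mink_smul_left]
    linarith
  have h1 : mink n u v * mink n u v = 1 := by
    rw [key, mink_smul_left, mink_smul_right, hv] at hu
    linarith
  rcases mul_self_eq_one_iff.1 h1 with h2 | h2 <;> rw [h2] at key
  · exact .inl (by simpa using key)
  · exact .inr (by simpa using key)

/-- An irredundant description of a polyhedron `X` by the unit outward normals `p`. -/
structure Irred {ι : Type*} (X : Set (hypSet n)) (p : ι → V n) : Prop where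
  unit : ∀ i, mink n (p i) (p i) = 1
  eq : X = ⋂ i, hHalf n (p i)
  wit : ∀ i, ∃ m : hypSet n, mink n (p i) m.val = 0 ∧ ∀ j, j ≠ i → mink n (p j) m.val < 0

variable {ι : Type*} {X : Set (hypSet n)} {p : ι → V n}

lemma Irred.mem (h : Irred X p) {x : hypSet n} : x ∈ X ↔ ∀ i, mink n (p i) x.val ≤ 0 := by
  rw [h.eq, mem_iInter]
  rfl

lemma Irred.wit_mem (h : Irred X p) (i : ι) : ∃ m ∈ X ∩ hWall n (p i),
    ∀ j, j ≠ i → mink n (p j) m.val < 0 := by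
  obtain ⟨m, h0, h1⟩ := h.wit i
  refine ⟨m, ⟨h.mem.2 fun j => ?_, h0⟩, h1⟩
  by_cases hj : j = i
  exacts [hj ▸ h0.le, (h1 j hj).le]

lemma Irred.eq_or_eq_neg [Finite ι] (h : Irred X p) {u : V n} (hu : mink n u u = 1) {i : ι}
    (hw : X ∩ hWall n (p i) ⊆ hWall n u) : u = p i ∨ u = -p i := by
  refine eq_or_eq_neg_of_orthogonal hu (h.unit i) fun y hy => ?_
  obtain ⟨m, hm, hneg⟩ := h.wit_mem i
  have hopen : IsOpen {x : hypSet n | ∀ j, j ≠ i → mink n (p j) x.val < 0} := by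
    simp only [ofPred_forall]
    exact isOpen_iInter_of_finite fun j => isOpen_iInter_of_finite fun _ => isOpen_mink_neg _
  obtain ⟨δ, hδ, ht⟩ := exists_perturb hopen hneg y
  obtain ⟨c, hc, x, hx, hxc⟩ := ht (δ / 2) (by rw [abs_of_pos] <;> linarith)
  have h0 : mink n (p i) x.val = 0 := by
    rw [hxc, mink_smul_right, mink_add_right, mink_smul_right, hy, mem_hWall.1 hm.2]
    ring
  have hxm : x ∈ X ∩ hWall n (p i) := by
    refine ⟨h.mem.2 fun j => ?_, h0⟩
    by_cases hj : j = i
    exacts [hj ▸ h0.le, (hx j hj).le]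
  have h1 := hw hxm
  have h2 := hw hm
  rw [mem_hWall] at h1 h2
  rw [hxc, mink_smul_right, mink_add_right, mink_smul_right, h2, zero_add, ← mul_assoc] at h1
  exact (mul_eq_zero.1 h1).resolve_left (by positivity)

lemma hWall_neg (v : V n) : hWall n (-v) = hWall n v := by
  ext x
  simp [mem_hWall]

lemma Irred.isFacet [Finite ι] (h : Irred X p) (i : ι) : hIsFacet n X (X ∩ hWall n (p i)) := by
  obtain ⟨m, hm, -⟩ := h.wit_mem i
  refine ⟨⟨m, hm⟩, p i, h.unit i, h.eq.trans_subset (iInter_subset _ i), rfl, fun u hu hw => ?_⟩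
  rcases h.eq_or_eq_neg hu hw with rfl | rfl
  exacts [rfl, hWall_neg _]

lemma Irred.subset_interior [Finite ι] (h : Irred X p) {x : hypSet n}
    (hx : ∀ i, mink n (p i) x.val < 0) : x ∈ interior X := by
  have hopen : IsOpen {x : hypSet n | ∀ i, mink n (p i) x.val < 0} := by
    simp only [ofPred_forall]
    exact isOpen_iInter_of_finite fun j => isOpen_mink_neg _
  exact mem_interior.2 ⟨_, fun y hy => h.mem.2 fun i => (hy i).le, hopen, hx⟩

lemma Irred.facet_eq [Finite ι] (h : Irred X p) {S : Set (hypSet n)} (hS : hIsFacet n X S) :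
    ∃ i, S = X ∩ hWall n (p i) := by
  obtain ⟨⟨x, hx⟩, u, hu, hXu, hSu, huniq⟩ := hS
  suffices ∃ i, S ⊆ hWall n (p i) by
    obtain ⟨i, hi⟩ := this
    exact ⟨i, by rw [huniq _ (h.unit i) hi, hSu]⟩
  by_contra! hne
  have hex : ∀ i, ∃ s ∈ S, mink n (p i) s.val < 0 := fun i => by
    obtain ⟨s, hs, hsi⟩ := not_subset.1 (hne i)
    exact ⟨s, hs, lt_of_le_of_ne (h.mem.1 (hSu ▸ hs : s ∈ X ∩ _).1 i) hsi⟩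
  choose s hs hneg using hex
  have := Fintype.ofFinite ι
  have key : ∀ J : Finset ι, mink n (x.val + ∑ i ∈ J, (s i).val) (x.val + ∑ i ∈ J, (s i).val) < 0 ∧
      0 < (x.val + ∑ i ∈ J, (s i).val) 0 := by
    classical
    intro J
    induction J using Finset.induction_on with
    | empty => simpa using timelike_val x
    | insert i J hi ih =>
      rw [Finset.sum_insert hi, add_left_comm]
      exact timelike_add (timelike_val _) ih
  obtain ⟨c, hc, z, hz⟩ := exists_normalized (key Finset.univ).1 (key Finset.univ).2
  have hle : ∀ y ∈ S, ∀ i, mink n (p i) y.val ≤ 0 := fun y hy =>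
    h.mem.1 (hSu ▸ hy : y ∈ X ∩ _).1
  have hzi : z ∈ interior X := h.subset_interior fun i => by
    rw [hz, mink_smul_right, mink_add_right, mink_sum_right]
    have h1 : ∑ j, mink n (p i) (s j).val < 0 :=
      Finset.sum_neg' (fun j _ => hle _ (hs j) i) ⟨i, Finset.mem_univ i, hneg i⟩
    exact mul_neg_of_pos_of_neg hc (by linarith [hle x hx i])
  have h0 : ∀ y ∈ S, mink n u y.val = 0 := fun y hy => (hSu ▸ hy : y ∈ X ∩ _).2
  refine (mink_neg_of_mem_interior hu hXu hzi).ne ?_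
  rw [hz, mink_smul_right, mink_add_right, mink_sum_right, h0 x hx,
    Finset.sum_eq_zero fun j _ => h0 _ (hs j)]
  simp

lemma Irred.facet_injective (h : Irred X p) : Function.Injective fun i => X ∩ hWall n (p i) := by
  intro i j hij
  obtain ⟨m, hm, hneg⟩ := h.wit_mem i
  by_contra hne
  have : m ∈ X ∩ hWall n (p j) := (Set.ext_iff.1 hij m).1 hm
  exact (hneg j (Ne.symm hne)).ne this.2

lemma Irred.ncard_facets [Finite ι] (h : Irred X p) : {S | hIsFacet n X S}.ncard = Nat.card ι := by
  have : {S | hIsFacet n X S} = range fun i => X ∩ hWall n (p i) := by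
    ext S
    exact ⟨fun hS => (h.facet_eq hS).imp fun _ => Eq.symm, fun ⟨i, hi⟩ => hi ▸ h.isFacet i⟩
  rw [this, ← image_univ, ncard_image_of_injective _ h.facet_injective, ncard_univ]

lemma Irred.comp_equiv {κ : Type*} (h : Irred X p) (e : κ ≃ ι) : Irred X (p ∘ e) where
  unit i := h.unit _
  eq := by rw [h.eq, ← e.surjective.iInter_comp]; rfl
  wit i := by
    obtain ⟨m, h0, h1⟩ := h.wit (e i)
    exact ⟨m, h0, fun j hj => h1 _ (e.injective.ne hj)⟩

lemma exists_irred {k : ℕ} {v : Fin k → V n} (hv : ∀ i, mink n (v i) (v i) = 1)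
    (hX : X = ⋂ i, hHalf n (v i)) (hi : (interior X).Nonempty) :
    ∃ J : Finset (Fin k), Irred X fun i : J => v i := by
  obtain ⟨J, hJ, hmin⟩ := exists_minimal_of_wellFoundedLT
    (fun J : Finset (Fin k) => X = ⋂ i ∈ J, hHalf n (v i)) ⟨Finset.univ, by simpa using hX⟩
  obtain ⟨x, hx⟩ := hi
  have hneg : ∀ i, mink n (v i) x.val < 0 := fun i =>
    mink_neg_of_mem_interior (hv i) (hX.trans_subset (iInter_subset _ i)) hx
  refine ⟨J, fun i => hv i, by rw [hJ, iInter_subtype], fun ⟨i, hiJ⟩ => ?_⟩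
  have hne : ¬⋂ j ∈ J.erase i, hHalf n (v j) ⊆ X := fun hsub => by
    have := hmin (y := J.erase i) (Subset.antisymm ?_ hsub) (Finset.erase_subset i J)
    · exact Finset.notMem_erase i J (this hiJ)
    · refine hJ.trans_subset (iInter₂_mono' fun j hj => ⟨j, Finset.mem_of_mem_erase hj, subset_rfl⟩)
  obtain ⟨z, hz, hzX⟩ := not_subset.1 hne
  have hzj : ∀ j ∈ J, j ≠ i → mink n (v j) z.val ≤ 0 := fun j hj hji =>
    mem_iInter₂.1 hz j (Finset.mem_erase.2 ⟨hji, hj⟩)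
  have hzi : 0 < mink n (v i) z.val := by
    by_contra! h0
    refine hzX (hJ ▸ mem_iInter₂.2 fun j hj => ?_)
    by_cases hji : j = i
    exacts [hji ▸ h0, hzj j hj hji]
  obtain ⟨ht, ht0⟩ := timelike_add (timelike_smul hzi (timelike_val x))
    (timelike_smul (neg_pos.2 (hneg i)) (timelike_val z))
  obtain ⟨c, hc, m, hm⟩ := exists_normalized ht ht0
  refine ⟨m, ?_, fun ⟨j, hjJ⟩ hj => ?_⟩
  · rw [hm, mink_smul_right, mink_add_right, mink_smul_right, mink_smul_right]
    ring
  · rw [hm, mink_smul_right, mink_add_right, mink_smul_right, mink_smul_right]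
    have h1 := mul_neg_of_pos_of_neg hzi (hneg j)
    have h2 := mul_nonpos_of_nonneg_of_nonpos (neg_pos.2 (hneg i)).le
      (hzj j hjJ fun h => hj (Subtype.ext h))
    exact mul_neg_of_pos_of_neg hc (by linarith)

end Facets

section Chamber

/-- A finite-volume simplex with unit outward normals `p` and dual vectors `w`, the vectors
spanning the rays through its (possibly ideal) vertices. -/
structure Chamber (X : Set (hypSet 5)) (p w : Fin 6 → V 5) : Prop extends Irred X p where
  dual : ∀ i k, mink 5 (p i) (w k) = if i = k then -1 else 0
  causal : ∀ z, (∀ i, mink 5 (p i) z ≤ 0) → mink 5 z z ≤ 0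
  future : ∀ z, (∀ i, mink 5 (p i) z ≤ 0) → 0 ≤ z 0
  expand : ∀ z, z = ∑ k, -mink 5 (p k) z • w k

variable {X : Set (hypSet 5)} {p w : Fin 6 → V 5}

lemma exists_chamber (h : Irred X p) (hi : (interior X).Nonempty) (hvol : hVol 5 X < ⊤) :
    ∃ w, Chamber X p w := by
  have hc : ∀ z, (∀ i, mink 5 (p i) z ≤ 0) → mink 5 z z ≤ 0 := fun z =>
    mink_self_nonpos h.eq h.unit hi hvol
  have hf : ∀ z, (∀ i, mink 5 (p i) z ≤ 0) → 0 ≤ z 0 := fun z =>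
    zero_le_of_mem_cone h.eq h.unit hi hvol
  let φ : V 5 →ₗ[ℝ] Fin 6 → ℝ := LinearMap.pi fun i => minkB 5 (p i)
  have hφ : ∀ z i, φ z i = mink 5 (p i) z := fun z i => rfl
  have hinj : Function.Injective φ := by
    rw [injective_iff_map_eq_zero]
    intro z hz
    have h0 : ∀ i, mink 5 (p i) z = 0 := fun i => by rw [← hφ, hz]; rfl
    by_contra hne
    refine apply_zero_ne (hc z fun i => (h0 i).le) hne (le_antisymm ?_ (hf z fun i => (h0 i).le))
    simpa using hf (-z) fun i => by simp [h0 i]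
  have hsurj : Function.Surjective φ :=
    (LinearMap.injective_iff_surjective_of_finrank_eq_finrank (by simp)).1 hinj
  choose w hw using fun k : Fin 6 => hsurj (Pi.single k (-1))
  have hd : ∀ i k, mink 5 (p i) (w k) = if i = k then -1 else 0 := fun i k => by
    rw [← hφ, hw, Pi.single_apply]
  refine ⟨w, h, hd, hc, hf, fun z => hinj ?_⟩
  ext i
  rw [hφ, hφ, mink_sum_right]
  simp [hd]

lemma Chamber.expand' (h : Chamber X p w) (z : V 5) : z = ∑ k, -mink 5 (w k) z • p k := by
  rw [← sub_eq_zero]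
  refine eq_zero_of_mink _ fun y => ?_
  have hy : ∀ x, mink 5 x y = ∑ k, -mink 5 (p k) y * mink 5 x (w k) := fun x => by
    conv_lhs => rw [h.expand y, mink_sum_right]
    simp
  rw [hy]
  refine Finset.sum_eq_zero fun l _ => ?_
  rw [mink_sub_left, mink_sum_left]
  simp [h.dual, mink_comm z]

lemma Chamber.eq_of_mink (h : Chamber X p w) {x y : V 5}
    (hxy : ∀ i, mink 5 (p i) x = mink 5 (p i) y) : x = y := by
  rw [h.expand x, h.expand y]
  simp [hxy]

lemma Chamber.dual_nonpos (h : Chamber X p w) (i k : Fin 6) : mink 5 (p i) (w k) ≤ 0 := by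
  rw [h.dual]
  split_ifs <;> norm_num

lemma Chamber.w_causal (h : Chamber X p w) (k : Fin 6) : mink 5 (w k) (w k) ≤ 0 :=
  h.causal _ fun i => h.dual_nonpos i k

lemma Chamber.w_ne (h : Chamber X p w) (k : Fin 6) : w k ≠ 0 := fun h0 => by
  simpa [h0] using h.dual k k

lemma Chamber.w_future (h : Chamber X p w) (k : Fin 6) : 0 < w k 0 :=
  lt_of_le_of_ne (h.future _ fun i => h.dual_nonpos i k)
    (apply_zero_ne (h.w_causal k) (h.w_ne k)).symm

lemma Chamber.w_sep (h : Chamber X p w) {k l : Fin 6} (hkl : k ≠ l) : mink 5 (w k) (w l) < 0 := by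
  refine mink_neg_of_causal (h.w_causal k) (h.w_future k) (h.w_causal l) (h.w_future l) fun he => ?_
  have := congr_arg (mink 5 (p k)) he
  rw [mink_smul_right, mink_smul_right, h.dual, h.dual, if_pos rfl, if_neg hkl] at this
  linarith [h.w_future l]

lemma Chamber.w_add (h : Chamber X p w) {k l : Fin 6} (hkl : k ≠ l) :
    mink 5 (w k + w l) (w k + w l) < 0 ∧ 0 < (w k + w l) 0 := by
  refine ⟨?_, add_pos (h.w_future k) (h.w_future l)⟩
  simp only [mink_add_left, mink_add_right, mink_comm (w l)]
  linarith [h.w_causal k, h.w_causal l, h.w_sep hkl, h.w_sep hkl.symm]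

/-- Any two walls of a simplex meet inside it. -/
lemma Chamber.walls_meet (h : Chamber X p w) (i j : Fin 6) :
    ∃ x ∈ X, x ∈ hWall 5 (p i) ∩ hWall 5 (p j) := by
  obtain ⟨k, l, hkl, hk, hl, hk', hl'⟩ : ∃ k l : Fin 6, k ≠ l ∧ i ≠ k ∧ i ≠ l ∧ j ≠ k ∧ j ≠ l := by
    revert i j
    decide
  obtain ⟨c, hc, x, hx⟩ := exists_normalized (h.w_add hkl).1 (h.w_add hkl).2
  refine ⟨x, h.mem.2 fun a => ?_, ?_, ?_⟩
  · rw [hx, mink_smul_right, mink_add_right]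
    exact mul_nonpos_of_nonneg_of_nonpos hc.le (add_nonpos (h.dual_nonpos a k) (h.dual_nonpos a l))
  all_goals rw [mem_hWall, hx, mink_smul_right, mink_add_right, h.dual, h.dual]; simp [*]

lemma cos_pi_div_nonneg {m : ℕ} (hm : 2 ≤ m) : 0 ≤ Real.cos (Real.pi / m) := by
  have h2 : (2 : ℝ) ≤ m := by exact_mod_cast hm
  have := Real.pi_pos
  refine Real.cos_nonneg_of_neg_pi_div_two_le_of_le ?_ ?_
  · have : 0 ≤ Real.pi / m := by positivity
    linarith
  · exact div_le_div_of_nonneg_left this.le two_pos h2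

/-- The normals of a Coxeter simplex. -/
lemma exists_coxeter_chamber (hX : hCoxSimplex 5 X) : ∃ p w, Chamber X p w ∧
    ∀ i j, i ≠ j → ∃ m : ℕ, 2 ≤ m ∧ mink 5 (p i) (p j) = -Real.cos (Real.pi / m) := by
  obtain ⟨⟨k, v, hv, hXv, hi, hvol, hcox⟩, -, hcard⟩ := hX
  obtain ⟨J, hJ⟩ := exists_irred hv hXv hi
  rw [hJ.ncard_facets, Nat.card_eq_fintype_card] at hcard
  let e : Fin 6 ≃ J := (Fintype.equivFinOfCardEq hcard).symm
  have hp := hJ.comp_equiv e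
  obtain ⟨w, hw⟩ := exists_chamber hp hi hvol
  refine ⟨_, w, hw, fun i j hij => hcox _ _ (fun heq => hij ?_) (hw.walls_meet i j)⟩
  exact hp.facet_injective (congr_arg (X ∩ ·) heq)

end Chamber

section Diagram

variable {X : Set (hypSet 5)} {p w : Fin 6 → V 5}

/-- The integers `m i j` are the labels of the Coxeter diagram of the vectors `p i`. -/
def HasLabels (p : Fin 6 → V 5) (m : Fin 6 → Fin 6 → ℕ) : Prop :=
  ∀ i j, i ≠ j → 2 ≤ m i j ∧ mink 5 (p i) (p j) = -Real.cos (Real.pi / m i j)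

lemma cos_pi_div_inj {a b : ℕ} (ha : 2 ≤ a) (hb : 2 ≤ b)
    (h : -Real.cos (Real.pi / a) = -Real.cos (Real.pi / b)) : a = b := by
  have hmem : ∀ {m : ℕ}, 2 ≤ m → Real.pi / m ∈ Icc 0 Real.pi := fun {m} hm =>
    ⟨by positivity, div_le_self Real.pi_pos.le (by exact_mod_cast (by lia : 1 ≤ m))⟩
  have := Real.injOn_cos (hmem ha) (hmem hb) (neg_injective h)
  have ha' : (a : ℝ) ≠ 0 := by positivity
  have hb' : (b : ℝ) ≠ 0 := by positivity
  rw [div_eq_div_iff ha' hb'] at this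
  exact_mod_cast (mul_left_cancel₀ Real.pi_ne_zero this).symm

lemma cos_label_three : -Real.cos (Real.pi / (3 : ℕ)) = -1 / 2 := by
  rw [Nat.cast_ofNat, Real.cos_pi_div_three]
  norm_num

lemma cos_label_four : -Real.cos (Real.pi / (4 : ℕ)) = -rt := by
  rw [Nat.cast_ofNat, Real.cos_pi_div_four, rt]

lemma cos_label_le {a b : ℕ} (ha : 2 ≤ a) (hab : a ≤ b) :
    -Real.cos (Real.pi / b) ≤ -Real.cos (Real.pi / a) := by
  have ha' : (0 : ℝ) < a := by positivity
  refine neg_le_neg (Real.cos_le_cos_of_nonneg_of_le_pi (by positivity)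
    (div_le_self Real.pi_pos.le (by exact_mod_cast (by lia : 1 ≤ a))) ?_)
  exact div_le_div_of_nonneg_left Real.pi_pos.le ha' (by exact_mod_cast hab)

lemma HasLabels.symm {m : Fin 6 → Fin 6 → ℕ} (hm : HasLabels p m) {i j : Fin 6} (h : i ≠ j) :
    m i j = m j i := by
  refine cos_pi_div_inj (hm i j h).1 (hm j i h.symm).1 ?_
  rw [← (hm i j h).2, ← (hm j i h.symm).2, mink_comm]

/-- Subdiagram occurrences in a simplex are embeddings of labelled diagrams. -/
lemma Irred.subOcc_iff {k : ℕ} {M : Matrix (Fin k) (Fin k) ℕ} {𝒜 : Set (Set (hypSet 5))}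
    {m : Fin 6 → Fin 6 → ℕ} (h : Irred X p) (hm : HasLabels p m) (hM : ∀ i j, i ≠ j → 2 ≤ M i j) :
    hSubOcc 5 X M 𝒜 ↔ ∃ c : Fin k → Fin 6, Function.Injective c ∧
      (∀ i j, i ≠ j → m (c i) (c j) = M i j) ∧ 𝒜 = range fun i => X ∩ hWall 5 (p (c i)) := by
  constructor
  · rintro ⟨e, hu, he, hf, h𝒜, hcard⟩
    choose c hc using fun i => h.facet_eq (hf i)
    have hsub : ∀ i, X ∩ hWall 5 (p (c i)) ⊆ hWall 5 (e i) := fun i => by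
      rw [← hc i]
      exact inter_subset_right
    have hinj : Function.Injective c := by
      have hr : 𝒜 = (fun i => X ∩ hWall 5 (p i)) '' range c := by
        rw [← range_comp, h𝒜]
        exact congr_arg range (funext hc)
      rw [hr, ncard_image_of_injective _ h.facet_injective] at hcard
      rw [← injOn_univ]
      exact injOn_of_ncard_image_eq (by rw [image_univ, hcard, ncard_univ, Nat.card_fin])
    refine ⟨c, hinj, fun i j hij => ?_, by rw [h𝒜]; exact congr_arg range (funext hc)⟩
    have hcij := hinj.ne hij
    obtain ⟨h2, hmij⟩ := hm _ _ hcij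
    have heij := he i j hij
    refine cos_pi_div_inj h2 (hM i j hij) ?_
    rw [← heij, ← hmij]
    have hle : mink 5 (p (c i)) (p (c j)) ≤ 0 := by
      rw [hmij]
      exact neg_nonpos.2 (cos_pi_div_nonneg h2)
    have hle' : mink 5 (e i) (e j) ≤ 0 := by
      rw [heij]
      exact neg_nonpos.2 (cos_pi_div_nonneg (hM i j hij))
    rcases h.eq_or_eq_neg (hu i) (hsub i) with hi | hi <;>
      rcases h.eq_or_eq_neg (hu j) (hsub j) with hj | hj <;>
      rw [hi, hj] at hle' ⊢ <;> simp only [mink_neg_left, mink_neg_right] at hle' ⊢ <;> linarith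
  · rintro ⟨c, hinj, hc, rfl⟩
    refine ⟨p ∘ c, fun i => h.unit _, fun i j hij => ?_, fun i => h.isFacet _, rfl, ?_⟩
    · rw [← hc i j hij]
      exact (hm _ _ (hinj.ne hij)).2
    · exact (ncard_range_of_injective (h.facet_injective.comp hinj)).trans (Nat.card_fin k)

lemma Chamber.comp_equiv (h : Chamber X p w) (e : Fin 6 ≃ Fin 6) : Chamber X (p ∘ e) (w ∘ e) where
  toIrred := h.toIrred.comp_equiv e
  dual i k := by simp [h.dual]
  causal z hz := h.causal z fun i => by simpa using hz (e.symm i)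
  future z hz := h.future z fun i => by simpa using hz (e.symm i)
  expand z := (h.expand z).trans (e.sum_comp fun k => -mink 5 (p k) z • w k).symm

lemma Chamber.self_nonneg (h : Chamber X p w) (k : Fin 6) {v : V 5} (hv : mink 5 (w k) v = 0) :
    0 ≤ mink 5 v v := by
  by_contra! hlt
  exact (mink_self_pos hlt hv (h.w_ne k)).not_ge (h.w_causal k)

end Diagram

section Diagram

variable {X : Set (hypSet 5)} {p w : Fin 6 → V 5} {m : Fin 6 → Fin 6 → ℕ}

/-- A diagram on six nodes: `C̃₄` on the first five, and the labels `r` at the last node. -/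
def extLabel (r : Fin 6 → ℕ) (a b : Fin 6) : ℕ :=
  if a = 5 then r b else if b = 5 then r a
  else cmOfEdges 6 [(0,1,4),(1,2,3),(2,3,3),(3,4,4)] a b

lemma two_le_c4t (i j : Fin 5) (h : i ≠ j) : 2 ≤ cmC4t i j := by
  fin_cases i <;> fin_cases j <;> first | exact absurd rfl h | exact Nat.le_of_ble_eq_true rfl

lemma two_le_f4t (i j : Fin 5) (h : i ≠ j) : 2 ≤ cmF4t i j := by
  fin_cases i <;> fin_cases j <;> first | exact absurd rfl h | exact Nat.le_of_ble_eq_true rfl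

/-- Whether a diagram extending `C̃₄` may have label `x` between `a` and `b`. -/
def compatLabel (a b : Fin 6) (x : ℕ) : Bool :=
  a != b && (a == 5 || b == 5 || extLabel 0 a b == x)

/-- The linear diagram `4, 3, 3, 4, 3`. -/
def pathLabel (i j : Fin 6) : ℕ := cmOfEdges 6 [(0,1,4),(1,2,3),(2,3,3),(3,4,4),(4,5,3)] i j

/-- The cyclic diagram `3, 3, 4, 3, 3, 4`. -/
def hexLabel (i j : Fin 6) : ℕ :=
  cmOfEdges 6 [(0,1,3),(1,2,3),(2,3,4),(3,4,3),(4,5,3),(0,5,4)] i j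

set_option maxRecDepth 4000 in
set_option synthInstance.maxSize 1000 in
set_option synthInstance.maxHeartbeats 200000 in
/-- The possible positions of `F̃₄` in a diagram on six nodes extending `C̃₄`. -/
lemma f4t_in_extension : ∀ a b, compatLabel a b 3 → ∀ c, compatLabel b c 3 && compatLabel a c 2 →
    ∀ d, compatLabel c d 4 && compatLabel a d 2 && compatLabel b d 2 →
    ∀ e, compatLabel d e 3 && compatLabel a e 2 && compatLabel b e 2 && compatLabel c e 2 →
    [a, b, c, d, e] ∈ [[3, 2, 1, 0, 5], [0, 5, 4, 3, 2], [1, 2, 3, 4, 5], [4, 5, 0, 1, 2]] := by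
  decide +kernel

set_option maxRecDepth 4000 in
set_option synthInstance.maxSize 1000 in
set_option synthInstance.maxHeartbeats 200000 in
/-- The only `C̃₄` in the linear diagram avoids its last node. -/
lemma c4t_in_path : ∀ a b, pathLabel a b = 4 → ∀ c, pathLabel b c = 3 ∧ a ≠ c →
    ∀ d, pathLabel c d = 3 ∧ pathLabel b d = 2 → ∀ e, pathLabel d e = 4 →
    a ≠ 5 ∧ b ≠ 5 ∧ c ≠ 5 ∧ d ≠ 5 ∧ e ≠ 5 := by
  decide +kernel

/-- A facet set omitting one facet of a simplex has positive semidefinite Gram matrix. -/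
lemma Chamber.quad_nonneg (h : Chamber X p w) (hm : HasLabels p m) {k : ℕ} {u : Fin k → Fin 6}
    (hu : Function.Injective u) {M : Fin k → Fin k → ℕ}
    (hM : ∀ i j, i ≠ j → m (u i) (u j) = M i j) {l : Fin 6} (hl : ∀ i, u i ≠ l) (t : Fin k → ℝ) :
    0 ≤ ∑ i, t i * ∑ j, t j * if i = j then 1 else -Real.cos (Real.pi / M i j) := by
  convert h.self_nonneg l (v := ∑ i, t i • p (u i)) ?_ using 1
  · rw [mink_sum_left]
    refine Finset.sum_congr rfl fun i _ => ?_
    rw [mink_smul_left, mink_sum_right]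
    refine congr_arg _ (Finset.sum_congr rfl fun j _ => ?_)
    rw [mink_smul_right]
    split_ifs with hij
    · rw [hij, h.unit]
    · rw [(hm _ _ (hu.ne hij)).2, hM i j hij]
  · rw [mink_sum_right]
    refine Finset.sum_eq_zero fun i _ => ?_
    rw [mink_comm, mink_smul_left, h.dual, if_neg (hl i), mul_zero]

lemma Chamber.label_le_three_of_path (h : Chamber X p w) (hm : HasLabels p m) {u : Fin 5 → Fin 6}
    {x : ℕ} (hu : Function.Injective u) {l : Fin 6} (hl : ∀ i, u i ≠ l)
    (hM : ∀ i j, i ≠ j → m (u i) (u j) = cmOfEdges 5 [(0,1,3),(1,2,4),(2,3,x),(3,4,3)] i j) :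
    x ≤ 3 := by
  by_contra! hx
  have hq := cos_label_le (by norm_num) hx
  rw [Nat.succ_eq_add_one, cos_label_four] at hq
  have h0 := h.quad_nonneg hm hu hM hl ![2 * rt, 4 * rt, 3, 2, 1]
  simp [Fin.sum_univ_five, cmOfEdges, show √2 / 2 = rt from rfl] at h0
  nlinarith [rt_mul, rt_bounds]

lemma Chamber.label_le_two_of_triangle (h : Chamber X p w) (hm : HasLabels p m) {u : Fin 3 → Fin 6}
    {x : ℕ} (hu : Function.Injective u) {l : Fin 6} (hl : ∀ i, u i ≠ l)
    (hM : ∀ i j, i ≠ j → m (u i) (u j) = cmOfEdges 3 [(0,1,4),(1,2,x),(0,2,3)] i j) :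
    x ≤ 2 := by
  by_contra! hx
  have hq := cos_label_le (by norm_num) hx
  rw [Nat.succ_eq_add_one, cos_label_three] at hq
  have h0 := h.quad_nonneg hm hu hM hl ![1, 1, 1]
  simp [Fin.sum_univ_three, cmOfEdges, show √2 / 2 = rt from rfl] at h0
  nlinarith [rt_mul, rt_bounds]

lemma eq_extLabel (hm : HasLabels p m)
    (h4 : ∀ i j : Fin 5, i ≠ j → m i.castSucc j.castSucc = cmC4t i j) {r : Fin 6 → ℕ}
    (hr : ∀ i : Fin 5, m i.castSucc 5 = r i.castSucc) {a b : Fin 6} (hab : a ≠ b) :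
    m a b = extLabel r a b := by
  have h5 : ∀ i : Fin 5, i.castSucc ≠ (5 : Fin 6) := fun i => (Fin.castSucc_lt_last i).ne
  induction a using Fin.lastCases with
  | last =>
    induction b using Fin.lastCases with
    | last => exact absurd rfl hab
    | cast b => exact (hm.symm hab).trans (hr b)
  | cast a =>
    induction b using Fin.lastCases with
    | last =>
      rw [extLabel, if_neg (h5 a)]
      exact hr a
    | cast b =>
      rw [h4 a b fun he => hab (he ▸ rfl), extLabel, if_neg (h5 a),
        if_neg (h5 b)]
      fin_cases a <;> fin_cases b <;> rfl

/-- A simplex whose diagram contains `C̃₄` and `F̃₄` has a linear or cyclic diagram. -/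
lemma Chamber.path_or_hex_of_c4t (h : Chamber X p w) (hm : HasLabels p m)
    (h4 : ∀ i j : Fin 5, i ≠ j → m i.castSucc j.castSucc = cmC4t i j) {f : Fin 5 → Fin 6}
    (hf : Function.Injective f) (hfm : ∀ i j, i ≠ j → m (f i) (f j) = cmF4t i j) :
    ∃ e : Fin 6 → Fin 6, Function.Injective e ∧
      ((∀ i j, i ≠ j → m (e i) (e j) = pathLabel i j) ∨
        ∀ i j, i ≠ j → m (e i) (e j) = hexLabel i j) := by
  have hc : ∀ i j, i ≠ j → compatLabel (f i) (f j) (cmF4t i j) := fun i j hij => by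
    have hne := hf.ne hij
    have := eq_extLabel hm h4 (r := fun a => m a 5) (fun _ => rfl) hne
    rw [hfm i j hij] at this
    by_cases hi : f i = 5
    · simp [compatLabel, hi, hi ▸ hne]
    by_cases hj : f j = 5
    · simp [compatLabel, hi, hj]
    simp [compatLabel, hne, hi, hj, this, extLabel]
  have hl := f4t_in_extension (f 0) (f 1) (hc 0 1 (by decide)) (f 2)
    (Bool.and_eq_true_iff.2 ⟨hc 1 2 (by decide), hc 0 2 (by decide)⟩) (f 3)
    (by simp only [Bool.and_eq_true]
        exact ⟨⟨hc 2 3 (by decide), hc 0 3 (by decide)⟩, hc 1 3 (by decide)⟩) (f 4)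
    (by simp only [Bool.and_eq_true]
        exact ⟨⟨⟨hc 3 4 (by decide), hc 0 4 (by decide)⟩, hc 1 4 (by decide)⟩,
          hc 2 4 (by decide)⟩)
  simp only [List.mem_cons, List.not_mem_nil, or_false, List.cons.injEq, and_true] at hl
  have key : ∀ r : Fin 6 → ℕ, (∀ i : Fin 5, m i.castSucc 5 = r i.castSucc) →
      ∀ (k : ℕ) (u : Fin k → Fin 6) (M : Fin k → Fin k → ℕ), Function.Injective u →
      (∀ i j, i ≠ j → extLabel r (u i) (u j) = M i j) →
      ∀ i j, i ≠ j → m (u i) (u j) = M i j := fun r hr k u M hu hM i j hij => by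
    rw [eq_extLabel hm h4 hr (hu.ne hij), hM i j hij]
  have hrow : ∀ i j, i ≠ j → ∀ a, f i = a → f j = 5 → m a 5 = cmF4t i j := by
    rintro i j hij a rfl hj
    rw [← hj, hfm i j hij]
  have h2 : ∀ a, a ≠ 5 → 2 ≤ m a 5 := fun a ha => (hm a 5 ha).1
  rcases hl with ⟨h0, h1, h2', h3, h4'⟩ | ⟨h0, h1, h2', h3, h4'⟩ | ⟨h0, h1, h2', h3, h4'⟩ |
    ⟨h0, h1, h2', h3, h4'⟩
  · obtain ⟨x, hx⟩ : ∃ x, m 4 5 = x := ⟨_, rfl⟩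
    have hr : ∀ i : Fin 5, m i.castSucc 5 = ![3, 2, 2, 2, x, 0] i.castSucc := by
      intro i
      fin_cases i
      exacts [hrow 3 4 (by decide) _ h3 h4', hrow 2 4 (by decide) _ h2' h4',
        hrow 1 4 (by decide) _ h1 h4', hrow 0 4 (by decide) _ h0 h4', hx]
    have hx3 := h.label_le_three_of_path hm (u := ![2, 3, 4, 5, 0]) (x := x) (by decide) (l := 1)
      (by decide) (key _ hr _ _ _ (by decide) fun i j hij => by
        fin_cases i <;> fin_cases j <;> first | rfl | exact absurd rfl hij)
    have hx2 := hx ▸ h2 4 (by decide)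
    obtain rfl | rfl : x = 2 ∨ x = 3 := by lia
    · exact ⟨![4, 3, 2, 1, 0, 5], by decide, Or.inl (key _ hr _ _ _ (by decide) (by decide))⟩
    · exact ⟨![4, 5, 0, 1, 2, 3], by decide, Or.inr (key _ hr _ _ _ (by decide) (by decide))⟩
  · obtain ⟨x, hx⟩ : ∃ x, m 1 5 = x := ⟨_, rfl⟩
    have hr : ∀ i : Fin 5, m i.castSucc 5 = ![3, x, 2, 2, 3, 0] i.castSucc := by
      intro i
      fin_cases i
      exacts [hrow 0 1 (by decide) _ h0 h1, hx,
        hrow 4 1 (by decide) _ h4' h1, hrow 3 1 (by decide) _ h3 h1,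
        hrow 2 1 (by decide) _ h2' h1]
    have hx3 := h.label_le_two_of_triangle hm (u := ![0, 1, 5]) (x := x) (by decide) (l := 2)
      (by decide) (key _ hr _ _ _ (by decide) fun i j hij => by
        fin_cases i <;> fin_cases j <;> first | rfl | exact absurd rfl hij)
    have hx2 := hx ▸ h2 1 (by decide)
    obtain rfl : x = 2 := by lia
    exact ⟨![4, 5, 0, 1, 2, 3], by decide, Or.inr (key _ hr _ _ _ (by decide) (by decide))⟩
  · obtain ⟨x, hx⟩ : ∃ x, m 0 5 = x := ⟨_, rfl⟩
    have hr : ∀ i : Fin 5, m i.castSucc 5 = ![x, 2, 2, 2, 3, 0] i.castSucc := by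
      intro i
      fin_cases i
      exacts [hx, hrow 0 4 (by decide) _ h0 h4',
        hrow 1 4 (by decide) _ h1 h4', hrow 2 4 (by decide) _ h2' h4',
        hrow 3 4 (by decide) _ h3 h4']
    have hx3 := h.label_le_three_of_path hm (u := ![2, 1, 0, 5, 4]) (x := x) (by decide) (l := 3)
      (by decide) (key _ hr _ _ _ (by decide) fun i j hij => by
        fin_cases i <;> fin_cases j <;> first | rfl | exact absurd rfl hij)
    have hx2 := hx ▸ h2 0 (by decide)
    obtain rfl | rfl : x = 2 ∨ x = 3 := by lia
    · exact ⟨![0, 1, 2, 3, 4, 5], by decide, Or.inl (key _ hr _ _ _ (by decide) (by decide))⟩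
    · exact ⟨![4, 5, 0, 1, 2, 3], by decide, Or.inr (key _ hr _ _ _ (by decide) (by decide))⟩
  · obtain ⟨x, hx⟩ : ∃ x, m 3 5 = x := ⟨_, rfl⟩
    have hr : ∀ i : Fin 5, m i.castSucc 5 = ![3, 2, 2, x, 3, 0] i.castSucc := by
      intro i
      fin_cases i
      exacts [hrow 2 1 (by decide) _ h2' h1, hrow 3 1 (by decide) _ h3 h1,
        hrow 4 1 (by decide) _ h4' h1, hx,
        hrow 0 1 (by decide) _ h0 h1]
    have hx3 := h.label_le_two_of_triangle hm (u := ![4, 3, 5]) (x := x) (by decide) (l := 2)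
      (by decide) (key _ hr _ _ _ (by decide) fun i j hij => by
        fin_cases i <;> fin_cases j <;> first | rfl | exact absurd rfl hij)
    have hx2 := hx ▸ h2 3 (by decide)
    obtain rfl : x = 2 := by lia
    exact ⟨![4, 5, 0, 1, 2, 3], by decide, Or.inr (key _ hr _ _ _ (by decide) (by decide))⟩

/-- A Coxeter simplex whose diagram contains `C̃₄` and `F̃₄` is linear or cyclic. -/
lemma hCoxSimplex.path_or_hex (hX : hCoxSimplex 5 X) (hC : {𝒜 | hSubOcc 5 X cmC4t 𝒜}.ncard ≠ 0)
    (hF : {𝒜 | hSubOcc 5 X cmF4t 𝒜}.ncard ≠ 0) : ∃ p w m, Chamber X p w ∧ HasLabels p m ∧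
      ((∀ i j, i ≠ j → m i j = pathLabel i j) ∨ ∀ i j, i ≠ j → m i j = hexLabel i j) := by
  obtain ⟨p, w, h, hlab⟩ := exists_coxeter_chamber hX
  choose! m hm using hlab
  have hm : HasLabels p m := hm
  obtain ⟨_, hC⟩ := nonempty_of_ncard_ne_zero hC
  obtain ⟨_, hF⟩ := nonempty_of_ncard_ne_zero hF
  obtain ⟨c, hc, hcm, -⟩ := (h.subOcc_iff hm two_le_c4t).1 hC
  obtain ⟨f, hf, hfm, -⟩ := (h.subOcc_iff hm two_le_f4t).1 hF
  obtain ⟨b, hb⟩ : ∃ b, b ∉ range c := by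
    by_contra! hall
    have := Fintype.card_le_of_surjective c hall
    simp at this
  have reindex : ∀ g : Fin 6 → Fin 6, Function.Injective g →
      ∃ e : Fin 6 ≃ Fin 6, ⇑e = g := fun g hg =>
    ⟨Equiv.ofBijective g (Finite.injective_iff_bijective.1 hg), rfl⟩
  obtain ⟨g, hg⟩ := reindex (Fin.snoc c b) (Fin.snoc_injective_iff.2 ⟨hc, hb⟩)
  have hmg : HasLabels (p ∘ g) fun i j => m (g i) (g j) := fun i j hij => hm _ _
      (g.injective.ne hij)
  have hgc : ∀ i : Fin 5, g i.castSucc = c i := fun i => by rw [hg, Fin.snoc_castSucc]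
  obtain ⟨e, he, hpath⟩ := (h.comp_equiv g).path_or_hex_of_c4t hmg (f := g.symm ∘ f)
    (fun i j hij => by simpa only [hgc] using hcm i j hij) (g.symm.injective.comp hf)
    (fun i j hij => by simpa using hfm i j hij)
  obtain ⟨e, rfl⟩ := reindex e he
  exact ⟨_, _, _, (h.comp_equiv g).comp_equiv e,
    fun i j hij => hmg _ _ (e.injective.ne hij), hpath⟩

/-- The Gram matrix of a labelled diagram. -/
def gramOf (L : Fin 6 → Fin 6 → ℕ) (i j : Fin 6) : ℝ :=
  if i = j then 1 else -Real.cos (Real.pi / L i j)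

lemma Irred.gram (h : Irred X p) (hm : HasLabels p m) {L : Fin 6 → Fin 6 → ℕ}
    (hL : ∀ i j, i ≠ j → m i j = L i j) (i j : Fin 6) : mink 5 (p i) (p j) = gramOf L i j := by
  rw [gramOf]
  split_ifs with hij
  · rw [hij, h.unit]
  · rw [(hm i j hij).2, hL i j hij]

lemma IsH55.exists_chamber {F : Set (hypSet 5)} (hF : IsH55 F) :
    ∃ f z, Chamber F f z ∧ ∀ i j, mink 5 (f i) (f j) = gramOf pathLabel i j := by
  obtain ⟨-, hF, -, hC, hF4, -⟩ := hF
  obtain ⟨f, z, m, h, hm, hp | hx⟩ := hF.path_or_hex (by rw [hC]; exact one_ne_zero)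
    (by rw [hF4]; exact one_ne_zero)
  · exact ⟨f, z, h, h.gram hm hp⟩
  exfalso
  have hocc : ∀ c : Fin 5 → Fin 6, Function.Injective c →
      (∀ i j, i ≠ j → hexLabel (c i) (c j) = cmC4t i j) →
      (range fun i => F ∩ hWall 5 (f (c i))) ∈ {𝒜 | hSubOcc 5 F cmC4t 𝒜} := fun c hc hL =>
    (h.subOcc_iff hm two_le_c4t).2
      ⟨c, hc, fun i j hij => by rw [hx _ _ (hc.ne hij), hL i j hij], rfl⟩
  have heq := (ncard_le_one (finite_of_ncard_ne_zero (by rw [hC]; exact one_ne_zero))).1 hC.le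
    _ (hocc ![2, 3, 4, 5, 0] (by decide) fun i j _ => by fin_cases i <;> fin_cases j <;> trivial)
    _ (hocc ![3, 2, 1, 0, 5] (by decide) fun i j _ => by fin_cases i <;> fin_cases j <;> trivial)
  obtain ⟨i, hi⟩ := heq.symm.subset (mem_range_self 2)
  exact (by decide : ∀ i : Fin 5, ![2, 3, 4, 5, 0] i ≠ (1 : Fin 6)) i (h.facet_injective hi)

lemma IsH125.exists_chamber {P : Set (hypSet 5)} (hP : IsH125 P) :
    ∃ p w, Chamber P p w ∧ ∀ i j, mink 5 (p i) (p j) = gramOf hexLabel i j := by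
  obtain ⟨-, hP, -, hC, hF4, -⟩ := hP
  obtain ⟨p, w, m, h, hm, hp | hx⟩ := hP.path_or_hex (by rw [hC]; exact two_ne_zero)
    (by rw [hF4]; exact four_ne_zero)
  · exfalso
    have hocc : {𝒜 | hSubOcc 5 P cmC4t 𝒜} ⊆ {(fun i => P ∩ hWall 5 (p i)) '' {5}ᶜ} := by
      intro 𝒜 h𝒜
      obtain ⟨c, hc, hcm, rfl⟩ := (h.subOcc_iff hm two_le_c4t).1 h𝒜
      have hcp : ∀ i j, i ≠ j → pathLabel (c i) (c j) = cmC4t i j := fun i j hij => by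
        rw [← hp _ _ (hc.ne hij), hcm i j hij]
      have h5 := c4t_in_path (c 0) (c 1) (hcp 0 1 (by decide)) (c 2)
        ⟨hcp 1 2 (by decide), hc.ne (by decide)⟩ (c 3)
        ⟨hcp 2 3 (by decide), hcp 1 3 (by decide)⟩ (c 4) (hcp 3 4 (by decide))
      have hrange : range c = {5}ᶜ := by
        refine eq_of_subset_of_ncard_le (range_subset_iff.2 fun i => ?_) ?_
        · fin_cases i
          exacts [h5.1, h5.2.1, h5.2.2.1, h5.2.2.2.1, h5.2.2.2.2]
        · rw [ncard_range_of_injective hc, ncard_compl]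
          simp
      rw [mem_singleton_iff, ← hrange, ← range_comp]
      rfl
    have := ncard_le_ncard hocc
    rw [hC, ncard_singleton] at this
    lia
  · exact ⟨p, w, h, h.gram hm hx⟩

end Diagram

section NullVectors

variable {X : Set (hypSet 5)} {p w : Fin 6 → V 5}

lemma Chamber.mul_self_dual (h : Chamber X p w) {G : Fin 6 → Fin 6 → ℝ}
    (hG : ∀ i j, mink 5 (p i) (p j) = G i j) (k : Fin 6) (t : Fin 6 → ℝ)
    (ht : ∀ j, j ≠ k → ∑ i, t i * G i j = 0) :
    t k = (∑ i, t i * G i k) * mink 5 (w k) (w k) := by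
  have hv : ∀ j, mink 5 (p j) (∑ i, t i • p i) = ∑ i, t i * G i j := fun j => by
    rw [mink_comm, mink_sum_left]
    simp [hG]
  have he : ∑ i, t i • p i = -(∑ i, t i * G i k) • w k := h.eq_of_mink fun j => by
    rw [hv, mink_smul_right, h.dual]
    split_ifs with hj
    · rw [hj]; ring
    · rw [ht j hj, mul_zero]
  have := congr_arg (mink 5 · (w k)) he
  simp only [mink_sum_left, mink_smul_left, h.dual] at this
  simp only [mul_ite, mul_neg, mul_one, mul_zero, Finset.sum_ite_eq', Finset.mem_univ,
    if_true] at this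
  linarith

lemma gramOf_hexLabel (i j : Fin 6) : gramOf hexLabel i j = hexGram i j := by
  fin_cases i <;> fin_cases j <;> simp [gramOf, hexLabel, cmOfEdges, hexGram, rt] <;> norm_num

lemma sum_mul_gramOf_pathLabel (t : Fin 6 → ℝ) (j : Fin 6) :
    ∑ i, t i * gramOf pathLabel i j = pairF j t := by
  rw [Fin.sum_univ_six]
  fin_cases j <;> simp [gramOf, pathLabel, cmOfEdges, pairF, rt] <;> ring

/-- Combinations of five normals of the cyclic simplex orthogonal to these five normals. -/
def hexNull : Fin 6 → Fin 6 → ℝ :=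
  ![![0, 2, 4, 6 * rt, 4 * rt, 2 * rt], ![1, 0, 1, 2 * rt, 2 * rt, 2 * rt],
    ![4, 2, 0, 2 * rt, 4 * rt, 6 * rt], ![3, 2, 1, 0, 2 * rt, 4 * rt],
    ![2, 2, 2, 2 * rt, 0, 2 * rt], ![1, 2, 3, 4 * rt, 2 * rt, 0]]

lemma hexNull_self (k : Fin 6) : hexNull k k = 0 := by
  fin_cases k <;> simp [hexNull]

lemma sum_hexNull (k j : Fin 6) (hj : j ≠ k) : ∑ i, hexNull k i * hexGram i j = 0 := by
  have hrt := rt_mul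
  rw [Fin.sum_univ_six]
  fin_cases k <;> fin_cases j <;> first | exact absurd rfl hj | simp [hexNull, hexGram] <;> linarith

lemma sum_hexNull_self (k : Fin 6) : ∑ i, hexNull k i * hexGram i k < 0 := by
  have hrt := rt_mul
  have := rt_pos
  rw [Fin.sum_univ_six]
  fin_cases k <;> simp [hexNull, hexGram] <;> linarith

/-- All vertices of the simplex with cyclic diagram are ideal. -/
lemma Chamber.ideal_of_hex (h : Chamber X p w) (hG : ∀ i j, mink 5 (p i) (p j) = hexGram i j)
    (k : Fin 6) : mink 5 (w k) (w k) = 0 := by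
  have := h.mul_self_dual hG k (hexNull k) (sum_hexNull k)
  rw [hexNull_self, eq_comm, mul_eq_zero] at this
  exact this.resolve_left (sum_hexNull_self k).ne

/-- Combinations of normals of the linear simplex orthogonal to five of the normals. -/
def pathNull : Fin 6 → Fin 6 → ℝ :=
  ![![0, 1, 2, 3, 4 * rt, 2 * rt], ![2 * rt, 2, 4, 6, 8 * rt, 4 * rt],
    ![2 * rt, 2, 2, 3, 4 * rt, 2 * rt], ![6 * rt, 6, 6, 6, 8 * rt, 4 * rt],
    ![4 * rt, 4, 4, 4, 4 * rt, 2 * rt], ![2 * rt, 2, 2, 2, 2 * rt, 0]]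

lemma pairF_pathNull (k j : Fin 6) (hj : j ≠ k) : pairF j (pathNull k) = 0 := by
  have hrt := rt_mul
  fin_cases k <;> fin_cases j <;> first | exact absurd rfl hj | simp [pathNull, pairF] <;> linarith

/-- The ideal vertices of the simplex with linear diagram. -/
lemma Chamber.ideal_iff_of_path (h : Chamber X p w)
    (hG : ∀ i j, mink 5 (p i) (p j) = gramOf pathLabel i j) (k : Fin 6) :
    mink 5 (w k) (w k) = 0 ↔ k = 0 ∨ k = 5 := by
  have hrt := rt_mul
  have hpos := rt_pos
  have := h.mul_self_dual hG k (pathNull k) fun j hj => by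
    rw [sum_mul_gramOf_pathLabel, pairF_pathNull k j hj]
  rw [sum_mul_gramOf_pathLabel] at this
  constructor
  · intro h0
    rw [h0, mul_zero] at this
    fin_cases k <;> simp [pathNull, hpos.ne'] at this ⊢
  · rintro (rfl | rfl) <;> simp [pathNull, pairF] at this
    · exact this.resolve_left hpos.ne'
    · rcases this with h0 | h0
      exacts [by linarith, h0]

end NullVectors

section Isometry

variable {n : ℕ}

/-- Points of the hyperboloid span the ambient space. -/
lemma exists_hyperboloid_frame (n : ℕ) : ∃ (y : Fin (n + 1) → hypSet n)
    (φ : Fin (n + 1) → V n →ₗ[ℝ] ℝ), ∀ v, v = ∑ k, φ k v • (y k).val := by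
  have h2 : √2 * √2 = (2 : ℝ) := Real.mul_self_sqrt zero_le_two
  have ho : EuclideanSpace.single 0 1 ∈ hypSet n := by
    simp [hypSet, mink]
  have hy : ∀ i : Fin n, EuclideanSpace.single 0 √2 + EuclideanSpace.single i.succ 1 ∈ hypSet n :=
    fun i => by
    simp [hypSet, mink, h2]
    norm_num
  let c : Fin (n + 1) → V n →ₗ[ℝ] ℝ := fun k => (EuclideanSpace.proj k).toLinearMap
  refine ⟨Fin.cons ⟨_, ho⟩ fun i => ⟨_, hy i⟩,
    Fin.cons (c 0 - √2 • ∑ i : Fin n, c i.succ) fun i => c i.succ, fun v => ?_⟩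
  ext k
  rw [Fin.sum_univ_succ]
  refine Fin.cases ?_ (fun j => ?_) k
  · simp [c]
    rw [← Finset.sum_mul]
    ring
  · simp [c]
    simp [Pi.single_apply]

lemma hIsIsom.exists_linear {g : hypSet n → hypSet n} (hg : hIsIsom n g) :
    ∃ L : V n → V n, (∀ x : hypSet n, L x.val = (g x).val) ∧
      ∀ v w, mink n (L v) (L w) = mink n v w := by
  obtain ⟨y, φ, hφ⟩ := exists_hyperboloid_frame n
  have hm : ∀ v (x : hypSet n), mink n (∑ k, φ k v • (g (y k)).val) (g x).val = mink n v x.val := by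
    intro v x
    conv_rhs => rw [hφ v]
    simp only [mink_sum_left, mink_smul_left, hg.2]
  have hL : ∀ v w, mink n (∑ k, φ k v • (g (y k)).val) (∑ k, φ k w • (g (y k)).val) =
      mink n v w := by
    intro v w
    conv_rhs => rw [hφ w]
    simp only [mink_sum_right, mink_smul_right, hm]
  refine ⟨fun v => ∑ k, φ k v • (g (y k)).val, fun x => ?_, hL⟩
  rw [← sub_eq_zero]
  by_contra hne
  have h0 := mink_self_pos (timelike_val (g x)).1 ?_ hne
  · simp only [mink_sub_left, mink_sub_right, hL, hm, mink_comm (g x).val, hg.2, sub_self,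
      lt_irrefl] at h0
  · rw [mink_sub_left, hm, hg.2, sub_self]

lemma Irred.image {ι : Type*} {F : Set (hypSet n)} {f : ι → V n} (h : Irred F f)
    {g : hypSet n → hypSet n} (hg : hIsIsom n g) :
    ∃ f' : ι → V n, Irred (g '' F) f' ∧ ∀ i j, mink n (f' i) (f' j) = mink n (f i) (f j) := by
  obtain ⟨L, hLg, hL⟩ := hg.exists_linear
  have hm : ∀ v (x : hypSet n), mink n (L v) (g x).val = mink n v x.val := fun v x => by
    rw [← hLg, hL]
  refine ⟨L ∘ f, ⟨fun i => (hL _ _).trans (h.unit i), ?_, fun i => ?_⟩, fun i j => hL _ _⟩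
  · ext x
    obtain ⟨y, rfl⟩ := hg.1.surjective x
    rw [hg.1.injective.mem_set_image, h.mem, mem_iInter]
    simp only [mem_hHalf, Function.comp_apply, hm]
  · obtain ⟨m, h0, h1⟩ := h.wit i
    exact ⟨g m, (hm _ _).trans h0, fun j hj => (hm _ _).trans_lt (h1 j hj)⟩

lemma Chamber.congr {F T : Set (hypSet 5)} {f z : Fin 6 → V 5} (h : Chamber F f z)
    (hT : hIsCoxPoly 5 T) (hFT : hCongr 5 F T) :
    ∃ g ρ, Chamber T g ρ ∧ ∀ i j, mink 5 (g i) (g j) = mink 5 (f i) (f j) := by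
  obtain ⟨φ, hφ, rfl⟩ := hFT
  obtain ⟨g, hg, hgram⟩ := h.image hφ
  obtain ⟨k, v, -, -, hi, hvol, -⟩ := hT
  obtain ⟨ρ, hρ⟩ := exists_chamber hg hi hvol
  exact ⟨g, ρ, hρ, hgram⟩

end Isometry

section Staircase

open Filter Topology

lemma coeff_nonneg_of_frequently {n : ℕ} {a : Fin n → ℝ}
    (h : ∃ᶠ ε in 𝓝[>] (0 : ℝ), 0 ≤ ∑ k, a k * ε ^ (k : ℕ)) {m : Fin n}
    (hm : ∀ k < m, a k = 0) : 0 ≤ a m := by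
  by_contra! hneg
  refine h ?_
  have hlim : Tendsto (fun ε : ℝ => ∑ k, a k * ε ^ ((k : ℕ) - m)) (𝓝[>] 0) (𝓝 (a m)) := by
    have hc : Continuous fun ε : ℝ => ∑ k, a k * ε ^ ((k : ℕ) - m) := by fun_prop
    have h0 := (hc.tendsto 0).mono_left (nhdsWithin_le_nhds (s := Ioi 0))
    convert h0 using 2
    rw [Finset.sum_eq_single m _ (by simp)]
    · simp
    · intro k _ hk
      rcases lt_or_gt_of_ne hk with hlt | hlt
      · rw [hm k hlt, zero_mul]
      · rw [zero_pow (Nat.sub_ne_zero_of_lt hlt), mul_zero]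
  filter_upwards [hlim.eventually_lt_const hneg, self_mem_nhdsWithin] with ε hε hpos
  rw [not_le]
  have : ∑ k, a k * ε ^ (k : ℕ) = ε ^ (m : ℕ) * ∑ k, a k * ε ^ ((k : ℕ) - m) := by
    rw [Finset.mul_sum]
    refine Finset.sum_congr rfl fun k _ => ?_
    rcases lt_or_ge k m with hlt | hge
    · simp [hm k hlt]
    · rw [mul_left_comm, ← pow_add, Nat.add_sub_cancel' hge]
  rw [this]
  exact mul_neg_of_pos_of_neg (pow_pos hpos _) hε

/-- A nonnegative matrix whose inverse has lexicographically nonnegative rows becomes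
lower triangular after permuting its columns. -/
lemma exists_staircase {n : ℕ} {C D : Fin n → Fin n → ℝ} (hC : ∀ j i, 0 ≤ C j i)
    (hCD : ∀ j l, ∑ i, C j i * D i l = if j = l then 1 else 0)
    (hDC : ∀ i l, ∑ j, D i j * C j l = if i = l then 1 else 0)
    (hlex : ∀ i m, (∀ k < m, D i k = 0) → 0 ≤ D i m) :
    ∃ h : Fin n → Fin n, (∀ k, 0 < C k (h k)) ∧ (∀ k j, k < j → C j (h k) = 0) ∧
      ∀ k j, k < j → D (h j) k = 0 := by
  suffices H : ∀ m ≤ n, ∃ h : Fin n → Fin n, ∀ k : Fin n, (k : ℕ) < m →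
      0 < C k (h k) ∧ (∀ j, k < j → C j (h k) = 0) ∧
      (∀ j : Fin n, k < j → (j : ℕ) < m → D (h j) k = 0) ∧
      ∀ i, (∀ j : Fin n, (j : ℕ) < m → i ≠ h j) → D i k = 0 by
    obtain ⟨h, hh⟩ := H n le_rfl
    exact ⟨h, fun k => (hh k k.2).1, fun k => (hh k k.2).2.1,
      fun k j hkj => (hh k k.2).2.2.1 j hkj j.2⟩
  intro m
  induction m with
  | zero => exact fun _ => ⟨id, fun k hk => absurd hk (Nat.not_lt_zero _)⟩
  | succ m ih =>
    intro hmn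
    obtain ⟨h, hh⟩ := ih (Nat.le_of_succ_le hmn)
    let q : Fin n := ⟨m, hmn⟩
    have hz : ∀ j, q ≤ j → ∀ k : Fin n, (k : ℕ) < m → C j (h k) = 0 := fun j hj k hk =>
      (hh k hk).2.1 j (lt_of_lt_of_le hk hj)
    have hD : ∀ i, (∀ j : Fin n, (j : ℕ) < m → i ≠ h j) → 0 ≤ D i q := fun i hi =>
      hlex i q fun k hk => (hh k hk).2.2.2 i hi
    have hnn : ∀ j, q ≤ j → ∀ i, 0 ≤ C j i * D i q := fun j hj i => by
      by_cases hi : ∀ j : Fin n, (j : ℕ) < m → i ≠ h j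
      · exact mul_nonneg (hC j i) (hD i hi)
      · push Not at hi
        obtain ⟨k, hk, rfl⟩ := hi
        rw [hz j hj k hk, zero_mul]
    obtain ⟨a, -, ha⟩ : ∃ a ∈ Finset.univ, 0 < C q a * D a q := by
      by_contra! hle
      have := Finset.sum_nonpos hle
      rw [hCD, if_pos rfl] at this
      linarith
    have haC : 0 < C q a := lt_of_le_of_ne (hC q a) fun h0 => by simp [← h0] at ha
    have haD : 0 < D a q := (mul_pos_iff_of_pos_left haC).1 ha
    have hanew : ∀ j : Fin n, (j : ℕ) < m → a ≠ h j := by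
      rintro k hk rfl
      exact haC.ne' (hz q le_rfl k hk)
    have hcol : ∀ j, q < j → C j a = 0 := fun j hj => by
      have h0 := (Finset.sum_eq_zero_iff_of_nonneg fun i _ => hnn j hj.le i).1
        ((hCD j q).trans (if_neg hj.ne')) a (Finset.mem_univ a)
      exact (mul_eq_zero.1 h0).resolve_right haD.ne'
    have hupd : ∀ k : Fin n, (k : ℕ) < m → Function.update h q a k = h k := fun k hk =>
      Function.update_of_ne (Fin.ne_of_val_ne hk.ne) _ _
    refine ⟨Function.update h q a, fun k hk => ?_⟩
    rcases Nat.lt_succ_iff_lt_or_eq.1 hk with hk | hk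
    · rw [hupd k hk]
      refine ⟨(hh k hk).1, (hh k hk).2.1, fun j hkj hj => ?_, fun i hi => ?_⟩
      · rcases Nat.lt_succ_iff_lt_or_eq.1 hj with hj | hj
        · rw [hupd j hj]
          exact (hh k hk).2.2.1 j hkj hj
        · obtain rfl : j = q := Fin.ext hj
          rw [Function.update_self]
          exact (hh k hk).2.2.2 a hanew
      · exact (hh k hk).2.2.2 i fun j hj => by
          rw [← hupd j hj]
          exact hi j (Nat.lt_succ_of_lt hj)
    · obtain rfl : k = q := Fin.ext hk
      rw [Function.update_self]
      refine ⟨haC, hcol, fun j hj hj' => absurd hj' (by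
        have : m < (j : ℕ) := hj
        lia), fun i hi => ?_⟩
      have hia : i ≠ a := by simpa using hi q (Nat.lt_succ_self m)
      have hsum := hDC i a
      rw [if_neg hia, Finset.sum_eq_single q _ (by simp)] at hsum
      · exact (mul_eq_zero.1 hsum).resolve_right haC.ne'
      · intro j _ hj
        rcases lt_or_gt_of_ne hj with hlt | hlt
        · rw [(hh j hlt).2.2.2 i (fun j hj => by
            rw [← hupd j hj]
            exact hi j (Nat.lt_succ_of_lt hj)), zero_mul]
        · rw [hcol j hlt, mul_zero]

end Staircase

section Coordinates

/-- The matrix of pairings of normals with vertex rays. -/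
def coord (p ρ : Fin 6 → V 5) (j i : Fin 6) : ℝ := -mink 5 (p j) (ρ i)

variable {P T : Set (hypSet 5)} {p w g ρ : Fin 6 → V 5}

lemma Chamber.mink_eq_sum (h : Chamber P p w) (x z : V 5) :
    mink 5 x z = -∑ k, mink 5 x (w k) * mink 5 (p k) z := by
  conv_lhs => rw [h.expand z, mink_sum_right]
  simp [mul_comm]

lemma mink_sum_smul_self {n : ℕ} {ι : Type*} [Fintype ι] (s : ι → ℝ) (w : ι → V n) :
    mink n (∑ k, s k • w k) (∑ k, s k • w k) = ∑ a, ∑ b, s a * (s b * mink n (w a) (w b)) := by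
  simp only [mink_sum_left, mink_sum_right, mink_smul_left, mink_smul_right]
  exact Finset.sum_congr rfl fun a _ => by simp only [Finset.mul_sum, mink_comm (w a)]

lemma Chamber.w_nonpos (h : Chamber P p w) (k l : Fin 6) : mink 5 (w k) (w l) ≤ 0 := by
  rcases eq_or_ne k l with rfl | hkl
  exacts [h.w_causal k, (h.w_sep hkl).le]

lemma Chamber.sum_coord_mul (hT : Chamber T g ρ) (hP : Chamber P p w) (j l : Fin 6) :
    ∑ i, coord p ρ j i * coord g w i l = if j = l then 1 else 0 := by
  have := hT.mink_eq_sum (p j) (w l)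
  rw [hP.dual] at this
  simp only [coord, neg_mul_neg]
  split_ifs at this ⊢ <;> linarith

lemma Chamber.coord_nonneg (hP : Chamber P p w) (hT : Chamber T g ρ) (hTP : T ⊆ P)
    (j i : Fin 6) : 0 ≤ coord p ρ j i := by
  obtain ⟨k, hk⟩ := exists_ne i
  have key : ∀ t : ℝ, 0 < t → t * mink 5 (p j) (ρ i) + mink 5 (p j) (ρ k) ≤ 0 := fun t ht => by
    have hz : mink 5 (t • ρ i + ρ k) (t • ρ i + ρ k) < 0 := by
      simp only [mink_add_left, mink_add_right, mink_smul_left, mink_smul_right, mink_comm (ρ k)]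
      have h1 := mul_nonpos_of_nonneg_of_nonpos (mul_pos ht ht).le (hT.w_causal i)
      have h2 := mul_neg_of_pos_of_neg ht (hT.w_sep hk.symm)
      linarith [hT.w_causal k, mink_comm (ρ k) (ρ k)]
    have h0 : 0 < (t • ρ i + ρ k) 0 := add_pos (mul_pos ht (hT.w_future i)) (hT.w_future k)
    obtain ⟨c, hc, x, hx⟩ := exists_normalized hz h0
    have hxT : x ∈ T := hT.mem.2 fun a => by
      rw [hx, mink_smul_right, mink_add_right, mink_smul_right]
      exact mul_nonpos_of_nonneg_of_nonpos hc.le (add_nonpos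
        (mul_nonpos_of_nonneg_of_nonpos ht.le (hT.dual_nonpos a i)) (hT.dual_nonpos a k))
    have := hP.mem.1 (hTP hxT) j
    rw [hx, mink_smul_right, mink_add_right, mink_smul_right] at this
    exact nonpos_of_mul_nonpos_right this hc
  rw [coord, Left.nonneg_neg_iff]
  by_contra! ha
  have := key (|mink 5 (p j) (ρ k)| / mink 5 (p j) (ρ i) + 1) (by positivity)
  rw [add_mul, div_mul_cancel₀ _ ha.ne'] at this
  linarith [neg_abs_le (mink 5 (p j) (ρ k))]

lemma Chamber.gram_coord (hT : Chamber T g ρ)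
    (hG : ∀ i j, mink 5 (g i) (g j) = gramOf pathLabel i j) (j l : Fin 6) :
    gramF (coord p ρ j) (coord p ρ l) = mink 5 (p j) (p l) := by
  have hexp : ∀ k, p k = ∑ i, coord p ρ k i • g i := fun k => by
    simpa only [coord, mink_comm (ρ _)] using hT.expand' (p k)
  conv_rhs => rw [hexp j, mink_sum_left]
  refine Finset.sum_congr rfl fun i _ => ?_
  conv_rhs => rw [hexp l, mink_smul_left, mink_sum_right]
  rw [← sum_mul_gramOf_pathLabel]
  congr 1
  exact Finset.sum_congr rfl fun m _ => by rw [mink_smul_right, mink_comm, hG]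

/-- A lightlike vertex of a tile lies on a ray through a vertex of the whole simplex. -/
lemma Chamber.coord_eq_zero_or (hP : Chamber P p w) (hT : Chamber T g ρ) (hTP : T ⊆ P) {i : Fin 6}
    (hi : mink 5 (ρ i) (ρ i) = 0) {j l : Fin 6} (hjl : j ≠ l) :
    coord p ρ j i = 0 ∨ coord p ρ l i = 0 := by
  have hexp : ρ i = ∑ k, coord p ρ k i • w k := hP.expand (ρ i)
  have hC := fun k => hP.coord_nonneg hT hTP k i
  have hnon : ∀ a b, coord p ρ a i * (coord p ρ b i * mink 5 (w a) (w b)) ≤ 0 := fun a b =>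
    mul_nonpos_of_nonneg_of_nonpos (hC a) (mul_nonpos_of_nonneg_of_nonpos (hC b) (hP.w_nonpos a b))
  have hsum : ∑ a, ∑ b, coord p ρ a i * (coord p ρ b i * mink 5 (w a) (w b)) = 0 := by
    rw [← mink_sum_smul_self, ← hexp, hi]
  have h1 := (Finset.sum_eq_zero_iff_of_nonpos fun a _ =>
    Finset.sum_nonpos fun b _ => hnon a b).1 hsum j (Finset.mem_univ j)
  have h2 := (Finset.sum_eq_zero_iff_of_nonpos fun b _ => hnon j b).1 h1 l (Finset.mem_univ l)
  simpa [(hP.w_sep hjl).ne] using h2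

lemma Chamber.exists_mem_of_pos (h : Chamber P p w) {s : Fin 6 → ℝ} (hs : ∀ k, 0 < s k) :
    ∃ c : ℝ, 0 < c ∧ ∃ x : hypSet 5, x.val = c • ∑ k, s k • w k := by
  refine exists_normalized ?_ ?_
  · rw [mink_sum_smul_self]
    have hnon : ∀ a b, s a * (s b * mink 5 (w a) (w b)) ≤ 0 := fun a b =>
      mul_nonpos_of_nonneg_of_nonpos (hs a).le
        (mul_nonpos_of_nonneg_of_nonpos (hs b).le (h.w_nonpos a b))
    refine Finset.sum_neg' (fun a _ => Finset.sum_nonpos fun b _ => ?_) ⟨0, Finset.mem_univ _, ?_⟩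
    · linarith [hnon a b]
    · refine Finset.sum_neg' (fun b _ => ?_) ⟨1, Finset.mem_univ _, ?_⟩
      · linarith [hnon 0 b]
      · have := mul_neg_of_pos_of_neg (hs 0) (mul_neg_of_pos_of_neg (hs 1)
          (h.w_sep (zero_ne_one : (0 : Fin 6) ≠ 1)))
        linarith
  · rw [WithLp.ofLp_sum, Finset.sum_apply]
    exact Finset.sum_pos (fun k _ => mul_pos (hs k) (h.w_future k)) ⟨0, Finset.mem_univ _⟩

lemma Chamber.mink_sum_smul (h : Chamber P p w) (s : Fin 6 → ℝ) (i : Fin 6) :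
    mink 5 (p i) (∑ k, s k • w k) = -s i := by
  simp [mink_sum_right, h.dual]

/-- Two chambers whose interiors are disjoint have no common positive combination of vertices. -/
lemma Chamber.interior_inter_nonempty (hP : Chamber P p w) {T' : Set (hypSet 5)}
    {g' ρ' : Fin 6 → V 5} (hT : Chamber T g ρ) (hT' : Chamber T' g' ρ') {s s' : Fin 6 → ℝ}
    (hs : ∀ n, 0 < s n) (hs' : ∀ n, 0 < s' n)
    (h : ∀ j, ∑ n, coord p ρ j n * s n = ∑ n, coord p ρ' j n * s' n) :
    (interior T ∩ interior T').Nonempty := by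
  have heq : ∑ n, s n • ρ n = ∑ n, s' n • ρ' n := hP.eq_of_mink fun j => by
    simpa [coord, mink_sum_right, mul_comm] using h j
  obtain ⟨c, hc, x, hx⟩ := hT.exists_mem_of_pos hs
  refine ⟨x, hT.subset_interior fun i => ?_, hT'.subset_interior fun i => ?_⟩
  · rw [hx, mink_smul_right, hT.mink_sum_smul]
    exact mul_neg_of_pos_of_neg hc (neg_neg_of_pos (hs i))
  · rw [hx, heq, mink_smul_right, hT'.mink_sum_smul]
    exact mul_neg_of_pos_of_neg hc (neg_neg_of_pos (hs' i))

end Coordinates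

section Tiles

open Filter Topology

variable {P T : Set (hypSet 5)} {p w g ρ : Fin 6 → V 5} {𝒯 : Set (Set (hypSet 5))}

/-- In a decomposition of the second type, a wall of a tile through a codimension-two face of the
whole simplex is a wall of that simplex. -/
lemma Chamber.normal_eq_or_eq (hP : Chamber P p w) (hT : Chamber T g ρ) (hTP : T ⊆ P)
    (hmem : T ∈ 𝒯) (hsec : hSecondType 5 P 𝒯) {i u v : Fin 6} (huv : u ≠ v) {a b : ℝ}
    (hg : g i = a • p u + b • p v) : g i = p u ∨ g i = p v := by
  have hsub : P ∩ hWall 5 (p u) ∩ (P ∩ hWall 5 (p v)) ⊆ hWall 5 (g i) := fun x hx => by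
    rw [mem_hWall, hg, mink_add_left, mink_smul_left, mink_smul_left, mem_hWall.1 hx.1.2,
      mem_hWall.1 hx.2.2]
    ring
  obtain ⟨x, hxP, hxu, hxv⟩ := hP.walls_meet u v
  have hmir := hsec _ _ (hP.isFacet u) (hP.isFacet v) (fun h => huv (hP.facet_injective h))
    ⟨x, ⟨hxP, hxu⟩, hxP, hxv⟩
  obtain ⟨S, hS, hSg⟩ : ∃ S, hIsFacet 5 P S ∧ S ⊆ hWall 5 (g i) := by
    by_contra hno
    exact hmir ⟨g i, ⟨hT.unit i, ⟨T, hmem, _, hT.isFacet i, inter_subset_right⟩, hno⟩, hsub⟩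
  obtain ⟨m, rfl⟩ := hP.facet_eq hS
  have hgm : g i = p m := by
    refine (hP.eq_or_eq_neg (hT.unit i) hSg).resolve_right fun hneg => ?_
    have h1 := hP.coord_nonneg hT hTP m i
    have h2 := hT.dual i i
    rw [hneg, mink_neg_left, if_pos rfl] at h2
    rw [coord] at h1
    linarith
  have hm : m = u ∨ m = v := by
    by_contra! hm
    have := hP.dual m m
    rw [← hgm, hg, mink_add_left, mink_smul_left, mink_smul_left, hP.dual, hP.dual,
      if_neg hm.1.symm, if_neg hm.2.symm] at this
    norm_num at this
  rw [hgm]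
  exact hm.imp (congr_arg p) (congr_arg p)

lemma Chamber.coord_eq_single (hT : Chamber T g ρ) {i j : Fin 6} (h : g i = p j) :
    coord p ρ j = Pi.single i 1 := by
  ext n
  rw [coord, ← h, hT.dual, Pi.single_apply]
  simp only [eq_comm (a := n)]
  split_ifs <;> norm_num

lemma Chamber.eq_of_mink_dual (h : Chamber P p w) {x y : V 5}
    (hxy : ∀ k, mink 5 x (w k) = mink 5 y (w k)) : x = y := by
  rw [h.expand' x, h.expand' y]
  simp only [mink_comm (w _), hxy]

lemma Chamber.rawChart (hP : Chamber P p w) (hT : Chamber T g ρ) (hTP : T ⊆ P)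
    (hmem : T ∈ 𝒯) (hsec : hSecondType 5 P 𝒯)
    (hpG : ∀ i j, mink 5 (p i) (p j) = hexGram i j)
    (hgG : ∀ i j, mink 5 (g i) (g j) = gramOf pathLabel i j) : RawChart (coord p ρ) where
  nn := hP.coord_nonneg hT hTP
  gram j l := (hT.gram_coord hgG j l).trans (hpG j l)
  mono i hi j l hjl := hP.coord_eq_zero_or hT hTP ((hT.ideal_iff_of_path hgG i).2 hi) hjl
  ridge i j l hjl u v h0 hi := by
    set c := u * coord p ρ j i + v * coord p ρ l i with hc
    have hg : g i = (u / c) • p j + (v / c) • p l := hT.eq_of_mink_dual fun n => by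
      have hcomb : mink 5 ((u / c) • p j + (v / c) • p l) (ρ n) =
          -((u * coord p ρ j n + v * coord p ρ l n) / c) := by
        simp only [coord, mink_add_left, mink_smul_left]
        ring
      rw [hcomb, hT.dual]
      split_ifs with hin
      · rw [← hin, ← hc, div_self hi]
      · rw [h0 n (Ne.symm hin), zero_div, neg_zero]
    have key : ∀ {m}, g i = p m → ∀ n, n ≠ i → coord p ρ m n = 0 := fun h n hn => by
      rw [hT.coord_eq_single h, Pi.single_eq_of_ne hn]
    exact (hP.normal_eq_or_eq hT hTP hmem hsec hjl hg).imp key key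

/-- A flag of the simplex is refined by a flag of some tile. -/
lemma Chamber.exists_tile_staircase (hP : Chamber P p w) {ι : Type*} [Finite ι]
    {T : ι → Set (hypSet 5)} {g ρ : ι → Fin 6 → V 5} (hT : ∀ t, Chamber (T t) (g t) (ρ t))
    (hTP : ∀ t, T t ⊆ P) (hcov : P ⊆ ⋃ t, T t) :
    ∃ t, ∃ h : Fin 6 → Fin 6, (∀ k, 0 < coord p (ρ t) k (h k)) ∧
      (∀ k j, k < j → coord p (ρ t) j (h k) = 0) ∧
      ∀ k j, k < j → coord (g t) w (h j) k = 0 := by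
  have hex : ∀ ε : ℝ, 0 < ε → ∃ t, ∀ i, 0 ≤ ∑ k, coord (g t) w i k * ε ^ (k : ℕ) := fun ε hε => by
    obtain ⟨c, hc, x, hx⟩ := hP.exists_mem_of_pos (s := fun k => ε ^ (k : ℕ)) fun k => pow_pos hε _
    have hxP : x ∈ P := hP.mem.2 fun i => by
      rw [hx, mink_smul_right, hP.mink_sum_smul]
      exact mul_nonpos_of_nonneg_of_nonpos hc.le (neg_nonpos.2 (pow_pos hε _).le)
    obtain ⟨t, ht⟩ := mem_iUnion.1 (hcov hxP)
    refine ⟨t, fun i => ?_⟩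
    have := (hT t).mem.1 ht i
    rw [hx, mink_smul_right] at this
    have := nonpos_of_mul_nonpos_right this hc
    rw [mink_sum_right] at this
    simp only [mink_smul_right] at this
    simp only [coord, neg_mul, Finset.sum_neg_distrib, Left.nonneg_neg_iff]
    simpa only [mul_comm] using this
  obtain ⟨t, ht⟩ : ∃ t, ∃ᶠ ε in 𝓝[>] (0 : ℝ), ∀ i, 0 ≤ ∑ k, coord (g t) w i k * ε ^ (k : ℕ) := by
    by_contra! hno
    obtain ⟨ε, hε, hpos⟩ := ((eventually_all.2 hno).and self_mem_nhdsWithin).exists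
    obtain ⟨t, ht⟩ := hex ε hpos
    obtain ⟨i, hi⟩ := hε t
    exact hi.not_ge (ht i)
  exact ⟨t, exists_staircase (hP.coord_nonneg (hT t) (hTP t)) ((hT t).sum_coord_mul hP)
    (hP.sum_coord_mul (hT t))
    fun i m hm => coeff_nonneg_of_frequently (ht.mono fun ε hε => hε i) hm⟩

lemma Chamber.exists_tile_flag (hP : Chamber P p w) (hw : ∀ k, mink 5 (w k) (w k) = 0)
    (hsec : hSecondType 5 P 𝒯) {ι : Type*} [Finite ι]
    {T : ι → Set (hypSet 5)} {g ρ : ι → Fin 6 → V 5} (hmem : ∀ t, T t ∈ 𝒯)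
    (hT : ∀ t, Chamber (T t) (g t) (ρ t)) (hTP : ∀ t, T t ⊆ P) (hcov : P ⊆ ⋃ t, T t) :
    ∃ t, ∃ h : Fin 6 → Fin 6, (∀ k, 0 < coord p (ρ t) k (h k)) ∧
      (∀ k j, k < j → coord p (ρ t) j (h k) = 0) ∧ mink 5 (ρ t (h 0)) (ρ t (h 0)) = 0 ∧
      g t (h 4) = p 4 ∧ g t (h 5) = p 5 := by
  obtain ⟨t, h, hpos, hzero, hD⟩ := hP.exists_tile_staircase hT hTP hcov
  have hspan : ∀ j, 4 ≤ j → g t (h j) = p 4 ∨ g t (h j) = p 5 := fun j hj => by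
    refine hP.normal_eq_or_eq (hT t) (hTP t) (hmem t) hsec (by decide)
      (a := coord (g t) w (h j) 4) (b := coord (g t) w (h j) 5) ?_
    have hexp : g t (h j) = ∑ k, coord (g t) w (h j) k • p k := by
      simpa only [coord, mink_comm (w _)] using hP.expand' (g t (h j))
    rw [Fin.sum_univ_six, hD 0 j (by lia), hD 1 j (by lia), hD 2 j (by lia),
        hD 3 j (by lia)] at hexp
    simpa using hexp
  have h4 : g t (h 4) = p 4 := (hspan 4 le_rfl).resolve_right fun h5 => by
    have := hzero 4 5 (by decide)
    rw [(hT t).coord_eq_single h5, Pi.single_eq_same] at this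
    norm_num at this
  have h5 : g t (h 5) = p 5 := (hspan 5 (by decide)).resolve_left fun h4' => by
    have := hpos 5
    have h45 : h 4 = h 5 := by
      by_contra hne
      have h1 := (hT t).dual (h 4) (h 5)
      rw [h4, ← h4', (hT t).dual, if_pos rfl, if_neg hne] at h1
      norm_num at h1
    exact this.ne' (h45 ▸ hzero 4 5 (by decide))
  refine ⟨t, h, hpos, hzero, ?_, h4, h5⟩
  have h0 : ρ t (h 0) = coord p (ρ t) 0 (h 0) • w 0 := by
    have hexp : ρ t (h 0) = ∑ k, coord p (ρ t) k (h 0) • w k := hP.expand _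
    rwa [Finset.sum_eq_single 0 (fun k _ hk => by
      rw [hzero 0 k (Fin.pos_of_ne_zero hk), zero_smul]) (by simp)] at hexp
  rw [h0, mink_smul_left, mink_smul_right, hw, mul_zero, mul_zero]

end Tiles

lemma hSTDecomp.exists_tiling {P F : Set (hypSet 5)} {p w f z : Fin 6 → V 5}
    {𝒯 : Set (Set (hypSet 5))} (h : hSTDecomp 5 P F 𝒯) (hP : Chamber P p w) (hF : Chamber F f z)
    (hpG : ∀ i j, mink 5 (p i) (p j) = hexGram i j)
    (hfG : ∀ i j, mink 5 (f i) (f j) = gramOf pathLabel i j) :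
    ∃ C : 𝒯 → Fin 6 → Fin 6 → ℝ, Tiling C := by
  obtain ⟨⟨hfin, -, hcox, hcov, hdisj, -⟩, hcong, hsec⟩ := h
  have : Finite 𝒯 := hfin
  choose g ρ hT hG using fun T : 𝒯 => hF.congr (hcox T T.2) (hcong T T.2)
  have hTP : ∀ T : 𝒯, (T : Set (hypSet 5)) ⊆ P := fun T => hcov ▸ subset_sUnion_of_mem T.2
  have hcov' : P ⊆ ⋃ T : 𝒯, (T : Set (hypSet 5)) := by rw [← sUnion_eq_iUnion, hcov]
  have hideal := hP.ideal_of_hex hpG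
  refine ⟨fun T => coord p (ρ T), fun T => hP.rawChart (hT T) (hTP T) T.2 hsec hpG
    fun i j => (hG T i j).trans (hfG i j), fun T T' s s' hs hs' heq => ?_, fun σ hσ => ?_⟩
  · by_contra hne
    have := hP.interior_inter_nonempty (hT T) (hT T') hs hs' heq
    rw [hdisj T T.2 T' T'.2 (Subtype.coe_ne_coe.2 hne)] at this
    exact not_nonempty_empty this
  · let e : Fin 6 ≃ Fin 6 := Fin.revPerm.trans
        (Equiv.ofBijective σ (Finite.injective_iff_bijective.1 hσ))
    have he : ∀ k, e k.rev = σ k := fun k => congr_arg σ (Fin.rev_rev k)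
    obtain ⟨T, h, hpos, hzero, h0, h4, h5⟩ := (hP.comp_equiv e).exists_tile_flag
      (fun k => hideal (e k)) hsec (fun T : 𝒯 => T.2) hT hTP hcov'
    have hinj : Function.Injective h := fun a b hab => by
      by_contra hne
      rcases lt_or_gt_of_ne hne with hlt | hlt
      exacts [(hpos b).ne' (hab ▸ hzero a b hlt), (hpos a).ne' (hab ▸ hzero b a hlt)]
    refine ⟨T, h ∘ Fin.rev, hinj.comp Fin.rev_injective, ?_, ?_, ?_, fun s => ?_,
        fun s t hst _ => ?_⟩
    · exact ((hT T).ideal_iff_of_path (fun i j => (hG T i j).trans (hfG i j)) _).1 h0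
    · exact (hT T).coord_eq_single h5
    · exact (hT T).coord_eq_single h4
    · simpa only [coord, Function.comp, he] using hpos s.rev
    · simpa only [coord, Function.comp, he] using hzero t.rev s.rev (Fin.rev_lt_rev.2 hst)

/-- **(Section 3.2.2 of the paper.)** There is no Coxeter decomposition of the
second type of the hyperbolic simplex `H₁₂⁵` with fundamental simplex `H₅⁵`. -/
theorem statement14 (P F : Set ↥(hypSet 5)) (hF : IsH55 F) (hP : IsH125 P) :
    ¬∃ 𝒯, hSTDecomp 5 P F 𝒯 := by
  rintro ⟨𝒯, h⟩
  obtain ⟨p, w, hp, hpG⟩ := hP.exists_chamber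
  obtain ⟨f, z, hf, hfG⟩ := hF.exists_chamber
  obtain ⟨C, hC⟩ := h.exists_tiling hp hf
    (fun i j => (hpG i j).trans (gramOf_hexLabel i j)) hfG
  exact not_tiling hC

end CD
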